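/- There exists a minimizer of the Pekar functional among normalized functions: there is a Schwartz function ψ_Pek : ℝ³ → ℂ with ∫_{ℝ³} |ψ_Pek(x)|² dx = 1 such that 𝓔^Pek(ψ_Pek) ≤ 𝓔^Pek(ψ) for every Schwartz function ψ : ℝ³ → ℂ with ∫_{ℝ³} |ψ(x)|² dx = 1. -/

import Mathlib

open MeasureTheory Real

noncomputable section

/-- `ℝ³` as a Euclidean space. -/
abbrev E3 := EuclideanSpace ℝ (Fin 3)

/-- The Pekar functional
`𝓔^Pek(ψ) = ∫ |∇ψ|² − ∫∫ |ψ(x)|²|ψ(y)|²/|x−y| dx dy`. -/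
def pekarF (ψ : SchwartzMap E3 ℂ) : ℝ :=
  (∫ x : E3, ‖fderiv ℝ ψ x‖ ^ 2) -
    ∫ x : E3, ∫ y : E3, ‖ψ x‖ ^ 2 * ‖ψ y‖ ^ 2 / ‖x - y‖

section

open scoped ENNReal Topology FourierTransform SchwartzMap
open Filter

section ENNRealAux

theorem ENNReal.two_mul_le_sq_add_sq (a b : ℝ≥0∞) : 2 * (a * b) ≤ a ^ 2 + b ^ 2 := by
  rcases le_total a b with h | h
  · obtain ⟨c, rfl⟩ := exists_add_of_le h
    calc 2 * (a * (a + c)) ≤ 2 * (a * (a + c)) + c ^ 2 := le_self_add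
      _ = a ^ 2 + (a + c) ^ 2 := by ring
  · obtain ⟨c, rfl⟩ := exists_add_of_le h
    calc 2 * ((b + c) * b) ≤ 2 * ((b + c) * b) + c ^ 2 := le_self_add
      _ = (b + c) ^ 2 + b ^ 2 := by ring

theorem ENNReal.le_of_two_mul_le {a b : ℝ≥0∞} (h : 2 * a ≤ 2 * b) : a ≤ b :=
  (ENNReal.mul_le_mul_iff_right (by simp) (by simp)).1 h

theorem ENNReal.le_of_sq_le {a b : ℝ≥0∞} (h : a ^ 2 ≤ b ^ 2) : a ≤ b :=
  (ENNReal.pow_le_pow_left_iff two_ne_zero).1 h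

theorem sq_lintegral_mul_le {α : Type*} [MeasurableSpace α] (μ : Measure α) {f g : α → ℝ≥0∞}
    (hf : AEMeasurable f μ) (hg : AEMeasurable g μ) :
    (∫⁻ x, f x * g x ∂μ) ^ 2 ≤ (∫⁻ x, f x ^ 2 ∂μ) * ∫⁻ x, g x ^ 2 ∂μ := by
  have h := ENNReal.lintegral_mul_le_Lp_mul_Lq μ Real.HolderConjugate.two_two hf hg
  calc (∫⁻ x, f x * g x ∂μ) ^ 2
      ≤ ((∫⁻ x, f x ^ (2:ℝ) ∂μ) ^ (1 / (2:ℝ)) * (∫⁻ x, g x ^ (2:ℝ) ∂μ) ^ (1 / (2:ℝ))) ^ 2 := by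
        gcongr; exact h
    _ = _ := by
      rw [mul_pow, ← ENNReal.rpow_natCast, ← ENNReal.rpow_natCast, ← ENNReal.rpow_mul,
        ← ENNReal.rpow_mul]
      simp

/-- Weighted Cauchy–Schwarz inequality. -/
theorem sq_lintegral_mul_le_weight {α : Type*} [MeasurableSpace α] (μ : Measure α)
    {f g w : α → ℝ≥0∞} (hf : Measurable f) (hg : Measurable g)
    (hw : Measurable w) (h0 : ∀ x, w x ≠ 0) (hi : ∀ x, w x ≠ ∞) :
    (∫⁻ x, f x * g x ∂μ) ^ 2 ≤ (∫⁻ x, w x * f x ^ 2 ∂μ) * ∫⁻ x, g x ^ 2 / w x ∂μ := by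
  have h := sq_lintegral_mul_le μ (f := fun x => w x ^ (1/2 : ℝ) * f x)
    (g := fun x => w x ^ (-(1/2) : ℝ) * g x) (by fun_prop) (by fun_prop)
  have e1 : ∀ x, (w x ^ (1/2 : ℝ)) ^ 2 = w x := fun x => by
    rw [← ENNReal.rpow_natCast, ← ENNReal.rpow_mul]; simp
  have e2 : ∀ x, (w x ^ (-(1/2) : ℝ)) ^ 2 = (w x)⁻¹ := fun x => by
    rw [← ENNReal.rpow_natCast, ← ENNReal.rpow_mul]; norm_num [ENNReal.rpow_neg_one]
  have e3 : ∀ x, w x ^ (1/2 : ℝ) * w x ^ (-(1/2) : ℝ) = 1 := fun x => by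
    rw [← ENNReal.rpow_add _ _ (h0 x) (hi x)]; simp
  have e4 : ∀ x, w x ^ (1/2 : ℝ) * f x * (w x ^ (-(1/2) : ℝ) * g x) = f x * g x := fun x => by
    rw [show w x ^ (1/2 : ℝ) * f x * (w x ^ (-(1/2) : ℝ) * g x) =
      (w x ^ (1/2 : ℝ) * w x ^ (-(1/2) : ℝ)) * (f x * g x) by ring, e3, one_mul]
  simp only [e4, mul_pow, e1, e2] at h
  simpa only [div_eq_mul_inv, mul_comm] using h

end ENNRealAux

namespace Pekar

/-- The weight `1 + |k|²`. -/
def wt (k : E3) : ℝ≥0∞ := 1 + ‖k‖ₑ ^ 2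

/-- The Coulomb multiplier `|k|⁻²`. -/
def coul (k : E3) : ℝ≥0∞ := (‖k‖ₑ ^ 2)⁻¹

/-- The correlation `k ↦ ∫ a(l) b(l + k) dl`. -/
def corr (a b : E3 → ℝ≥0∞) (k : E3) : ℝ≥0∞ := ∫⁻ l, a l * b (l + k)

/-- The squared Sobolev norm in Fourier space. -/
def sob (v : E3 → ℝ≥0∞) : ℝ≥0∞ := ∫⁻ k, wt k * v k ^ 2

/-- The Coulomb energy in Fourier space. -/
def coulE (v : E3 → ℝ≥0∞) : ℝ≥0∞ := ∫⁻ k, corr v v k ^ 2 * coul k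

/-- A quarter of the derivative of the Coulomb energy at `v` in direction `h`. -/
def coulD (v h : E3 → ℝ≥0∞) : ℝ≥0∞ := ∫⁻ k, corr v v k * corr v h k * coul k

theorem measurable_wt : Measurable wt := by unfold wt; fun_prop

theorem measurable_coul : Measurable coul := by unfold coul; fun_prop

theorem one_le_wt (k : E3) : 1 ≤ wt k := le_self_add

theorem wt_ne_zero (k : E3) : wt k ≠ 0 := (zero_lt_one.trans_le (one_le_wt k)).ne'

theorem wt_ne_top (k : E3) : wt k ≠ ∞ := by simp [wt]

theorem coul_ne_zero (k : E3) : coul k ≠ 0 := by simp [coul]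

theorem coul_neg (k : E3) : coul (-k) = coul k := by simp [coul]

theorem measurable_corr {a b : E3 → ℝ≥0∞} (ha : Measurable a) (hb : Measurable b) :
    Measurable (corr a b) := by
  unfold corr
  exact Measurable.lintegral_prod_right' (f := fun p : E3 × E3 => a p.2 * b (p.2 + p.1))
    (by fun_prop)

theorem corr_neg (a b : E3 → ℝ≥0∞) (k : E3) : corr a b (-k) = corr b a k := by
  unfold corr
  rw [← lintegral_add_right_eq_self (fun l => a l * b (l + -k)) k]
  simp [mul_comm]

theorem lintegral_sq_le_sob (v : E3 → ℝ≥0∞) : ∫⁻ k, v k ^ 2 ≤ sob v :=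
  lintegral_mono fun k => le_mul_of_one_le_left (by simp) (one_le_wt k)

theorem corr_self_le_sob {v : E3 → ℝ≥0∞} (hv : Measurable v) (k : E3) :
    corr v v k ≤ sob v := by
  refine le_trans ?_ (lintegral_sq_le_sob v)
  apply ENNReal.le_of_two_mul_le
  unfold corr
  rw [← lintegral_const_mul _ (by fun_prop)]
  calc ∫⁻ l, 2 * (v l * v (l + k)) ≤ ∫⁻ l, (v l ^ 2 + v (l + k) ^ 2) :=
        lintegral_mono fun l => ENNReal.two_mul_le_sq_add_sq _ _
    _ = 2 * ∫⁻ l, v l ^ 2 := by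
      rw [lintegral_add_left (by fun_prop), lintegral_add_right_eq_self (fun l => v l ^ 2) k,
        two_mul]

theorem enorm_mul_corr_self_le_sob {v : E3 → ℝ≥0∞} (hv : Measurable v) (k : E3) :
    ‖k‖ₑ * corr v v k ≤ sob v := by
  apply ENNReal.le_of_two_mul_le
  unfold corr sob
  have hw := measurable_wt
  rw [← lintegral_const_mul _ (by fun_prop), ← lintegral_const_mul _ (by fun_prop),
    ← lintegral_const_mul _ (by fun_prop)]
  calc ∫⁻ l, 2 * (‖k‖ₑ * (v l * v (l + k)))
      ≤ ∫⁻ l, (wt l * v l ^ 2 + wt (l + k) * v (l + k) ^ 2) := by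
        refine lintegral_mono fun l => ?_
        have hk : ‖k‖ₑ ≤ ‖l‖ₑ + ‖l + k‖ₑ := by
          calc ‖k‖ₑ = ‖(l + k) - l‖ₑ := by simp
            _ ≤ ‖l + k‖ₑ + ‖l‖ₑ := enorm_sub_le
            _ = _ := add_comm _ _
        calc 2 * (‖k‖ₑ * (v l * v (l + k)))
            ≤ 2 * ((‖l‖ₑ + ‖l + k‖ₑ) * (v l * v (l + k))) := by gcongr
          _ = 2 * ((‖l‖ₑ * v l) * v (l + k)) + 2 * (v l * (‖l + k‖ₑ * v (l + k))) := by ring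
          _ ≤ ((‖l‖ₑ * v l) ^ 2 + v (l + k) ^ 2) + (v l ^ 2 + (‖l + k‖ₑ * v (l + k)) ^ 2) :=
            add_le_add (ENNReal.two_mul_le_sq_add_sq _ _) (ENNReal.two_mul_le_sq_add_sq _ _)
          _ = _ := by unfold wt; ring
    _ = ∫⁻ l, 2 * (wt l * v l ^ 2) := by
      rw [lintegral_add_left (by fun_prop),
        lintegral_add_right_eq_self (fun l => wt l * v l ^ 2) k, ← two_mul,
        lintegral_const_mul _ (by fun_prop)]

theorem corr_self_sq_le {v : E3 → ℝ≥0∞} (hv : Measurable v) (k : E3) :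
    corr v v k ^ 2 ≤ sob v ^ 2 * min 1 (coul k) := by
  rcases eq_or_ne k 0 with rfl | hk
  · have : coul (0 : E3) = ∞ := by simp [coul]
    simp only [this, le_top, min_eq_left, mul_one]
    gcongr
    exact corr_self_le_sob hv _
  · rw [mul_min, le_min_iff, mul_one]
    refine ⟨by gcongr; exact corr_self_le_sob hv _, ?_⟩
    unfold coul
    rw [← div_eq_mul_inv, ENNReal.le_div_iff_mul_le (by simp [hk]) (by simp), ← mul_pow, mul_comm]
    gcongr
    exact enorm_mul_corr_self_le_sob hv _

theorem inv_wt_le (k : E3) : (wt k)⁻¹ ≤ min 1 (coul k) := by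
  refine le_min ?_ ?_
  · simpa using one_le_wt k
  · unfold coul wt
    gcongr
    exact le_add_self

theorem wt_le_two_mul (k l : E3) : wt k ≤ 2 * wt l * wt (l + k) := by
  have hk : ‖k‖ₑ ≤ ‖l‖ₑ + ‖l + k‖ₑ := by
    calc ‖k‖ₑ = ‖(l + k) - l‖ₑ := by simp
      _ ≤ ‖l + k‖ₑ + ‖l‖ₑ := enorm_sub_le
      _ = _ := add_comm _ _
  unfold wt
  calc 1 + ‖k‖ₑ ^ 2 ≤ 1 + (‖l‖ₑ + ‖l + k‖ₑ) ^ 2 := by gcongr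
    _ = 1 + (‖l‖ₑ ^ 2 + ‖l + k‖ₑ ^ 2 + 2 * (‖l‖ₑ * ‖l + k‖ₑ)) := by ring
    _ ≤ 1 + (‖l‖ₑ ^ 2 + ‖l + k‖ₑ ^ 2 + (‖l‖ₑ ^ 2 + ‖l + k‖ₑ ^ 2)) := by
      gcongr; exact ENNReal.two_mul_le_sq_add_sq _ _
    _ ≤ 1 + (‖l‖ₑ ^ 2 + ‖l + k‖ₑ ^ 2 + (‖l‖ₑ ^ 2 + ‖l + k‖ₑ ^ 2))
        + (1 + 2 * (‖l‖ₑ ^ 2 * ‖l + k‖ₑ ^ 2)) := le_self_add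
    _ = _ := by ring

theorem corr_sq_le {a b : E3 → ℝ≥0∞} (ha : Measurable a) (hb : Measurable b) (k : E3) :
    corr a b k ^ 2 ≤ 2 * sob a * sob b * (wt k)⁻¹ := by
  have hw := measurable_wt
  calc corr a b k ^ 2 ≤ sob a * ∫⁻ l, b (l + k) ^ 2 / wt l :=
        sq_lintegral_mul_le_weight volume ha (by fun_prop) hw wt_ne_zero wt_ne_top
    _ ≤ sob a * ∫⁻ l, (2 * (wt k)⁻¹) * (wt (l + k) * b (l + k) ^ 2) := by
      gcongr with l
      rw [ENNReal.div_le_iff (wt_ne_zero _) (wt_ne_top _)]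
      calc b (l + k) ^ 2 = (wt k * (wt k)⁻¹) * b (l + k) ^ 2 := by
            rw [ENNReal.mul_inv_cancel (wt_ne_zero _) (wt_ne_top _), one_mul]
        _ ≤ (2 * wt l * wt (l + k) * (wt k)⁻¹) * b (l + k) ^ 2 := by
          gcongr; exact wt_le_two_mul k l
        _ = _ := by ring
    _ = _ := by
      rw [lintegral_const_mul _ (by fun_prop),
        lintegral_add_right_eq_self (fun l => wt l * b l ^ 2) k]
      unfold sob; ring

/-- The integral of `min (|k|⁻², |k|⁻⁴)`. -/
def coulBound : ℝ≥0∞ := ∫⁻ k, min 1 (coul k) * coul k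

theorem coulBound_lt_top : coulBound < ∞ := by
  have hInt : Integrable (fun k : E3 => (fun r : ℝ => min 1 (r ^ 2)⁻¹ * (r ^ 2)⁻¹) ‖k‖) := by
    rw [integrable_fun_norm_addHaar (volume : Measure E3)
      (f := fun r : ℝ => min 1 (r ^ 2)⁻¹ * (r ^ 2)⁻¹)]
    refine (integrable_inv_one_add_sq.const_mul 2).integrableOn.mono'
      (by fun_prop) ?_
    refine (ae_restrict_iff' measurableSet_Ioi).2 (Eventually.of_forall fun y hy => ?_)
    have hy : 0 < y := hy
    have h0 : 0 ≤ min 1 (y ^ 2)⁻¹ := by positivity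
    simp only [finrank_euclideanSpace, Fintype.card_fin, smul_eq_mul]
    rw [Real.norm_of_nonneg (by positivity)]
    have : y ^ (3 - 1) * (min 1 (y ^ 2)⁻¹ * (y ^ 2)⁻¹) = min 1 (y ^ 2)⁻¹ := by
      field_simp
    rw [this, ← div_eq_mul_inv, le_div_iff₀ (by positivity), mul_add, mul_one]
    have h1 : min 1 (y ^ 2)⁻¹ ≤ 1 := min_le_left _ _
    have h2 : min 1 (y ^ 2)⁻¹ * y ^ 2 ≤ 1 := by
      calc _ ≤ (y ^ 2)⁻¹ * y ^ 2 := by gcongr; exact min_le_right _ _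
        _ = 1 := by field_simp
    linarith
  refine lt_of_eq_of_lt (lintegral_congr_ae ?_) hInt.lintegral_lt_top
  have hne : ∀ᵐ k : E3, k ≠ 0 := by simp [ae_iff]
  filter_upwards [hne] with k hk
  have hk' : 0 < ‖k‖ ^ 2 := by positivity
  have e : coul k = ENNReal.ofReal ((‖k‖ ^ 2)⁻¹) := by
    rw [ENNReal.ofReal_inv_of_pos hk', ENNReal.ofReal_pow (norm_nonneg _), ofReal_norm]; rfl
  rw [e, ENNReal.ofReal_mul (by positivity), ENNReal.ofReal_min]
  simp

theorem measurable_coul_trunc (δ : ℝ) :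
    Measurable (Set.indicator (Metric.ball (0 : E3) δ)ᶜ coul) :=
  measurable_coul.indicator (Metric.isOpen_ball.measurableSet.compl)

theorem lintegral_inv_wt_sq_lt_top : ∫⁻ k, ((wt k)⁻¹) ^ 2 < ∞ := by
  refine lt_of_le_of_lt (lintegral_mono fun k => ?_) coulBound_lt_top
  rw [sq]
  gcongr
  · exact inv_wt_le k
  · exact (inv_wt_le k).trans (min_le_right _ _)

theorem coul_eq_of_mem_ball {k : E3} (hk : k ∈ Metric.ball (0 : E3) 1) :
    coul k = min 1 (coul k) * coul k := by
  have : (1 : ℝ≥0∞) ≤ coul k := by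
    unfold coul
    rw [ENNReal.one_le_inv]
    have : ‖k‖ₑ ≤ 1 := by
      rw [← ofReal_norm, ENNReal.ofReal_le_one]
      exact (mem_ball_zero_iff.1 hk).le
    exact pow_le_one' this 2
  rw [min_eq_left this, one_mul]

theorem setLIntegral_ball_coul_lt_top : ∫⁻ k in Metric.ball (0 : E3) 1, coul k < ∞ := by
  refine lt_of_le_of_lt ?_ coulBound_lt_top
  rw [setLIntegral_congr_fun Metric.isOpen_ball.measurableSet
    (fun k hk => coul_eq_of_mem_ball hk)]
  exact setLIntegral_le_lintegral _ _

theorem lintegral_coul_trunc_sq_lt_top {δ : ℝ} (hδ : 0 < δ) :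
    ∫⁻ k, (Set.indicator (Metric.ball (0 : E3) δ)ᶜ coul k) ^ 2 < ∞ := by
  have hD : 1 + ENNReal.ofReal ((δ ^ 2)⁻¹) < ∞ := by simp
  refine lt_of_le_of_lt (lintegral_mono fun k => ?_)
    (b := ∫⁻ k, (1 + ENNReal.ofReal ((δ ^ 2)⁻¹)) * (min 1 (coul k) * coul k)) ?_
  · by_cases hk : k ∈ (Metric.ball (0 : E3) δ)ᶜ
    · rw [Set.indicator_of_mem hk, sq, ← mul_assoc]
      gcongr
      have hk : δ ≤ ‖k‖ := by simpa using hk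
      have h1 : coul k ≤ ENNReal.ofReal ((δ ^ 2)⁻¹) := by
        unfold coul
        rw [ENNReal.ofReal_inv_of_pos (by positivity), ENNReal.ofReal_pow hδ.le, ← ofReal_norm]
        gcongr
      rw [mul_min, mul_one]
      refine le_min (h1.trans le_add_self) (le_mul_of_one_le_left (by simp) le_self_add)
    · rw [Set.indicator_of_notMem hk]; simp
  · have := measurable_coul
    rw [lintegral_const_mul _ (by fun_prop)]
    exact ENNReal.mul_lt_top hD coulBound_lt_top

theorem tendsto_setLIntegral_ball_coul :
    Tendsto (fun n : ℕ => ∫⁻ k in Metric.ball (0 : E3) (1 / ((n : ℝ) + 1)), coul k)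
      atTop (𝓝 0) := by
  have hanti : Tendsto (fun n : ℕ => volume.restrict (Metric.ball (0 : E3) 1)
      (Metric.ball (0 : E3) (1 / ((n : ℝ) + 1)))) atTop (𝓝 0) := by
    have h1 : Tendsto (fun n : ℕ => volume
      (Metric.ball (0 : E3) (1 / ((n : ℝ) + 1)))) atTop (𝓝 0) := by
      simp only [EuclideanSpace.volume_ball]
      have : Tendsto (fun n : ℕ => ENNReal.ofReal (1 / ((n : ℝ) + 1)) ^ 3) atTop (𝓝 0) := by
        have := ENNReal.Tendsto.pow (n := 3)
          (ENNReal.tendsto_ofReal (tendsto_one_div_add_atTop_nhds_zero_nat (𝕜 := ℝ)))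
        simpa using this
      have := ENNReal.Tendsto.mul_const (b := ENNReal.ofReal (√π ^ 3 / Gamma (3 / 2 + 1))) this
        (Or.inr (by simp))
      simpa using this
    exact tendsto_of_tendsto_of_tendsto_of_le_of_le tendsto_const_nhds h1 (fun _ => bot_le)
      (fun n => Measure.restrict_apply_le _ _)
  have := tendsto_setLIntegral_zero setLIntegral_ball_coul_lt_top.ne hanti
  refine this.congr fun n => ?_
  rw [Measure.restrict_restrict_of_subset]
  refine Metric.ball_subset_ball ?_
  rw [div_le_one (by positivity)]
  simp

theorem coulE_le {v : E3 → ℝ≥0∞} (hv : Measurable v) : coulE v ≤ coulBound * sob v ^ 2 := by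
  have := measurable_coul
  unfold coulE coulBound
  rw [mul_comm, ← lintegral_const_mul _ (by fun_prop)]
  refine lintegral_mono fun k => ?_
  rw [← mul_assoc]
  gcongr
  exact corr_self_sq_le hv k

theorem sob_smul (c : ℝ≥0∞) {v : E3 → ℝ≥0∞} (hv : Measurable v) :
    sob (fun k => c * v k) = c ^ 2 * sob v := by
  have := measurable_wt
  unfold sob
  rw [← lintegral_const_mul _ (by fun_prop)]
  congr with k; ring

theorem corr_smul (c : ℝ≥0∞) {v : E3 → ℝ≥0∞} (hv : Measurable v) (k : E3) :
    corr (fun k => c * v k) (fun k => c * v k) k = c ^ 2 * corr v v k := by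
  unfold corr
  rw [← lintegral_const_mul _ (by fun_prop)]
  congr with k; ring

theorem coulE_smul (c : ℝ≥0∞) {v : E3 → ℝ≥0∞} (hv : Measurable v) :
    coulE (fun k => c * v k) = c ^ 4 * coulE v := by
  have := measurable_coul
  have := measurable_corr hv hv
  unfold coulE
  rw [← lintegral_const_mul _ (by fun_prop)]
  congr with k
  rw [corr_smul c hv]; ring

/-- The optimal constant in `coulE v ≤ C * sob v ^ 2`. -/
def coulC : ℝ≥0∞ := ⨆ v ∈ {v : E3 → ℝ≥0∞ | Measurable v ∧ sob v ≤ 1}, coulE v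

theorem coulC_lt_top : coulC < ∞ := by
  refine lt_of_le_of_lt (iSup₂_le fun v hv => (coulE_le hv.1).trans ?_) coulBound_lt_top
  calc coulBound * sob v ^ 2 ≤ coulBound * 1 ^ 2 := by gcongr; exact hv.2
    _ = coulBound := by simp

theorem coulE_le_coulC {v : E3 → ℝ≥0∞} (hv : Measurable v) (hs : sob v ≠ ∞) :
    coulE v ≤ coulC * sob v ^ 2 := by
  by_cases h0 : sob v = 0
  · have := coulE_le hv
    simpa [h0] using this
  set c : ℝ≥0∞ := (sob v) ^ (-(1/2) : ℝ) with hc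
  have hc2 : c ^ 2 = (sob v)⁻¹ := by
    rw [hc, ← ENNReal.rpow_natCast, ← ENNReal.rpow_mul]; norm_num [ENNReal.rpow_neg_one]
  have h : coulE (fun k => c * v k) ≤ coulC := by
    refine le_iSup₂_of_le (f := fun (v : E3 → ℝ≥0∞)
      (_ : v ∈ {v : E3 → ℝ≥0∞ | Measurable v ∧ sob v ≤ 1}) => coulE v)
      (fun k => c * v k) ⟨by fun_prop, ?_⟩ le_rfl
    rw [sob_smul c hv, hc2, ENNReal.inv_mul_cancel h0 hs]
  rw [coulE_smul c hv, show c ^ 4 = (c ^ 2) ^ 2 by ring, hc2, ← ENNReal.inv_pow, mul_comm,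
    ← div_eq_mul_inv] at h
  rwa [← ENNReal.div_le_iff (by simp [h0]) (by simp [hs])]

theorem lintegral_corr {a b : E3 → ℝ≥0∞} (ha : Measurable a) (hb : Measurable b) :
    ∫⁻ k, corr a b k = (∫⁻ k, a k) * ∫⁻ k, b k := by
  unfold corr
  rw [lintegral_lintegral_swap (by fun_prop), ← lintegral_mul_const _ ha]
  congr with l
  rw [lintegral_const_mul _ (by fun_prop), lintegral_add_left_eq_self]

theorem coulE_ne_zero {v : E3 → ℝ≥0∞} (hv : Measurable v) (h : ∫⁻ k, v k ≠ 0) :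
    coulE v ≠ 0 := by
  intro h0
  have hm := measurable_corr hv hv
  have hc := measurable_coul
  unfold coulE at h0
  rw [lintegral_eq_zero_iff (by fun_prop)] at h0
  have : corr v v =ᵐ[volume] 0 := by
    filter_upwards [h0] with k hk
    simpa [coul_ne_zero] using hk
  have := lintegral_congr_ae this
  rw [lintegral_corr hv hv] at this
  simp [h] at this

theorem coulC_ne_zero : coulC ≠ 0 := by
  set v : E3 → ℝ≥0∞ := Set.indicator (Metric.ball 0 1) 1 with hv
  have hvm : Measurable v := measurable_one.indicator Metric.isOpen_ball.measurableSet
  have hs : sob v ≠ ∞ := by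
    have : sob v ≤ ∫⁻ k in Metric.ball (0 : E3) 1, 2 := by
      unfold sob
      rw [← lintegral_indicator Metric.isOpen_ball.measurableSet]
      refine lintegral_mono fun k => ?_
      by_cases hk : k ∈ Metric.ball (0 : E3) 1
      · have h1 : ‖k‖ₑ ≤ 1 := by
          rw [← ofReal_norm, ENNReal.ofReal_le_one]
          exact (mem_ball_zero_iff.1 hk).le
        simp only [hv, Set.indicator_of_mem hk, Pi.one_apply, one_pow, mul_one, wt]
        calc 1 + ‖k‖ₑ ^ 2 ≤ 1 + 1 := by gcongr; exact pow_le_one' h1 2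
          _ = 2 := by norm_num
      · simp [hv, Set.indicator_of_notMem hk]
    refine (this.trans_lt ?_).ne
    rw [setLIntegral_const]
    exact ENNReal.mul_lt_top (by simp) measure_ball_lt_top
  intro h0
  have h1 := coulE_le_coulC hvm hs
  rw [h0, zero_mul, nonpos_iff_eq_zero] at h1
  refine coulE_ne_zero hvm ?_ h1
  rw [hv, lintegral_indicator Metric.isOpen_ball.measurableSet]
  simpa using (Metric.measure_ball_pos volume (0 : E3) one_pos).ne'

/-- A maximizing sequence. -/
theorem exists_seq_tendsto_coulC : ∃ v : ℕ → E3 → ℝ≥0∞, (∀ n, Measurable (v n)) ∧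
    (∀ n, sob (v n) ≤ 1) ∧ Tendsto (fun n => coulE (v n)) atTop (𝓝 coulC) := by
  have e : coulC = sSup (coulE '' {v : E3 → ℝ≥0∞ | Measurable v ∧ sob v ≤ 1}) := by
    rw [sSup_image]; rfl
  obtain ⟨u, -, hu, hmem⟩ := exists_seq_tendsto_sSup
    (S := coulE '' {v : E3 → ℝ≥0∞ | Measurable v ∧ sob v ≤ 1})
    ⟨_, (fun _ => 0), ⟨measurable_const, by simp [sob]⟩, rfl⟩ (by simp)
  choose v hv hvu using hmem
  refine ⟨v, fun n => (hv n).1, fun n => (hv n).2, ?_⟩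
  simpa only [hvu, e] using hu

end Pekar

/-- Bounded sequences in a separable Hilbert space have weakly convergent subsequences. -/
theorem exists_subseq_tendsto_inner {H : Type*} [NormedAddCommGroup H] [InnerProductSpace ℝ H]
    [CompleteSpace H] [TopologicalSpace.SeparableSpace H] (g : ℕ → H) (hg : ∀ n, ‖g n‖ ≤ 1) :
    ∃ φ : ℕ → ℕ, StrictMono φ ∧ ∃ g' : H, ‖g'‖ ≤ 1 ∧
      ∀ f : H, Tendsto (fun n => inner ℝ (g (φ n)) f) atTop (𝓝 (inner ℝ g' f)) := by
  let u : ℕ → WeakDual ℝ H := fun n => StrongDual.toWeakDual (InnerProductSpace.toDual ℝ H (g n))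
  obtain ⟨ℓ, hℓ, φ, hφ, hlim⟩ := WeakDual.isSeqCompact_closedBall (𝕜 := ℝ) (E := H) 0 1
    (x := u) (fun n => by simpa [u] using hg n)
  refine ⟨φ, hφ, (InnerProductSpace.toDual ℝ H).symm (WeakDual.toStrongDual ℓ), ?_, fun f => ?_⟩
  · simpa using hℓ
  · have := ((WeakDual.eval_continuous f).tendsto ℓ).comp hlim
    simpa [u, Function.comp_def] using this

theorem memLp_two_toReal {α : Type*} [MeasurableSpace α] {μ : Measure α} {f : α → ℝ≥0∞}
    (hf : Measurable f) (h : ∫⁻ x, f x ^ 2 ∂μ ≠ ∞) : MemLp (fun x => (f x).toReal) 2 μ := by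
  refine ⟨hf.ennreal_toReal.aestronglyMeasurable, ?_⟩
  rw [eLpNorm_lt_top_iff_lintegral_rpow_enorm_lt_top (by simp) (by simp)]
  refine lt_of_le_of_lt (lintegral_mono fun x => ?_) h.lt_top
  simp only [ENNReal.toReal_ofNat]
  rw [← ENNReal.rpow_natCast]
  push_cast
  gcongr
  rw [Real.enorm_of_nonneg ENNReal.toReal_nonneg]
  exact ENNReal.ofReal_toReal_le

theorem lintegral_enorm_sq_eq_norm_sq {α : Type*} [MeasurableSpace α] {μ : Measure α}
    (g : Lp ℝ 2 μ) : ∫⁻ x, ‖g x‖ₑ ^ 2 ∂μ = ENNReal.ofReal (‖g‖ ^ 2) := by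
  rw [ENNReal.ofReal_pow (norm_nonneg _), Lp.norm_def, ENNReal.ofReal_toReal (Lp.eLpNorm_ne_top g),
    eLpNorm_eq_lintegral_rpow_enorm_toReal (by simp) (by simp), ← ENNReal.rpow_natCast,
    ← ENNReal.rpow_mul]
  norm_num

/-- The `L²` class of the real-valued version of `f`. -/
theorem lintegral_mul_eq_ofReal_inner {α : Type*} [MeasurableSpace α] {μ : Measure α}
    {f : α → ℝ≥0∞} {g : Lp ℝ 2 μ} (hf : Measurable f) (h : ∫⁻ x, f x ^ 2 ∂μ ≠ ∞)
    (hg : 0 ≤ᵐ[μ] g) :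
    ∫⁻ x, ENNReal.ofReal (g x) * f x ∂μ
      = ENNReal.ofReal (inner ℝ g ((memLp_two_toReal hf h).toLp)) := by
  have hin : ∀ a b : ℝ, inner ℝ a b = a * b := fun a b => by simp [mul_comm]
  rw [L2.inner_def, ofReal_integral_eq_lintegral_ofReal]
  · have hfin : ∀ᵐ x ∂μ, f x < ∞ := by
      filter_upwards [ae_lt_top (hf.pow_const 2) h] with x hx
      simpa using hx
    refine lintegral_congr_ae ?_
    filter_upwards [hg, (memLp_two_toReal hf h).coeFn_toLp, hfin] with x h1 h2 h3
    rw [h2]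
    rw [hin, mul_comm (g x), ENNReal.ofReal_mul ENNReal.toReal_nonneg, ENNReal.ofReal_toReal h3.ne,
      mul_comm]
  · exact L2.integrable_inner _ _
  · filter_upwards [hg, (memLp_two_toReal hf h).coeFn_toLp] with x h1 h2
    rw [h2]
    rw [hin]
    exact mul_nonneg h1 ENNReal.toReal_nonneg

/-- Weak sequential compactness of the unit ball for nonnegative functions in `L²`. -/
theorem exists_subseq_tendsto_lintegral_mul {α : Type*} [MeasurableSpace α] {μ : Measure α}
    [SigmaFinite μ] [TopologicalSpace.SeparableSpace (Lp ℝ 2 μ)] (v : ℕ → α → ℝ≥0∞)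
    (hv : ∀ n, Measurable (v n)) (hs : ∀ n, ∫⁻ x, v n x ^ 2 ∂μ ≤ 1) :
    ∃ φ : ℕ → ℕ, StrictMono φ ∧ ∃ w : α → ℝ≥0∞, Measurable w ∧ ∫⁻ x, w x ^ 2 ∂μ ≤ 1 ∧
      ∀ f, Measurable f → ∫⁻ x, f x ^ 2 ∂μ ≠ ∞ →
        Tendsto (fun n => ∫⁻ x, v (φ n) x * f x ∂μ) atTop (𝓝 (∫⁻ x, w x * f x ∂μ)) := by
  have hs' : ∀ n, ∫⁻ x, v n x ^ 2 ∂μ ≠ ∞ := fun n => ((hs n).trans_lt (by simp)).ne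
  let g : ℕ → Lp ℝ 2 μ := fun n => (memLp_two_toReal (hv n) (hs' n)).toLp
  have hgv : ∀ n, ∀ᵐ x ∂μ, g n x = (v n x).toReal := fun n => MemLp.coeFn_toLp _
  have hg0 : ∀ n, 0 ≤ᵐ[μ] g n := fun n => by
    filter_upwards [hgv n] with x hx
    rw [hx]; exact ENNReal.toReal_nonneg
  have hvfin : ∀ n, ∀ᵐ x ∂μ, ENNReal.ofReal (g n x) = v n x := fun n => by
    filter_upwards [hgv n, ae_lt_top ((hv n).pow_const 2) (hs' n)] with x h1 hx
    rw [h1, ENNReal.ofReal_toReal]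
    have : v n x < ∞ := by simpa using hx
    exact this.ne
  have hgn : ∀ n, ‖g n‖ ≤ 1 := fun n => by
    have h1 := lintegral_enorm_sq_eq_norm_sq (g n)
    have h2 : ∫⁻ x, ‖g n x‖ₑ ^ 2 ∂μ ≤ 1 := by
      refine le_trans (le_of_eq (lintegral_congr_ae ?_)) (hs n)
      filter_upwards [hvfin n, hg0 n] with x h1 h2
      rw [← h1, Real.enorm_of_nonneg h2]
    rw [h1, ENNReal.ofReal_le_one] at h2
    exact (sq_le_one_iff₀ (norm_nonneg _)).1 h2
  obtain ⟨φ, hφ, g', hg', hlim⟩ := exists_subseq_tendsto_inner g hgn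
  have hg'0 : 0 ≤ᵐ[μ] g' := by
    refine ae_nonneg_of_forall_setIntegral_nonneg_of_sigmaFinite
      (fun s hs hμ => ?_) (fun s hs hμ => ?_)
    · have : IsFiniteMeasure (μ.restrict s) := ⟨by simpa using hμ⟩
      exact ((Lp.memLp g').restrict s).integrable one_le_two
    · have := hlim (indicatorConstLp 2 hs hμ.ne (1 : ℝ))
      simp only [fun x : Lp ℝ 2 μ => (real_inner_comm x (indicatorConstLp 2 hs hμ.ne (1 : ℝ))).symm,
        L2.inner_indicatorConstLp_one] at this
      exact ge_of_tendsto' this fun n => integral_nonneg_of_ae (ae_restrict_of_ae (hg0 _))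
  refine ⟨φ, hφ, fun x => ENNReal.ofReal (g' x), by fun_prop, ?_, fun f hf h => ?_⟩
  · have : ∫⁻ x, ENNReal.ofReal (g' x) ^ 2 ∂μ = ∫⁻ x, ‖g' x‖ₑ ^ 2 ∂μ := by
      refine lintegral_congr_ae ?_
      filter_upwards [hg'0] with x hx
      rw [Real.enorm_of_nonneg hx]
    rw [this, lintegral_enorm_sq_eq_norm_sq, ENNReal.ofReal_le_one]
    exact pow_le_one₀ (norm_nonneg _) hg'
  · rw [lintegral_mul_eq_ofReal_inner hf h hg'0]
    refine (ENNReal.tendsto_ofReal (hlim _)).congr fun n => ?_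
    rw [← lintegral_mul_eq_ofReal_inner hf h (hg0 _)]
    refine lintegral_congr_ae ?_
    filter_upwards [hvfin (φ n)] with x hx
    rw [hx]

namespace Pekar

/-- Weak convergence, tested against all `h` in the dual of the Sobolev space. -/
def WeakTendsto (v : ℕ → E3 → ℝ≥0∞) (w : E3 → ℝ≥0∞) : Prop :=
  ∀ h, Measurable h → ∫⁻ k, h k ^ 2 / wt k ≠ ∞ →
    Tendsto (fun n => ∫⁻ k, v n k * h k) atTop (𝓝 (∫⁻ k, w k * h k))

theorem exists_subseq_weakTendsto (v : ℕ → E3 → ℝ≥0∞) (hv : ∀ n, Measurable (v n))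
    (hs : ∀ n, sob (v n) ≤ 1) : ∃ φ : ℕ → ℕ, StrictMono φ ∧ ∃ w : E3 → ℝ≥0∞, Measurable w ∧
      sob w ≤ 1 ∧ WeakTendsto (fun n => v (φ n)) w := by
  have : Fact ((2 : ℝ≥0∞) ≠ ∞) := ⟨by simp⟩
  have hwt := measurable_wt
  set s : E3 → ℝ≥0∞ := fun k => wt k ^ (1 / 2 : ℝ) with hsdef
  have hsm : Measurable s := by fun_prop
  have hs2 : ∀ k, s k ^ 2 = wt k := fun k => by
    rw [hsdef]; simp only
    rw [← ENNReal.rpow_natCast, ← ENNReal.rpow_mul]; simp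
  have hs0 : ∀ k, s k ≠ 0 := fun k h => wt_ne_zero k (by rw [← hs2, h]; simp)
  have hsi : ∀ k, s k ≠ ∞ := fun k h => wt_ne_top k (by rw [← hs2, h]; simp)
  obtain ⟨φ, hφ, w, hw, hw1, hlim⟩ := exists_subseq_tendsto_lintegral_mul (μ := volume)
    (fun n k => s k * v n k) (fun n => by have := hv n; fun_prop) (fun n => by
      have h := hs n
      unfold sob at h
      simpa only [mul_pow, hs2] using h)
  refine ⟨φ, hφ, fun k => (s k)⁻¹ * w k, by fun_prop, ?_, fun h hh hfin => ?_⟩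
  · refine le_trans (le_of_eq ?_) hw1
    unfold sob
    congr with k
    rw [← hs2, ← mul_pow, ← mul_assoc, ENNReal.mul_inv_cancel (hs0 k) (hsi k), one_mul]
  · have := hlim (fun k => (s k)⁻¹ * h k) (by fun_prop) (by
      refine (lt_of_le_of_lt (le_of_eq ?_) hfin.lt_top).ne
      congr with k
      rw [mul_pow, ← ENNReal.inv_pow, hs2, div_eq_mul_inv, mul_comm])
    convert this using 3 with n
    · congr with k
      calc v (φ n) k * h k = (s k * (s k)⁻¹) * (v (φ n) k * h k) := by
            rw [ENNReal.mul_inv_cancel (hs0 k) (hsi k), one_mul]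
        _ = _ := by ring
    · congr with k
      ring

end Pekar

theorem ENNReal.tendsto_zero_of_sq_le {x y : ℕ → ℝ≥0∞} (h : ∀ n, x n ^ 2 ≤ y n)
    (hy : Tendsto y atTop (𝓝 0)) : Tendsto x atTop (𝓝 0) := by
  have h1 := (ENNReal.continuous_rpow_const (y := (1 / 2 : ℝ))).tendsto 0 |>.comp hy
  rw [ENNReal.zero_rpow_of_pos (by norm_num)] at h1
  refine tendsto_of_tendsto_of_tendsto_of_le_of_le tendsto_const_nhds h1 (fun n => bot_le)
    fun n => ?_
  have h2 : x n = (x n ^ 2) ^ (1 / 2 : ℝ) := by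
    rw [← ENNReal.rpow_natCast, ← ENNReal.rpow_mul]; simp
  rw [h2]
  exact ENNReal.rpow_le_rpow (h n) (by norm_num)

namespace Pekar

theorem coulD_self (v : E3 → ℝ≥0∞) : coulD v v = coulE v := by
  simp only [coulD, coulE, sq]

theorem lintegral_corr_mul {a b φ : E3 → ℝ≥0∞} (ha : Measurable a) (hb : Measurable b)
    (hφ : Measurable φ) : ∫⁻ k, corr a b k * φ k = ∫⁻ l, a l * corr φ b l := by
  unfold corr
  have e1 : ∀ k, (∫⁻ l, a l * b (l + k)) * φ k = ∫⁻ l, a l * b (l + k) * φ k := fun k =>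
    (lintegral_mul_const _ (by fun_prop)).symm
  have e2 : ∀ l, a l * ∫⁻ k, φ k * b (k + l) = ∫⁻ k, a l * (φ k * b (k + l)) := fun l =>
    (lintegral_const_mul _ (by fun_prop)).symm
  simp only [e1, e2]
  rw [lintegral_lintegral_swap (by fun_prop)]
  congr with l
  congr with k
  rw [add_comm l k]; ring

theorem lintegral_corr_swap_mul_coul (v h : E3 → ℝ≥0∞) :
    ∫⁻ k, corr v v k * corr h v k * coul k = coulD v h := by
  unfold coulD
  rw [← lintegral_neg_eq_self]
  congr with k
  rw [corr_neg, corr_neg, coul_neg]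

theorem corr_self_sq_le_of_le_add {v z h : E3 → ℝ≥0∞} {t : ℝ≥0∞} (hv : Measurable v)
    (hz : Measurable z) (hh : Measurable h) (h1 : ∀ k, v k ≤ z k + t * h k) (h2 : ∀ k, z k ≤ v k)
    (k : E3) : corr v v k ^ 2 ≤
      corr z z k ^ 2 + 2 * t * (corr v v k * corr v h k + corr v v k * corr h v k) := by
  set B := corr v h k + corr h v k with hB
  have e1 : corr v v k ≤ corr z z k + t * B := by
    calc corr v v k ≤ ∫⁻ l, (z l * z (l + k) + t * (v l * h (l + k) + h l * v (l + k))) := by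
          refine lintegral_mono fun l => ?_
          calc v l * v (l + k) ≤ (z l + t * h l) * v (l + k) := by gcongr; exact h1 l
            _ = z l * v (l + k) + t * (h l * v (l + k)) := by ring
            _ ≤ z l * (z (l + k) + t * h (l + k)) + t * (h l * v (l + k)) := by
                gcongr; exact h1 _
            _ = z l * z (l + k) + t * (z l * h (l + k) + h l * v (l + k)) := by ring
            _ ≤ _ := by gcongr; exact h2 l
      _ = _ := by
          rw [lintegral_add_left (by fun_prop), lintegral_const_mul _ (by fun_prop),
            lintegral_add_left (by fun_prop)]
          rfl
  have e2 : corr z z k ≤ corr v v k := lintegral_mono fun l => by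
    simp only; gcongr <;> exact h2 _
  calc corr v v k ^ 2 = corr v v k * corr v v k := sq _
    _ ≤ (corr z z k + t * B) * corr v v k := by gcongr
    _ = corr z z k * corr v v k + t * (corr v v k * B) := by ring
    _ ≤ corr z z k * (corr z z k + t * B) + t * (corr v v k * B) := by gcongr
    _ = corr z z k ^ 2 + t * (corr z z k * B) + t * (corr v v k * B) := by ring
    _ ≤ corr z z k ^ 2 + t * (corr v v k * B) + t * (corr v v k * B) := by gcongr
    _ = _ := by rw [hB]; ring

theorem coulE_le_of_le_add {v z h : E3 → ℝ≥0∞} {t : ℝ≥0∞} (hv : Measurable v)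
    (hz : Measurable z) (hh : Measurable h) (h1 : ∀ k, v k ≤ z k + t * h k)
    (h2 : ∀ k, z k ≤ v k) : coulE v ≤ coulE z + 4 * t * coulD v h := by
  have hc := measurable_coul
  have m1 := measurable_corr hv hv
  have m2 := measurable_corr hv hh
  have m3 := measurable_corr hh hv
  have m4 := measurable_corr hz hz
  calc coulE v ≤ ∫⁻ k, (corr z z k ^ 2 * coul k + 2 * t * (corr v v k * corr v h k * coul k
        + corr v v k * corr h v k * coul k)) := by
        refine lintegral_mono fun k => ?_
        calc corr v v k ^ 2 * coul k ≤ (corr z z k ^ 2 + 2 * t *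
              (corr v v k * corr v h k + corr v v k * corr h v k)) * coul k := by
              gcongr; exact corr_self_sq_le_of_le_add hv hz hh h1 h2 k
          _ = _ := by ring
    _ = coulE z + 2 * t * (coulD v h + coulD v h) := by
        rw [lintegral_add_left (by fun_prop), lintegral_const_mul _ (by fun_prop),
          lintegral_add_left (by fun_prop), lintegral_corr_swap_mul_coul]
        rfl
    _ = _ := by ring

theorem sob_tsub_add_le {v h : E3 → ℝ≥0∞} {t : ℝ≥0∞} (hv : Measurable v) (hh : Measurable h) :
    sob (fun k => v k - t * h k) + 2 * t * ∫⁻ k, v k * (wt k * h k) ≤ sob v + t ^ 2 * sob h := by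
  have hw := measurable_wt
  unfold sob
  rw [← lintegral_const_mul _ (by fun_prop), ← lintegral_const_mul _ (by fun_prop),
    ← lintegral_add_left (by fun_prop), ← lintegral_add_left (by fun_prop)]
  refine lintegral_mono fun k => ?_
  have : (v k - t * h k) ^ 2 + 2 * (v k * (t * h k)) ≤ v k ^ 2 + (t * h k) ^ 2 := by
    rcases le_total (v k) (t * h k) with hle | hle
    · rw [tsub_eq_zero_of_le hle]
      simpa using ENNReal.two_mul_le_sq_add_sq (v k) (t * h k)
    · obtain ⟨c, hc⟩ := exists_add_of_le hle
      have : v k = (v k - t * h k) + t * h k := (tsub_add_cancel_of_le hle).symm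
      set z := v k - t * h k
      rw [this]
      exact le_of_eq (by ring)
  calc wt k * (v k - t * h k) ^ 2 + 2 * t * (v k * (wt k * h k))
      = wt k * ((v k - t * h k) ^ 2 + 2 * (v k * (t * h k))) := by ring
    _ ≤ wt k * (v k ^ 2 + (t * h k) ^ 2) := by gcongr
    _ = _ := by ring

theorem coulE_add_mul_le {v h : E3 → ℝ≥0∞} {t : ℝ≥0∞} (hv : Measurable v) (hh : Measurable h) :
    coulE v + 4 * t * coulD v h ≤ coulE (fun k => v k + t * h k) := by
  have hc := measurable_coul
  have m1 := measurable_corr hv hv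
  have m2 := measurable_corr hv hh
  have m3 := measurable_corr hh hv
  calc coulE v + 4 * t * coulD v h = coulE v + 2 * t * (coulD v h + coulD v h) := by ring
    _ = ∫⁻ k, (corr v v k ^ 2 * coul k + 2 * t * (corr v v k * corr v h k * coul k
        + corr v v k * corr h v k * coul k)) := by
        rw [lintegral_add_left (by fun_prop), lintegral_const_mul _ (by fun_prop),
          lintegral_add_left (by fun_prop), lintegral_corr_swap_mul_coul]
        rfl
    _ ≤ _ := by
        refine lintegral_mono fun k => ?_
        have e : corr v v k + t * (corr v h k + corr h v k) ≤
            corr (fun k => v k + t * h k) (fun k => v k + t * h k) k := by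
          unfold corr
          rw [← lintegral_add_left (by fun_prop), ← lintegral_const_mul _ (by fun_prop),
            ← lintegral_add_left (by fun_prop)]
          refine lintegral_mono fun l => ?_
          calc v l * v (l + k) + t * (v l * h (l + k) + h l * v (l + k))
              ≤ v l * v (l + k) + t * (v l * h (l + k) + h l * v (l + k))
                + t ^ 2 * (h l * h (l + k)) := le_self_add
            _ = _ := by ring
        calc corr v v k ^ 2 * coul k + 2 * t * (corr v v k * corr v h k * coul k
              + corr v v k * corr h v k * coul k)
            = (corr v v k ^ 2 + 2 * t * (corr v v k * (corr v h k + corr h v k))) * coul k := by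
              ring
          _ ≤ (corr v v k ^ 2 + 2 * t * (corr v v k * (corr v h k + corr h v k))
              + (t * (corr v h k + corr h v k)) ^ 2) * coul k :=
              mul_le_mul_left le_self_add _
          _ = (corr v v k + t * (corr v h k + corr h v k)) ^ 2 * coul k := by ring
          _ ≤ _ := by gcongr

theorem sob_add_mul {v h : E3 → ℝ≥0∞} {t : ℝ≥0∞} (hv : Measurable v) (hh : Measurable h) :
    sob (fun k => v k + t * h k) =
      sob v + 2 * t * (∫⁻ k, v k * (wt k * h k)) + t ^ 2 * sob h := by
  have hw := measurable_wt
  unfold sob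
  rw [← lintegral_const_mul _ (by fun_prop), ← lintegral_const_mul _ (by fun_prop),
    ← lintegral_add_left (by fun_prop), ← lintegral_add_left (by fun_prop)]
  congr with k
  ring

/-- Against a square-integrable multiplier, correlations are weakly upper semicontinuous. -/
theorem WeakTendsto.exists_lintegral_corr_le {v : ℕ → E3 → ℝ≥0∞} {w φ : E3 → ℝ≥0∞}
    (hlim : WeakTendsto v w) (hv : ∀ n, Measurable (v n)) (hs : ∀ n, sob (v n) ≤ 1)
    (hw : Measurable w) (hsw : sob w ≤ 1) (hφ : Measurable φ) (hφ2 : ∫⁻ k, φ k ^ 2 ≠ ∞) :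
    ∃ u : ℕ → ℝ≥0∞, (∀ n, ∫⁻ k, corr (v n) (v n) k * φ k ≤ u n) ∧
      Tendsto u atTop (𝓝 (∫⁻ k, corr w w k * φ k)) := by
  have hwt := measurable_wt
  set J : E3 → ℝ≥0∞ := fun l => ∫⁻ k, φ k ^ 2 / wt (k + l) with hJ
  have hJm : Measurable J :=
    Measurable.lintegral_prod_right' (f := fun p : E3 × E3 => φ p.2 ^ 2 / wt (p.2 + p.1))
      (by fun_prop)
  have hJtop : ∀ l, J l ≠ ∞ := fun l => by
    refine (lt_of_le_of_lt (lintegral_mono fun k => ?_) hφ2.lt_top).ne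
    exact ENNReal.div_le_of_le_mul (le_mul_of_one_le_right bot_le (one_le_wt _))
  have hcorrJ : ∀ a : E3 → ℝ≥0∞, Measurable a → sob a ≤ 1 → ∀ l, corr φ a l ^ 2 ≤ J l := by
    intro a ha hsa l
    have h1 := sq_lintegral_mul_le_weight volume (f := fun k => a (k + l)) (g := φ)
      (w := fun k => wt (k + l)) (by fun_prop) hφ (by fun_prop) (fun k => wt_ne_zero _)
      (fun k => wt_ne_top _)
    calc corr φ a l ^ 2 = (∫⁻ k, a (k + l) * φ k) ^ 2 := by
          unfold corr; simp_rw [mul_comm]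
      _ ≤ _ := h1
      _ = sob a * J l := by
          rw [lintegral_add_right_eq_self (fun k => wt k * a k ^ 2)]; rfl
      _ ≤ 1 * J l := by gcongr
      _ = J l := one_mul _
  have hJint : ∫⁻ l, J l / wt l ≠ ∞ := by
    set K := ∫⁻ k, ((wt k)⁻¹) ^ 2 with hK
    have hKt : K < ∞ := lintegral_inv_wt_sq_lt_top
    have hcc : ∀ k, ∫⁻ l, (wt l)⁻¹ * (wt (k + l))⁻¹ ≤ K := fun k => by
      apply ENNReal.le_of_sq_le
      refine (sq_lintegral_mul_le volume (by fun_prop) (by fun_prop)).trans ?_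
      rw [lintegral_add_left_eq_self (fun l => (wt l)⁻¹ ^ 2), ← hK, sq]
    have : ∫⁻ l, J l / wt l = ∫⁻ k, φ k ^ 2 * ∫⁻ l, (wt l)⁻¹ * (wt (k + l))⁻¹ := by
      calc ∫⁻ l, J l / wt l = ∫⁻ l, ∫⁻ k, φ k ^ 2 * ((wt l)⁻¹ * (wt (k + l))⁻¹) := by
            congr with l
            rw [hJ, div_eq_mul_inv, ← lintegral_mul_const _ (by fun_prop)]
            congr with k
            rw [div_eq_mul_inv]; ring
        _ = _ := by
            rw [lintegral_lintegral_swap (by fun_prop)]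
            congr with k
            rw [lintegral_const_mul _ (by fun_prop)]
    rw [this]
    refine (lt_of_le_of_lt (lintegral_mono fun k => mul_le_mul_right (hcc k) _) ?_).ne
    rw [lintegral_mul_const _ (by fun_prop)]
    exact ENNReal.mul_lt_top hφ2.lt_top hKt
  have hΦtop : ∀ l, corr φ w l ≠ ∞ := fun l h => hJtop l (by
    have := hcorrJ w hw hsw l; rw [h] at this; simpa using this)
  have hpt : ∀ l, Tendsto (fun n => corr φ (v n) l) atTop (𝓝 (corr φ w l)) := fun l => by
    have := hlim (fun k => φ (k - l)) (by fun_prop) (by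
      refine (lt_of_le_of_lt (lintegral_mono fun k =>
        ENNReal.div_le_of_le_mul (le_mul_of_one_le_right bot_le (one_le_wt _))) ?_).ne
      rw [lintegral_sub_right_eq_self (fun k => φ k ^ 2)]
      exact hφ2.lt_top)
    have e : ∀ a : E3 → ℝ≥0∞, corr φ a l = ∫⁻ k, a k * φ (k - l) := fun a => by
      unfold corr
      rw [← lintegral_add_right_eq_self (fun k => a k * φ (k - l)) l]
      simp [mul_comm]
    simpa only [e] using this
  have hm : ∀ n, Measurable (corr φ (v n)) := fun n => measurable_corr hφ (hv n)
  have hm' : Measurable (corr φ w) := measurable_corr hφ hw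
  have hd : Tendsto (fun n => ∫⁻ l, (corr φ (v n) l - corr φ w l) ^ 2 / wt l) atTop (𝓝 0) := by
    have := tendsto_lintegral_of_dominated_convergence (μ := volume)
      (F := fun n l => (corr φ (v n) l - corr φ w l) ^ 2 / wt l) (f := fun _ => 0)
      (fun l => J l / wt l) (fun n => by have := hm n; fun_prop)
      (fun n => Eventually.of_forall fun l => by
        simp only
        gcongr
        exact (pow_le_pow_left' tsub_le_self 2).trans (hcorrJ _ (hv n) (hs n) l)) hJint
      (Eventually.of_forall fun l => by
        have h1 := ENNReal.Tendsto.sub (hpt l) (tendsto_const_nhds (x := corr φ w l))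
          (Or.inl (hΦtop l))
        rw [tsub_self] at h1
        have h2 := ENNReal.Tendsto.div_const (ENNReal.Tendsto.pow (n := 2) h1)
          (b := wt l) (Or.inr (wt_ne_zero l))
        simpa using h2)
    simpa using this
  refine ⟨fun n => (∫⁻ l, v n l * corr φ w l) + ∫⁻ l, v n l * (corr φ (v n) l - corr φ w l),
    fun n => ?_, ?_⟩
  · simp only
    rw [lintegral_corr_mul (hv n) (hv n) hφ, ← lintegral_add_left (by have := hv n; fun_prop)]
    refine lintegral_mono fun l => ?_
    rw [← mul_add]
    gcongr
    exact le_add_tsub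
  · rw [lintegral_corr_mul hw hw hφ, ← add_zero (∫⁻ l, w l * corr φ w l)]
    refine Tendsto.add (hlim _ hm' ?_) ?_
    · refine (lt_of_le_of_lt (lintegral_mono fun l => ?_) hJint.lt_top).ne
      simp only
      gcongr
      exact hcorrJ w hw hsw l
    · refine ENNReal.tendsto_zero_of_sq_le (fun n => ?_) hd
      refine (sq_lintegral_mul_le_weight volume (hv n) ((hm n).sub hm') hwt
        wt_ne_zero wt_ne_top).trans ?_
      calc _ ≤ 1 * _ := mul_le_mul_left (hs n) _
        _ = _ := one_mul _

theorem corr_congr_ae {a a' b b' : E3 → ℝ≥0∞} (ha : a =ᵐ[volume] a') (hb : b =ᵐ[volume] b') :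
    corr a b = corr a' b' := by
  funext k
  refine lintegral_congr_ae ?_
  filter_upwards [ha, (measurePreserving_add_right volume k).quasiMeasurePreserving.ae hb]
    with l h1 h2
  rw [h1, h2]

/-- Concentration of the Coulomb singularity does not obstruct upper semicontinuity. -/
theorem WeakTendsto.eventually_lintegral_mul_coul_lt {v : ℕ → E3 → ℝ≥0∞} {w q : E3 → ℝ≥0∞}
    {K M : ℝ≥0∞} (hlim : WeakTendsto v w) (hv : ∀ n, Measurable (v n)) (hs : ∀ n, sob (v n) ≤ 1)
    (hw : Measurable w) (hsw : sob w ≤ 1) (hq : Measurable q) (hqK : ∀ k, q k ≤ K) (hK : K ≠ ∞)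
    (hM : ∫⁻ k, corr w w k * q k * coul k < M) :
    ∀ᶠ n in atTop, ∫⁻ k, corr (v n) (v n) k * q k * coul k < M := by
  have hc := measurable_coul
  have h1 : Tendsto (fun m : ℕ => K * (∫⁻ k in Metric.ball (0 : E3) (1 / ((m : ℝ) + 1)), coul k)
      + ∫⁻ k, corr w w k * q k * coul k) atTop (𝓝 (∫⁻ k, corr w w k * q k * coul k)) := by
    have := (ENNReal.Tendsto.const_mul tendsto_setLIntegral_ball_coul (Or.inr hK)).add
      (tendsto_const_nhds (x := ∫⁻ k, corr w w k * q k * coul k))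
    simpa using this
  obtain ⟨m, hm⟩ := (h1.eventually_lt_const hM).exists
  set δ : ℝ := 1 / ((m : ℝ) + 1) with hδ
  have hδ0 : 0 < δ := by positivity
  set c' : E3 → ℝ≥0∞ := Set.indicator (Metric.ball (0 : E3) δ)ᶜ coul with hc'
  have hc'm : Measurable c' := measurable_coul_trunc δ
  obtain ⟨u, hu, hulim⟩ := hlim.exists_lintegral_corr_le (φ := fun k => q k * c' k) hv hs hw hsw
    (by fun_prop) (by
      have : ∫⁻ k, (q k * c' k) ^ 2 ≤ ∫⁻ k, K ^ 2 * c' k ^ 2 := lintegral_mono fun k => by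
        rw [mul_pow]
        gcongr
        exact hqK k
      rw [lintegral_const_mul _ (by fun_prop)] at this
      exact (this.trans_lt (ENNReal.mul_lt_top (ENNReal.pow_lt_top hK.lt_top)
        (lintegral_coul_trunc_sq_lt_top hδ0))).ne)
  have h2 : Tendsto (fun n => K * (∫⁻ k in Metric.ball (0 : E3) δ, coul k) + u n) atTop
      (𝓝 (K * (∫⁻ k in Metric.ball (0 : E3) δ, coul k) + ∫⁻ k, corr w w k * (q k * c' k))) :=
    tendsto_const_nhds.add hulim
  have h3 : K * (∫⁻ k in Metric.ball (0 : E3) δ, coul k) + ∫⁻ k, corr w w k * (q k * c' k) < M := by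
    refine lt_of_le_of_lt ?_ hm
    refine add_le_add le_rfl (lintegral_mono fun k => ?_)
    rw [← mul_assoc]
    exact mul_le_mul_right (Set.indicator_le_self _ _ _) _
  filter_upwards [h2.eventually_lt_const h3] with n hn
  refine lt_of_le_of_lt ?_ hn
  have m1 := measurable_corr (hv n) (hv n)
  calc ∫⁻ k, corr (v n) (v n) k * q k * coul k
      ≤ ∫⁻ k, (K * Set.indicator (Metric.ball (0 : E3) δ) coul k
        + corr (v n) (v n) k * (q k * c' k)) := by
        refine lintegral_mono fun k => ?_
        by_cases hk : k ∈ Metric.ball (0 : E3) δ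
        · rw [Set.indicator_of_mem hk]
          refine le_trans ?_ le_self_add
          gcongr
          calc corr (v n) (v n) k * q k ≤ 1 * K := by
                gcongr
                · exact (corr_self_le_sob (hv n) k).trans (hs n)
                · exact hqK k
            _ = K := one_mul _
        · rw [hc', Set.indicator_of_mem (show k ∈ (Metric.ball (0 : E3) δ)ᶜ from hk), mul_assoc]
          exact le_add_self
    _ = K * (∫⁻ k in Metric.ball (0 : E3) δ, coul k) + ∫⁻ k, corr (v n) (v n) k * (q k * c' k) := by
        rw [lintegral_add_right _ (by fun_prop), lintegral_const_mul _
          (hc.indicator Metric.isOpen_ball.measurableSet),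
          lintegral_indicator Metric.isOpen_ball.measurableSet]
    _ ≤ _ := by gcongr; exact hu n

theorem WeakTendsto.eventually_coulD_le {v : ℕ → E3 → ℝ≥0∞} {w h : E3 → ℝ≥0∞}
    {M : ℝ≥0∞} (hlim : WeakTendsto v w) (hv : ∀ n, Measurable (v n)) (hs : ∀ n, sob (v n) ≤ 1)
    (hw : Measurable w) (hsw : sob w ≤ 1) (hh : Measurable h) (hsh : sob h ≠ ∞)
    (hM : coulD w h < M) : ∀ᶠ n in atTop, coulD (v n) h ≤ M := by
  have hc := measurable_coul
  obtain ⟨M', hM1, hM2⟩ := exists_between hM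
  have hqb : ∀ a : E3 → ℝ≥0∞, Measurable a → sob a ≤ 1 → ∀ k,
      corr a h k ^ 2 ≤ 2 * sob h * (wt k)⁻¹ := fun a ha hsa k => by
    calc _ ≤ 2 * sob a * sob h * (wt k)⁻¹ := corr_sq_le ha hh k
      _ ≤ 2 * 1 * sob h * (wt k)⁻¹ := by gcongr
      _ = _ := by rw [mul_one]
  have hqK : ∀ k, corr w h k ≤ 1 + 2 * sob h := fun k => by
    apply ENNReal.le_of_sq_le
    calc corr w h k ^ 2 ≤ 2 * sob h * (wt k)⁻¹ := hqb w hw hsw k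
      _ ≤ 2 * sob h * 1 := by gcongr; exact ENNReal.inv_le_one.2 (one_le_wt k)
      _ ≤ 2 * sob h * 1 + (1 + 2 * sob h + (2 * sob h) ^ 2) := le_self_add
      _ = _ := by ring
  have hKt : 1 + 2 * sob h ≠ ∞ := by
    simp only [ne_eq, ENNReal.add_eq_top, ENNReal.one_ne_top, false_or]
    exact ENNReal.mul_ne_top (by simp) hsh
  have hqm := measurable_corr hw hh
  have e1 := hlim.eventually_lintegral_mul_coul_lt hv hs hw hsw hqm hqK hKt
    (M := M') hM1
  have hpt : ∀ k, Tendsto (fun n => corr (v n) h k) atTop (𝓝 (corr w h k)) := fun k => by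
    refine hlim (fun l => h (l + k)) (by fun_prop) ?_
    refine (lt_of_le_of_lt (lintegral_mono fun k =>
        ENNReal.div_le_of_le_mul (le_mul_of_one_le_right bot_le (one_le_wt _))) ?_).ne
    rw [lintegral_add_right_eq_self (fun k => h k ^ 2)]
    exact (lintegral_sq_le_sob h).trans_lt hsh.lt_top
  have hd : Tendsto (fun n => ∫⁻ k, corr (v n) (v n) k * (corr (v n) h k - corr w h k) * coul k)
      atTop (𝓝 0) := by
    have := tendsto_lintegral_of_dominated_convergence (μ := volume)
      (F := fun n k => corr (v n) (v n) k * (corr (v n) h k - corr w h k) * coul k)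
      (f := fun _ => 0) (fun k => (1 + 2 * sob h) * (min 1 (coul k) * coul k))
      (fun n => by
        have := measurable_corr (hv n) (hv n)
        have := measurable_corr (hv n) hh
        fun_prop)
      (fun n => Eventually.of_forall fun k => by
        simp only
        rw [← mul_assoc]
        refine mul_le_mul_left ?_ _
        calc corr (v n) (v n) k * (corr (v n) h k - corr w h k)
            ≤ corr (v n) (v n) k * corr (v n) h k := by gcongr; exact tsub_le_self
          _ ≤ 2 * (corr (v n) (v n) k * corr (v n) h k) := by
              rw [two_mul]; exact le_self_add
          _ ≤ corr (v n) (v n) k ^ 2 + corr (v n) h k ^ 2 := ENNReal.two_mul_le_sq_add_sq _ _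
          _ ≤ 1 ^ 2 * min 1 (coul k) + 2 * sob h * min 1 (coul k) := by
              gcongr
              · refine (corr_self_sq_le (hv n) k).trans ?_
                gcongr
                exact hs n
              · refine (hqb _ (hv n) (hs n) k).trans ?_
                gcongr
                exact inv_wt_le k
          _ = _ := by ring)
      (by
        rw [lintegral_const_mul _ (by fun_prop)]
        exact ENNReal.mul_ne_top hKt coulBound_lt_top.ne)
      (by
        have h0 : ∀ᵐ k : E3, k ≠ 0 := by
          simp [ae_iff]
        filter_upwards [h0] with k hk
        have hct : coul k ≠ ∞ := by simp [coul, hk]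
        have h1 := ENNReal.Tendsto.sub (hpt k) (tendsto_const_nhds (x := corr w h k))
          (Or.inl (ne_top_of_le_ne_top hKt (hqK k)))
        rw [tsub_self] at h1
        have h2 := ENNReal.Tendsto.mul_const h1 (b := coul k) (Or.inr hct)
        rw [zero_mul] at h2
        refine tendsto_of_tendsto_of_tendsto_of_le_of_le tendsto_const_nhds h2 (fun _ => bot_le)
          fun n => ?_
        simp only
        gcongr
        refine mul_le_of_le_one_left bot_le ?_
        exact (corr_self_le_sob (hv n) k).trans (hs n))
    simpa using this
  filter_upwards [e1, hd.eventually_lt_const (tsub_pos_of_lt hM2)] with n h1 h2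
  have m1 := measurable_corr (hv n) (hv n)
  have m2 := measurable_corr (hv n) hh
  calc coulD (v n) h ≤ ∫⁻ k, (corr (v n) (v n) k * corr w h k * coul k
        + corr (v n) (v n) k * (corr (v n) h k - corr w h k) * coul k) := by
        refine lintegral_mono fun k => ?_
        rw [← add_mul, ← mul_add]
        gcongr
        exact le_add_tsub
    _ ≤ M' + (M - M') := by
        rw [lintegral_add_left (by fun_prop)]
        exact add_le_add h1.le h2.le
    _ = M := add_tsub_cancel_of_le hM2.le

theorem WeakTendsto.not_ae_eq_zero {v : ℕ → E3 → ℝ≥0∞} {w : E3 → ℝ≥0∞}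
    (hlim : WeakTendsto v w) (hv : ∀ n, Measurable (v n)) (hs : ∀ n, sob (v n) ≤ 1)
    (hw : Measurable w) (hsw : sob w ≤ 1)
    (hC : Tendsto (fun n => coulE (v n)) atTop (𝓝 coulC)) : ¬ w =ᵐ[volume] 0 := by
  intro h0
  have e : corr w w = 0 := by
    rw [corr_congr_ae h0 h0]; funext k; simp [corr]
  obtain ⟨M, hM1, hM2⟩ := exists_between (pos_iff_ne_zero.2 coulC_ne_zero)
  have := hlim.eventually_lintegral_mul_coul_lt hv hs hw hsw (q := 1) (K := 1) (M := M)
    measurable_one (fun _ => le_rfl) (by simp) (by simpa [e] using hM1)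
  refine absurd (le_of_tendsto hC ?_) (not_le.2 hM2)
  filter_upwards [this] with n hn
  refine le_trans (lintegral_mono fun k => ?_) hn.le
  simp only
  gcongr
  rw [sq]
  gcongr
  exact (corr_self_le_sob (hv n) k).trans (hs n)

theorem le_of_lower_variation {C s L N : ℝ}
    (h : ∀ t > 0, C ≤ C * (1 + t ^ 2 * N - 2 * t * s) ^ 2 + 4 * t * L) : C * s ≤ L := by
  have h1 : ∀ t > 0, 0 ≤ C * (-s + t * N / 2 + t * (t * N - 2 * s) ^ 2 / 4) + L := fun t ht => by
    have := h t ht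
    have : 0 ≤ (4 * t) * (C * (-s + t * N / 2 + t * (t * N - 2 * s) ^ 2 / 4) + L) := by
      linarith
    exact nonneg_of_mul_nonneg_right this (by positivity)
  have h2 : Tendsto (fun t : ℝ => C * (-s + t * N / 2 + t * (t * N - 2 * s) ^ 2 / 4) + L)
      (𝓝[>] 0) (𝓝 (C * (-s + 0 * N / 2 + 0 * (0 * N - 2 * s) ^ 2 / 4) + L)) := by
    refine Tendsto.mono_left (Continuous.tendsto (by fun_prop) 0) nhdsWithin_le_nhds
  have := ge_of_tendsto h2 (eventually_mem_nhdsWithin.mono fun t ht => h1 t ht)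
  simp at this
  linarith

theorem le_of_upper_variation {C s L N : ℝ}
    (h : ∀ t > 0, C + 4 * t * L ≤ C * (1 + 2 * t * s + t ^ 2 * N) ^ 2) : L ≤ C * s := by
  have h1 : ∀ t > 0, 0 ≤ C * (s + t * N / 2 + t * (t * N + 2 * s) ^ 2 / 4) - L := fun t ht => by
    have := h t ht
    have : 0 ≤ (4 * t) * (C * (s + t * N / 2 + t * (t * N + 2 * s) ^ 2 / 4) - L) := by
      linarith
    exact nonneg_of_mul_nonneg_right this (by positivity)
  have h2 : Tendsto (fun t : ℝ => C * (s + t * N / 2 + t * (t * N + 2 * s) ^ 2 / 4) - L)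
      (𝓝[>] 0) (𝓝 (C * (s + 0 * N / 2 + 0 * (0 * N + 2 * s) ^ 2 / 4) - L)) := by
    refine Tendsto.mono_left (Continuous.tendsto (by fun_prop) 0) nhdsWithin_le_nhds
  have := ge_of_tendsto h2 (eventually_mem_nhdsWithin.mono fun t ht => h1 t ht)
  simp at this
  linarith

theorem lintegral_mul_wt_ne_top {v h : E3 → ℝ≥0∞} (hv : Measurable v)
    (hsv : sob v ≠ ∞) (hsh : sob h ≠ ∞) : ∫⁻ k, v k * (wt k * h k) ≠ ∞ := by
  have hw := measurable_wt
  refine ne_top_of_le_ne_top (ENNReal.add_ne_top.2 ⟨hsv, hsh⟩) ?_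
  unfold sob
  rw [← lintegral_add_left (by fun_prop)]
  refine lintegral_mono fun k => ?_
  rw [← mul_add]
  calc v k * (wt k * h k) = wt k * (v k * h k) := by ring
    _ ≤ wt k * (2 * (v k * h k)) :=
        mul_le_mul_right (by rw [two_mul]; exact le_self_add) _
    _ ≤ _ := by gcongr; exact ENNReal.two_mul_le_sq_add_sq _ _

theorem coulD_ne_top {v h : E3 → ℝ≥0∞} (hv : Measurable v) (hh : Measurable h)
    (hsv : sob v ≠ ∞) (hsh : sob h ≠ ∞) : coulD v h ≠ ∞ := by
  have hE : coulE (fun k => v k + 1 * h k) ≠ ∞ := by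
    have hs : sob (fun k => v k + 1 * h k) ≠ ∞ := by
      rw [sob_add_mul hv hh]
      refine ENNReal.add_ne_top.2 ⟨ENNReal.add_ne_top.2 ⟨hsv, ?_⟩, by simpa using hsh⟩
      exact ENNReal.mul_ne_top (by simp) (lintegral_mul_wt_ne_top hv hsv hsh)
    exact ne_top_of_le_ne_top (ENNReal.mul_ne_top coulBound_lt_top.ne (by simpa using hs))
      (coulE_le (by fun_prop))
  refine ne_top_of_le_ne_top hE (le_trans ?_ (coulE_add_mul_le hv hh))
  refine le_trans ?_ le_add_self
  exact le_mul_of_one_le_left bot_le (by norm_num)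

/-- The lower first variation along a weakly convergent maximizing sequence. -/
theorem WeakTendsto.mul_le_coulD {v : ℕ → E3 → ℝ≥0∞} {w h : E3 → ℝ≥0∞}
    (hlim : WeakTendsto v w) (hv : ∀ n, Measurable (v n)) (hs : ∀ n, sob (v n) ≤ 1)
    (hw : Measurable w) (hsw : sob w ≤ 1)
    (hC : Tendsto (fun n => coulE (v n)) atTop (𝓝 coulC)) (hh : Measurable h)
    (hsh : sob h ≠ ∞) : coulC * ∫⁻ k, w k * (wt k * h k) ≤ coulD w h := by
  have hwt := measurable_wt
  have hswt : sob w ≠ ∞ := ne_top_of_le_ne_top (by simp) hsw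
  have hL := coulD_ne_top hw hh hswt hsh
  have hS := lintegral_mul_wt_ne_top hw hswt hsh
  set L := coulD w h
  set S := ∫⁻ k, w k * (wt k * h k)
  have hSn : Tendsto (fun n => ∫⁻ k, v n k * (wt k * h k)) atTop (𝓝 S) := by
    refine hlim _ (by fun_prop) ?_
    refine ne_top_of_le_ne_top hsh (lintegral_mono fun k => ?_)
    refine le_of_eq ?_
    rw [mul_pow, sq (wt k), mul_assoc, mul_div_assoc,
      ENNReal.mul_div_cancel (wt_ne_zero k) (wt_ne_top k)]
  have key : ∀ t : ℝ≥0∞, t ≠ 0 → t ≠ ∞ → ∀ M > L,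
      coulC ≤ coulC * (1 + t ^ 2 * sob h - 2 * t * S) ^ 2 + 4 * t * M := by
    intro t ht ht' M hM
    have hlim1 : Tendsto (fun n => coulC * (1 + t ^ 2 * sob h -
        2 * t * ∫⁻ k, v n k * (wt k * h k)) ^ 2 + 4 * t * M) atTop
        (𝓝 (coulC * (1 + t ^ 2 * sob h - 2 * t * S) ^ 2 + 4 * t * M)) := by
      have h2 : 2 * t ≠ ∞ := ENNReal.mul_ne_top (by simp) ht'
      have h1 : 1 + t ^ 2 * sob h ≠ ∞ := ENNReal.add_ne_top.2 ⟨by simp,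
        ENNReal.mul_ne_top (by simpa using ht') hsh⟩
      refine Tendsto.add (ENNReal.Tendsto.const_mul (ENNReal.Tendsto.pow
        (ENNReal.Tendsto.sub tendsto_const_nhds
          (ENNReal.Tendsto.const_mul hSn (Or.inr h2)) (Or.inl h1)))
          (Or.inr coulC_lt_top.ne)) tendsto_const_nhds
    refine le_of_tendsto_of_tendsto hC hlim1 ?_
    filter_upwards [hlim.eventually_coulD_le hv hs hw hsw hh hsh hM] with n hn
    have hvn := hv n
    have hsn : sob (v n) ≠ ∞ := ne_top_of_le_ne_top (by simp) (hs n)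
    have hz : sob (fun k => v n k - t * h k) ≤
        1 + t ^ 2 * sob h - 2 * t * ∫⁻ k, v n k * (wt k * h k) := by
      refine ENNReal.le_sub_of_add_le_right (ENNReal.mul_ne_top
        (ENNReal.mul_ne_top (by simp) ht') (lintegral_mul_wt_ne_top hvn hsn hsh)) ?_
      refine (sob_tsub_add_le hvn hh).trans ?_
      gcongr
      exact hs n
    have hzt : sob (fun k => v n k - t * h k) ≠ ∞ := by
      refine ne_top_of_le_ne_top hsn (lintegral_mono fun k => ?_)
      gcongr
      exact tsub_le_self
    calc coulE (v n) ≤ coulE (fun k => v n k - t * h k) + 4 * t * coulD (v n) h :=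
          coulE_le_of_le_add hvn (by fun_prop) hh (fun k => le_tsub_add) (fun k => tsub_le_self)
      _ ≤ coulC * sob (fun k => v n k - t * h k) ^ 2 + 4 * t * coulD (v n) h := by
          gcongr
          exact coulE_le_coulC (by fun_prop) hzt
      _ ≤ _ := by gcongr
  have hle : ∀ t : ℝ≥0∞, t ≠ 0 → t ≠ ∞ → 2 * t * S ≤ 1 + t ^ 2 * sob h := by
    intro t ht ht'
    refine le_trans le_add_self ((sob_tsub_add_le (t := t) hw hh).trans ?_)
    gcongr
  have key' : ∀ t : ℝ, 0 < t → coulC.toReal ≤ coulC.toReal *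
      (1 + t ^ 2 * (sob h).toReal - 2 * t * S.toReal) ^ 2 + 4 * t * L.toReal := by
    intro t ht
    have h0 : ENNReal.ofReal t ≠ 0 := by simpa using ht
    have h2 : ∀ M > L.toReal, coulC.toReal ≤ coulC.toReal *
      (1 + t ^ 2 * (sob h).toReal - 2 * t * S.toReal) ^ 2 + 4 * t * M := fun M hM => by
      have hM0 : 0 ≤ M := ENNReal.toReal_nonneg.trans hM.le
      have := key (ENNReal.ofReal t) h0 (by simp) (ENNReal.ofReal M)
        ((ENNReal.lt_ofReal_iff_toReal_lt hL).2 hM)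
      have h3 := hle (ENNReal.ofReal t) h0 (by simp)
      have hfin : 1 + ENNReal.ofReal t ^ 2 * sob h ≠ ∞ := ENNReal.add_ne_top.2 ⟨by simp,
        ENNReal.mul_ne_top (by simp) hsh⟩
      have hA : coulC * (1 + ENNReal.ofReal t ^ 2 * sob h - 2 * ENNReal.ofReal t * S) ^ 2 ≠ ∞ :=
        ENNReal.mul_ne_top coulC_lt_top.ne (ENNReal.pow_ne_top
          (ne_top_of_le_ne_top hfin tsub_le_self))
      have hB : 4 * ENNReal.ofReal t * ENNReal.ofReal M ≠ ∞ :=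
        ENNReal.mul_ne_top (ENNReal.mul_ne_top (by simp) (by simp)) (by simp)
      have h4 := ENNReal.toReal_mono (ENNReal.add_ne_top.2 ⟨hA, hB⟩) this
      rw [ENNReal.toReal_add hA hB, ENNReal.toReal_mul, ENNReal.toReal_pow,
        ENNReal.toReal_sub_of_le h3 hfin, ENNReal.toReal_add (by simp)
          (ENNReal.mul_ne_top (by simp) hsh)] at h4
      simpa [ENNReal.toReal_ofReal ht.le, ENNReal.toReal_ofReal hM0] using h4
    have h3 : Tendsto (fun M => coulC.toReal *
        (1 + t ^ 2 * (sob h).toReal - 2 * t * S.toReal) ^ 2 + 4 * t * M) (𝓝[>] L.toReal)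
        (𝓝 (coulC.toReal * (1 + t ^ 2 * (sob h).toReal - 2 * t * S.toReal) ^ 2
          + 4 * t * L.toReal)) :=
      Tendsto.mono_left (Continuous.tendsto (by fun_prop) _) nhdsWithin_le_nhds
    exact ge_of_tendsto h3 (eventually_mem_nhdsWithin.mono fun M hM => h2 M hM)
  have := le_of_lower_variation key'
  rw [← ENNReal.toReal_mul] at this
  exact (ENNReal.toReal_le_toReal (ENNReal.mul_ne_top coulC_lt_top.ne hS) hL).1 this

theorem coulD_le_of_maximizer {w h : E3 → ℝ≥0∞} (hw : Measurable w) (hsw : sob w = 1)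
    (hE : coulE w = coulC) (hh : Measurable h) (hsh : sob h ≠ ∞) :
    coulD w h ≤ coulC * ∫⁻ k, w k * (wt k * h k) := by
  have hswt : sob w ≠ ∞ := by simp [hsw]
  have hL := coulD_ne_top hw hh hswt hsh
  have hS := lintegral_mul_wt_ne_top hw hswt hsh
  rw [← ENNReal.toReal_le_toReal hL (ENNReal.mul_ne_top coulC_lt_top.ne hS), ENNReal.toReal_mul]
  refine le_of_upper_variation (N := (sob h).toReal) fun t ht => ?_
  have h1 := coulE_add_mul_le (t := ENNReal.ofReal t) hw hh
  have hfin : sob w + 2 * ENNReal.ofReal t * (∫⁻ k, w k * (wt k * h k))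
      + ENNReal.ofReal t ^ 2 * sob h ≠ ∞ :=
    ENNReal.add_ne_top.2 ⟨ENNReal.add_ne_top.2 ⟨hswt, ENNReal.mul_ne_top
      (ENNReal.mul_ne_top (by simp) (by simp)) hS⟩, ENNReal.mul_ne_top (by simp) hsh⟩
  have h2 := coulE_le_coulC (v := fun k => w k + ENNReal.ofReal t * h k) (by fun_prop)
    (by rw [sob_add_mul hw hh]; exact hfin)
  rw [sob_add_mul hw hh] at h2
  have h3 := ENNReal.toReal_mono (ENNReal.mul_ne_top coulC_lt_top.ne (ENNReal.pow_ne_top hfin))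
    (h1.trans h2)
  rw [ENNReal.toReal_add (by rw [hE]; exact coulC_lt_top.ne)
    (ENNReal.mul_ne_top (ENNReal.mul_ne_top (by simp) (by simp)) hL), ENNReal.toReal_mul,
    ENNReal.toReal_mul, ENNReal.toReal_mul (a := coulC), ENNReal.toReal_pow,
        ENNReal.toReal_add (ENNReal.add_ne_top.2
      ⟨hswt, ENNReal.mul_ne_top (ENNReal.mul_ne_top (by simp) (by simp)) hS⟩)
      (ENNReal.mul_ne_top (by simp) hsh), ENNReal.toReal_add hswt
      (ENNReal.mul_ne_top (ENNReal.mul_ne_top (by simp) (by simp)) hS), hE, hsw] at h3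
  simpa [ENNReal.toReal_ofReal ht.le] using h3

theorem exists_maximizer : ∃ w : E3 → ℝ≥0∞, Measurable w ∧ sob w = 1 ∧ coulE w = coulC ∧
    ∀ h, Measurable h → sob h ≠ ∞ → coulD w h = coulC * ∫⁻ k, w k * (wt k * h k) := by
  obtain ⟨v, hv, hs, hC⟩ := exists_seq_tendsto_coulC
  obtain ⟨φ, hφ, w, hw, hsw, hlim⟩ := exists_subseq_weakTendsto v hv hs
  have hC' : Tendsto (fun n => coulE (v (φ n))) atTop (𝓝 coulC) := hC.comp hφ.tendsto_atTop
  have hlow : ∀ h, Measurable h → sob h ≠ ∞ → coulC * ∫⁻ k, w k * (wt k * h k) ≤ coulD w h :=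
    fun h hh hsh => hlim.mul_le_coulD (fun n => hv _) (fun n => hs _) hw hsw hC' hh hsh
  have hswt : sob w ≠ ∞ := ne_top_of_le_ne_top (by simp) hsw
  have e : ∫⁻ k, w k * (wt k * w k) = sob w := by
    unfold sob; congr with k; ring
  have h1 := hlow w hw hswt
  rw [e, coulD_self] at h1
  have hs0 : sob w ≠ 0 := fun h0 => by
    have hwt := measurable_wt
    refine hlim.not_ae_eq_zero (fun n => hv _) (fun n => hs _) hw hsw hC' ?_
    unfold sob at h0
    rw [lintegral_eq_zero_iff (by fun_prop)] at h0
    filter_upwards [h0] with k hk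
    simpa [wt_ne_zero] using hk
  have h2 := h1.trans (coulE_le_coulC hw hswt)
  rw [ENNReal.mul_le_mul_iff_right coulC_ne_zero coulC_lt_top.ne, sq] at h2
  have hs1 : sob w = 1 := by
    refine le_antisymm hsw ?_
    rwa [← ENNReal.mul_le_mul_iff_right hs0 hswt, mul_one]
  have hE : coulE w = coulC := by
    refine le_antisymm ?_ ?_
    · simpa [hs1] using coulE_le_coulC hw hswt
    · simpa [hs1] using h1
  exact ⟨w, hw, hs1, hE, fun h hh hsh => le_antisymm (coulD_le_of_maximizer hw hs1 hE hh hsh)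
    (hlow h hh hsh)⟩

/-- A maximizer satisfying the Euler–Lagrange equation pointwise. -/
theorem exists_maximizer_eulerLagrange : ∃ w : E3 → ℝ≥0∞, Measurable w ∧ sob w = 1 ∧
    coulE w = coulC ∧ ∀ l, coulC * wt l * w l = corr (fun k => corr w w k * coul k) w l := by
  obtain ⟨w, hw, hs, hE, hEL⟩ := exists_maximizer
  have hwt := measurable_wt
  have hc := measurable_coul
  have hm := measurable_corr hw hw
  set V : E3 → ℝ≥0∞ := fun k => corr w w k * coul k with hV
  have hVm : Measurable V := by fun_prop
  have hA : Measurable (corr V w) := measurable_corr hVm hw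
  have hD : ∀ h, Measurable h → coulD w h = ∫⁻ l, h l * corr V w l := fun h hh => by
    rw [← lintegral_corr_mul hh hw hVm, ← lintegral_corr_swap_mul_coul]
    congr with k
    rw [hV]; ring
  have hae : (fun l => corr V w l / wt l) =ᵐ[volume] fun l => coulC * w l := by
    refine ae_eq_of_forall_setLIntegral_eq_of_sigmaFinite (by fun_prop) (by fun_prop)
      fun s hms hμ => ?_
    set h : E3 → ℝ≥0∞ := fun l => s.indicator 1 l / wt l with hh
    have hhm : Measurable h := by
      have : Measurable (s.indicator (1 : E3 → ℝ≥0∞)) := measurable_one.indicator hms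
      fun_prop
    have hsh : sob h ≠ ∞ := by
      refine ne_top_of_le_ne_top hμ.ne ?_
      rw [← lintegral_indicator_one hms]
      refine lintegral_mono fun l => ?_
      rw [hh]
      simp only
      rw [sq, ← mul_assoc, ENNReal.mul_div_cancel (wt_ne_zero l) (wt_ne_top l)]
      by_cases hl : l ∈ s
      · simpa [hl] using one_le_wt l
      · simp [hl]
    have := hEL h hhm hsh
    rw [hD h hhm, ← lintegral_const_mul _ (by fun_prop)] at this
    rw [← lintegral_indicator hms, ← lintegral_indicator hms]
    convert this using 2
    · funext l
      by_cases hl : l ∈ s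
      · simp only [hh, Set.indicator_of_mem hl, Pi.one_apply]
        rw [div_eq_mul_inv, one_div, mul_comm]
      · simp [hh, hl]
    · funext l
      rw [hh]
      simp only
      rw [ENNReal.mul_div_cancel (wt_ne_zero l) (wt_ne_top l)]
      by_cases hl : l ∈ s
      · simp [hl]
      · simp [hl]
  set w' : E3 → ℝ≥0∞ := fun l => corr V w l / wt l / coulC with hw'
  have hww : w =ᵐ[volume] w' := by
    filter_upwards [hae] with l hl
    rw [hw']
    simp only
    rw [hl, mul_comm, ENNReal.mul_div_cancel_right coulC_ne_zero coulC_lt_top.ne]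
  have hcc : corr w' w' = corr w w := corr_congr_ae hww.symm hww.symm
  refine ⟨w', by fun_prop, ?_, ?_, fun l => ?_⟩
  · rw [← hs]
    refine lintegral_congr_ae ?_
    filter_upwards [hww] with l hl
    rw [hl]
  · rw [← hE]; unfold coulE; rw [hcc]
  · rw [hcc, ← hV, corr_congr_ae (EventuallyEq.refl _ V) hww.symm]
    simp only [hw']
    rw [mul_comm coulC, mul_assoc, ENNReal.mul_div_cancel coulC_ne_zero coulC_lt_top.ne,
      ENNReal.mul_div_cancel (wt_ne_zero l) (wt_ne_top l)]

theorem lintegral_wt_pow_mul_corr_le (n : ℕ) {a b : E3 → ℝ≥0∞} (ha : Measurable a)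
    (hb : Measurable b) : ∫⁻ k, wt k ^ n * corr a b k ≤
      2 ^ n * ((∫⁻ k, wt k ^ n * a k) * ∫⁻ k, wt k ^ n * b k) := by
  have hwt := measurable_wt
  rw [← lintegral_corr (by fun_prop) (by fun_prop), ← lintegral_const_mul _
    (measurable_corr (by fun_prop) (by fun_prop))]
  refine lintegral_mono fun k => ?_
  unfold corr
  rw [← lintegral_const_mul _ (by fun_prop), ← lintegral_const_mul _ (by fun_prop)]
  refine lintegral_mono fun l => ?_
  calc wt k ^ n * (a l * b (l + k)) ≤ (2 * wt l * wt (l + k)) ^ n * (a l * b (l + k)) := by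
        gcongr; exact wt_le_two_mul k l
    _ = _ := by rw [mul_pow, mul_pow]; ring

theorem lintegral_corr_self_sq_le {w : E3 → ℝ≥0∞} (hw : Measurable w) :
    ∫⁻ k, corr w w k ^ 2 ≤ sob w ^ 2 * ∫⁻ k, ((wt k)⁻¹) ^ 2 := by
  have hwt := measurable_wt
  set K := ∫⁻ k, ((wt k)⁻¹) ^ 2 with hK
  set g : E3 → ℝ≥0∞ := fun k => wt k * w k ^ 2 with hg
  have hgm : Measurable g := by fun_prop
  have hcc : ∀ k, ∫⁻ l, (wt l)⁻¹ * (wt (l + k))⁻¹ ≤ K := fun k => by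
    apply ENNReal.le_of_sq_le
    refine (sq_lintegral_mul_le volume (by fun_prop) (by fun_prop)).trans ?_
    rw [lintegral_add_right_eq_self (fun l => (wt l)⁻¹ ^ 2), ← hK, sq]
  have hP : ∀ k, corr w w k ^ 2 ≤ corr g g k * K := fun k => by
    have := sq_lintegral_mul_le_weight volume (f := fun l => w l * w (l + k)) (g := fun _ => 1)
      (w := fun l => wt l * wt (l + k)) (by fun_prop) (by fun_prop) (by fun_prop)
      (fun l => mul_ne_zero (wt_ne_zero _) (wt_ne_zero _))
      (fun l => ENNReal.mul_ne_top (wt_ne_top _) (wt_ne_top _))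
    simp only [mul_one] at this
    refine this.trans ?_
    gcongr
    · refine lintegral_mono fun l => le_of_eq ?_
      rw [hg]; ring
    · refine le_trans (lintegral_mono fun l => le_of_eq ?_) (hcc k)
      rw [one_pow, one_div, ENNReal.mul_inv (Or.inl (wt_ne_zero _)) (Or.inl (wt_ne_top _))]
  refine (lintegral_mono hP).trans (le_of_eq ?_)
  rw [lintegral_mul_const _ (measurable_corr hgm hgm), lintegral_corr hgm hgm, ← sq]
  rfl

theorem coul_le_ball_add_compl (k : E3) {p : ℝ≥0∞} (hp : p ≤ 1) :
    p * coul k ≤ (Metric.ball (0 : E3) 1).indicator coul k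
      + p * (Metric.ball (0 : E3) 1)ᶜ.indicator coul k := by
  by_cases hk : k ∈ Metric.ball (0 : E3) 1
  · rw [Set.indicator_of_mem hk]
    exact (mul_le_of_le_one_left bot_le hp).trans le_self_add
  · rw [Set.indicator_of_mem (show k ∈ (Metric.ball (0 : E3) 1)ᶜ from hk)]
    exact le_add_self

theorem lintegral_corr_self_mul_coul_ne_top {w : E3 → ℝ≥0∞} (hw : Measurable w)
    (hs : sob w = 1) : ∫⁻ k, corr w w k * coul k ≠ ∞ := by
  have hP := measurable_corr hw hw
  have hc := measurable_coul
  have hc' := measurable_coul_trunc 1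
  have hb : MeasurableSet (Metric.ball (0 : E3) 1) := Metric.isOpen_ball.measurableSet
  refine ne_top_of_le_ne_top ?_ (lintegral_mono fun k =>
    coul_le_ball_add_compl k ((corr_self_le_sob hw k).trans hs.le))
  rw [lintegral_add_left (hc.indicator hb), lintegral_indicator hb]
  refine ENNReal.add_ne_top.2 ⟨setLIntegral_ball_coul_lt_top.ne, ?_⟩
  have h1 := sq_lintegral_mul_le volume hP.aemeasurable hc'.aemeasurable
  have h2 : (∫⁻ k, corr w w k ^ 2) * ∫⁻ k,
      ((Metric.ball (0 : E3) 1)ᶜ.indicator coul k) ^ 2 ≠ ∞ := by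
    refine ENNReal.mul_ne_top ?_ (lintegral_coul_trunc_sq_lt_top one_pos).ne
    refine ne_top_of_le_ne_top ?_ (lintegral_corr_self_sq_le hw)
    rw [hs, one_pow, one_mul]
    exact lintegral_inv_wt_sq_lt_top.ne
  have h3 := ne_top_of_le_ne_top h2 h1
  simpa using h3

theorem lintegral_corr_sq_le {V w : E3 → ℝ≥0∞} (hV : Measurable V) (hw : Measurable w) :
    ∫⁻ l, corr V w l ^ 2 ≤ (∫⁻ k, V k) ^ 2 * ∫⁻ k, w k ^ 2 := by
  have hpt : ∀ l, corr V w l ^ 2 ≤ (∫⁻ k, V k) * corr V (fun k => w k ^ 2) l := fun l => by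
    have := sq_lintegral_mul_le volume (f := fun k => V k ^ (1 / 2 : ℝ))
      (g := fun k => V k ^ (1 / 2 : ℝ) * w (k + l)) (by fun_prop) (by fun_prop)
    have e1 : ∀ k, (V k ^ (1 / 2 : ℝ)) ^ 2 = V k := fun k => by
      rw [← ENNReal.rpow_natCast, ← ENNReal.rpow_mul]; simp
    simp only [mul_pow, ← mul_assoc, ← sq, e1] at this
    exact this
  refine (lintegral_mono hpt).trans (le_of_eq ?_)
  rw [lintegral_const_mul _ (measurable_corr hV (by fun_prop)), lintegral_corr hV (by fun_prop)]
  ring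

theorem lintegral_ne_top_of_eulerLagrange {w : E3 → ℝ≥0∞} (hw : Measurable w) (hs : sob w = 1)
    (hEL : ∀ l, coulC * wt l * w l = corr (fun k => corr w w k * coul k) w l) :
    ∫⁻ k, w k ≠ ∞ := by
  have hwt := measurable_wt
  have hP := measurable_corr hw hw
  have hc := measurable_coul
  have h1 : ∫⁻ l, (coulC * wt l * w l) ^ 2 ≠ ∞ := by
    simp only [hEL]
    refine ne_top_of_le_ne_top ?_ (lintegral_corr_sq_le (by fun_prop) hw)
    exact ENNReal.mul_ne_top (ENNReal.pow_ne_top (lintegral_corr_self_mul_coul_ne_top hw hs))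
      (ne_top_of_le_ne_top (by simp [hs]) (lintegral_sq_le_sob w))
  have h2 := sq_lintegral_mul_le volume (f := fun l => coulC * wt l * w l)
    (g := fun l => (wt l)⁻¹) (by fun_prop) (by fun_prop)
  have h3 := ne_top_of_le_ne_top (ENNReal.mul_ne_top h1 lintegral_inv_wt_sq_lt_top.ne) h2
  have e : ∀ l, coulC * wt l * w l * (wt l)⁻¹ = coulC * w l := fun l => by
    calc coulC * wt l * w l * (wt l)⁻¹ = coulC * w l * (wt l * (wt l)⁻¹) := by ring
      _ = _ := by rw [ENNReal.mul_inv_cancel (wt_ne_zero l) (wt_ne_top l), mul_one]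
  simp only [e] at h3
  rw [lintegral_const_mul _ hw] at h3
  intro h
  rw [h, ENNReal.mul_top coulC_ne_zero] at h3
  simp at h3

theorem lintegral_wt_pow_mul_potential_ne_top {w : E3 → ℝ≥0∞} (hw : Measurable w)
    (hs : sob w = 1) {n : ℕ} (hn : ∫⁻ k, wt k ^ n * w k ≠ ∞) :
    ∫⁻ k, wt k ^ n * (corr w w k * coul k) ≠ ∞ := by
  have hwt := measurable_wt
  have hP := measurable_corr hw hw
  have hc := measurable_coul
  have hb : MeasurableSet (Metric.ball (0 : E3) 1) := Metric.isOpen_ball.measurableSet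
  have hle : ∀ k, wt k ^ n * (corr w w k * coul k) ≤
      2 ^ n * (Metric.ball (0 : E3) 1).indicator coul k + wt k ^ n * corr w w k := fun k => by
    by_cases hk : k ∈ Metric.ball (0 : E3) 1
    · rw [Set.indicator_of_mem hk]
      refine le_trans ?_ le_self_add
      have h1 : ‖k‖ₑ ≤ 1 := by
        rw [← ofReal_norm, ENNReal.ofReal_le_one]
        exact (mem_ball_zero_iff.1 hk).le
      have h2 : wt k ≤ 2 := by
        calc 1 + ‖k‖ₑ ^ 2 ≤ 1 + 1 := by gcongr; exact pow_le_one' h1 2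
          _ = 2 := by norm_num
      gcongr
      exact mul_le_of_le_one_left bot_le ((corr_self_le_sob hw k).trans hs.le)
    · refine le_trans ?_ le_add_self
      gcongr
      refine mul_le_of_le_one_right bot_le ?_
      unfold coul
      rw [ENNReal.inv_le_one]
      refine one_le_pow₀ ?_
      rw [← ofReal_norm, ENNReal.one_le_ofReal]
      simpa using hk
  refine ne_top_of_le_ne_top ?_ (lintegral_mono hle)
  rw [lintegral_add_right _ (by fun_prop), lintegral_const_mul _ (hc.indicator hb),
    lintegral_indicator hb]
  refine ENNReal.add_ne_top.2 ⟨ENNReal.mul_ne_top (by simp) setLIntegral_ball_coul_lt_top.ne, ?_⟩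
  exact ne_top_of_le_ne_top (ENNReal.mul_ne_top (by simp) (ENNReal.mul_ne_top hn hn))
    (lintegral_wt_pow_mul_corr_le n hw hw)

theorem lintegral_wt_pow_mul_ne_top {w : E3 → ℝ≥0∞} (hw : Measurable w) (hs : sob w = 1)
    (hEL : ∀ l, coulC * wt l * w l = corr (fun k => corr w w k * coul k) w l) (n : ℕ) :
    ∫⁻ k, wt k ^ n * w k ≠ ∞ := by
  have hwt := measurable_wt
  have hP := measurable_corr hw hw
  have hc := measurable_coul
  induction n with
  | zero => simpa using lintegral_ne_top_of_eulerLagrange hw hs hEL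
  | succ n ih =>
    have h1 := lintegral_wt_pow_mul_corr_le n (a := fun k => corr w w k * coul k) (by fun_prop) hw
    have h2 := ne_top_of_le_ne_top (ENNReal.mul_ne_top (by simp) (ENNReal.mul_ne_top
      (lintegral_wt_pow_mul_potential_ne_top hw hs ih) ih)) h1
    simp only [← hEL] at h2
    have e : ∀ k, wt k ^ n * (coulC * wt k * w k) = coulC * (wt k ^ (n + 1) * w k) := fun k => by
      ring
    simp only [e] at h2
    rw [lintegral_const_mul _ (by fun_prop)] at h2
    intro h
    rw [h, ENNReal.mul_top coulC_ne_zero] at h2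
    exact h2 rfl

end Pekar

section Landau

open scoped ContDiff

variable {E F : Type*} [NormedAddCommGroup E] [NormedSpace ℝ E] [NormedAddCommGroup F]
  [NormedSpace ℝ F]

/-- Landau's inequality: decay of a function with Lipschitz derivative passes to the derivative. -/
theorem exists_decay_fderiv_of_lipschitz {g : E → F} (hg : Differentiable ℝ g) {M : ℝ}
    (hM : ∀ x y, ‖fderiv ℝ g y - fderiv ℝ g x‖ ≤ M * ‖y - x‖)
    (hdec : ∀ k : ℕ, ∃ C, ∀ x, (1 + ‖x‖) ^ k * ‖g x‖ ≤ C) (k : ℕ) :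
    ∃ C, ∀ x, (1 + ‖x‖) ^ k * ‖fderiv ℝ g x‖ ≤ C := by
  obtain ⟨C, hC⟩ := hdec (2 * k)
  have hC0 : 0 ≤ C := le_trans (by positivity) (hC 0)
  rcases subsingleton_or_nontrivial E with hE | hE
  · refine ⟨0, fun x => ?_⟩
    have : fderiv ℝ g x = 0 := by
      ext u
      rw [Subsingleton.elim u 0]
      simp
    simp [this]
  have hM0 : 0 ≤ M := by
    obtain ⟨x, hx⟩ := exists_ne (0 : E)
    have h := (norm_nonneg _).trans (hM 0 x)
    rw [sub_zero] at h
    exact nonneg_of_mul_nonneg_left h (norm_pos_iff.2 hx)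
  refine ⟨2 * (C * 2 ^ (2 * k)) + M, fun x => ?_⟩
  have hx1 : (1 : ℝ) ≤ 1 + ‖x‖ := by linarith [norm_nonneg x]
  set h : ℝ := ((1 + ‖x‖) ^ k)⁻¹ with hh
  have hp : (0 : ℝ) < (1 + ‖x‖) ^ k := by positivity
  have hh0 : 0 < h := inv_pos.2 hp
  have hh1 : h ≤ 1 := inv_le_one_of_one_le₀ (one_le_pow₀ hx1)
  have hgb : ∀ y, ‖y - x‖ ≤ 1 → ‖g y‖ ≤ C * 2 ^ (2 * k) * h ^ 2 := by
    intro y hy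
    have h1 : 1 + ‖x‖ ≤ 2 * (1 + ‖y‖) := by
      have := norm_sub_norm_le x y
      rw [norm_sub_rev] at this
      linarith [norm_nonneg y]
    have h2 : (1 + ‖x‖) ^ (2 * k) ≤ 2 ^ (2 * k) * (1 + ‖y‖) ^ (2 * k) := by
      rw [← mul_pow]
      exact pow_le_pow_left₀ (by positivity) h1 _
    have h3 : (1 + ‖x‖) ^ (2 * k) * ‖g y‖ ≤ 2 ^ (2 * k) * C := by
      calc _ ≤ 2 ^ (2 * k) * (1 + ‖y‖) ^ (2 * k) * ‖g y‖ := by gcongr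
        _ ≤ _ := by rw [mul_assoc]; gcongr; exact hC y
    have h4 : h ^ 2 = ((1 + ‖x‖) ^ (2 * k))⁻¹ := by
      rw [hh, inv_pow, ← pow_mul, mul_comm]
    rw [h4, ← div_eq_mul_inv, le_div_iff₀ (by positivity)]
    linarith
  have key : ‖fderiv ℝ g x‖ ≤ (2 * (C * 2 ^ (2 * k)) + M) * h := by
    refine ContinuousLinearMap.opNorm_le_of_unit_norm (by positivity) fun u hu => ?_
    have hn : ‖(x + h • u) - x‖ = h := by
      rw [add_sub_cancel_left, norm_smul, hu, mul_one, Real.norm_of_nonneg hh0.le]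
    have h1 : ‖g (x + h • u) - g x - fderiv ℝ g x ((x + h • u) - x)‖ ≤
        (M * h) * ‖(x + h • u) - x‖ := by
      refine (convex_closedBall x h).norm_image_sub_le_of_norm_fderiv_le' (𝕜 := ℝ)
        (fun y _ => hg y) (fun y hy => ?_)
        (Metric.mem_closedBall_self hh0.le) ?_
      · refine (hM x y).trans ?_
        gcongr
        rwa [mem_closedBall_iff_norm] at hy
      · rw [mem_closedBall_iff_norm, hn]
    rw [hn, add_sub_cancel_left, map_smul] at h1
    have h2 : ‖h • fderiv ℝ g x u‖ ≤ ‖g (x + h • u)‖ + ‖g x‖ + M * h * h := by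
      have e : h • fderiv ℝ g x u = g (x + h • u) - g x -
        (g (x + h • u) - g x - h • fderiv ℝ g x u) := by abel
      rw [e]
      refine (norm_sub_le _ _).trans (add_le_add (norm_sub_le _ _) h1)
    rw [norm_smul, Real.norm_of_nonneg hh0.le] at h2
    have h3 := hgb (x + h • u) (by rw [hn]; exact hh1)
    have h4 := hgb x (by simp)
    have h5 : h * ‖fderiv ℝ g x u‖ ≤ h * ((2 * (C * 2 ^ (2 * k)) + M) * h) := by nlinarith
    exact le_of_mul_le_mul_left h5 hh0
  calc _ ≤ (1 + ‖x‖) ^ k * ((2 * (C * 2 ^ (2 * k)) + M) * h) := by gcongr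
    _ = _ := by rw [hh]; field_simp

theorem exists_decay_iteratedFDeriv_of_bounded {f : E → F} (hf : ContDiff ℝ ∞ f)
    (hb : ∀ n : ℕ, ∃ M, ∀ x, ‖iteratedFDeriv ℝ n f x‖ ≤ M)
    (hdec : ∀ k : ℕ, ∃ C, ∀ x, (1 + ‖x‖) ^ k * ‖f x‖ ≤ C) (n k : ℕ) :
    ∃ C, ∀ x, (1 + ‖x‖) ^ k * ‖iteratedFDeriv ℝ n f x‖ ≤ C := by
  induction n generalizing k with
  | zero => simpa using hdec k
  | succ n ih =>
    obtain ⟨M, hM⟩ := hb (n + 2)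
    have hd : ∀ m : ℕ, Differentiable ℝ (iteratedFDeriv ℝ m f) := fun m =>
      hf.differentiable_iteratedFDeriv (by exact_mod_cast WithTop.coe_lt_top _)
    have hL : ∀ x y, ‖fderiv ℝ (iteratedFDeriv ℝ n f) y - fderiv ℝ (iteratedFDeriv ℝ n f) x‖ ≤
        M * ‖y - x‖ := by
      intro x y
      rw [← dist_eq_norm (fderiv ℝ (iteratedFDeriv ℝ n f) y), fderiv_iteratedFDeriv,
        Function.comp_apply, Function.comp_apply, LinearIsometryEquiv.dist_map, dist_eq_norm]
      refine convex_univ.norm_image_sub_le_of_norm_fderiv_le (𝕜 := ℝ) (fun z _ => hd (n + 1) z)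
        (fun z _ => ?_) (Set.mem_univ x) (Set.mem_univ y)
      rw [norm_fderiv_iteratedFDeriv]
      exact hM z
    obtain ⟨C, hC⟩ := exists_decay_fderiv_of_lipschitz (hd n) hL ih k
    exact ⟨C, fun x => by simpa only [norm_fderiv_iteratedFDeriv] using hC x⟩

theorem exists_schwartzMap_of_bounded {f : E → F} (hf : ContDiff ℝ ∞ f)
    (hb : ∀ n : ℕ, ∃ M, ∀ x, ‖iteratedFDeriv ℝ n f x‖ ≤ M)
    (hdec : ∀ k : ℕ, ∃ C, ∀ x, (1 + ‖x‖) ^ k * ‖f x‖ ≤ C) :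
    ∃ φ : SchwartzMap E F, ∀ x, φ x = f x := by
  refine ⟨⟨f, hf, fun k n => ?_⟩, fun x => rfl⟩
  obtain ⟨C, hC⟩ := exists_decay_iteratedFDeriv_of_bounded hf hb hdec n k
  refine ⟨C, fun x => le_trans ?_ (hC x)⟩
  gcongr
  linarith

end Landau

namespace Pekar

open ProbabilityTheory

/-- The standard exponential law on the half line. -/
def expLaw : Measure ℝ :=
  (volume.restrict (Set.Ioi 0)).withDensity fun s => ENNReal.ofReal (Real.exp (-s))

theorem integral_expLaw {F : Type*} [NormedAddCommGroup F] [NormedSpace ℝ F] (f : ℝ → F) :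
    ∫ s, f s ∂expLaw = ∫ s in Set.Ioi 0, Real.exp (-s) • f s := by
  rw [expLaw, integral_withDensity_eq_integral_toReal_smul (by fun_prop) (by simp)]
  simp [ENNReal.toReal_ofReal (Real.exp_pos _).le]

instance : IsProbabilityMeasure expLaw := by
  constructor
  rw [expLaw, withDensity_apply _ MeasurableSet.univ, Measure.restrict_univ,
    ← ofReal_integral_eq_lintegral_ofReal (integrableOn_exp_neg_Ioi 0)
      (Filter.Eventually.of_forall fun _ => (Real.exp_pos _).le), integral_exp_neg_Ioi_zero]
  simp

theorem integrable_pow_expLaw (n : ℕ) : Integrable (fun s => s ^ n) expLaw := by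
  rw [expLaw, integrable_withDensity_iff_integrable_smul' (by fun_prop) (by simp)]
  have h := Real.GammaIntegral_convergent (s := n + 1) (by positivity)
  refine (integrableOn_congr_fun (fun s hs => ?_) measurableSet_Ioi).1 h
  rw [ENNReal.toReal_ofReal (Real.exp_pos _).le, smul_eq_mul, add_sub_cancel_right,
    Real.rpow_natCast]

/-- The law whose characteristic function is `l ↦ (1 + ‖l‖²)⁻¹`, up to normalisation. -/
theorem exists_measure_resolvent : ∃ ν : Measure E3, IsProbabilityMeasure ν ∧
    (∀ n : ℕ, Integrable (fun y => (1 + ‖y‖) ^ n) ν) ∧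
    ∀ l : E3, ∫ y, Complex.exp (((2 * π * inner ℝ y l : ℝ) : ℂ) * Complex.I) ∂ν =
      (((1 + ‖l‖ ^ 2)⁻¹ : ℝ) : ℂ) := by
  set Y : ℝ × E3 → E3 := fun p => (√(2 * p.1) / (2 * π)) • p.2 with hY
  have hYc : Continuous Y := by fun_prop
  refine ⟨(expLaw.prod (stdGaussian E3)).map Y, Measure.isProbabilityMeasure_map hYc.aemeasurable,
    fun n => ?_, fun l => ?_⟩
  · rw [integrable_map_measure (by fun_prop) hYc.aemeasurable]
    have h1 : Integrable (fun s : ℝ => 2 ^ (n - 1) * (2 ^ n + s ^ n)) expLaw :=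
      ((integrable_const _).add (integrable_pow_expLaw n)).const_mul _
    have h2 : Integrable (fun z : E3 => 2 ^ (n - 1) * (1 ^ n + ‖z‖ ^ n)) (stdGaussian E3) := by
      refine ((integrable_const _).add ?_).const_mul _
      exact (IsGaussian.memLp_id (stdGaussian E3) n (by simp)).integrable_norm_pow'
    have hnn : ∀ᵐ p ∂(expLaw.prod (stdGaussian E3)), 0 ≤ p.1 := by
      have : ∀ᵐ s ∂expLaw, 0 ≤ s := by
        refine (withDensity_absolutelyContinuous _ _).ae_le ?_
        filter_upwards [ae_restrict_mem measurableSet_Ioi] with s hs using le_of_lt hs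
      exact Measure.quasiMeasurePreserving_fst.ae this
    refine (h1.mul_prod h2).mono' (by fun_prop) ?_
    filter_upwards [hnn] with p hp
    rw [Function.comp_apply, Real.norm_of_nonneg (by positivity), hY]
    simp only
    rw [norm_smul, Real.norm_of_nonneg (by positivity)]
    have h3 : √(2 * p.1) / (2 * π) ≤ 1 + p.1 := by
      have : √(2 * p.1) ≤ 1 + p.1 := by
        rw [Real.sqrt_le_left (by positivity)]; nlinarith [sq_nonneg p.1]
      rw [div_le_iff₀ (by positivity)]
      have : (1 : ℝ) ≤ 2 * π := by linarith [Real.pi_gt_three]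
      nlinarith
    have h4 : 0 ≤ √(2 * p.1) / (2 * π) := by positivity
    calc _ ≤ ((2 + p.1) * (1 + ‖p.2‖)) ^ n := by
          gcongr
          nlinarith [norm_nonneg p.2, mul_le_mul_of_nonneg_right h3 (norm_nonneg p.2)]
      _ ≤ _ := by
        rw [mul_pow]
        gcongr
        · exact add_pow_le (by norm_num) hp n
        · exact add_pow_le (by norm_num) (norm_nonneg _) n
  · rw [integral_map hYc.aemeasurable (by fun_prop)]
    have hInt : Integrable (fun p => Complex.exp (((2 * π * inner ℝ (Y p) l : ℝ) : ℂ) *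
        Complex.I)) (expLaw.prod (stdGaussian E3)) := by
      refine (integrable_const (1 : ℝ)).mono' (by fun_prop) (Eventually.of_forall fun p => ?_)
      rw [Complex.norm_exp_ofReal_mul_I]
    rw [integral_prod _ hInt, integral_expLaw]
    have h1 : ∀ s ∈ Set.Ioi (0 : ℝ), Real.exp (-s) • ∫ z, Complex.exp
        (((2 * π * inner ℝ (Y (s, z)) l : ℝ) : ℂ) * Complex.I) ∂(stdGaussian E3) =
        Complex.exp (((-(1 + ‖l‖ ^ 2) : ℝ) : ℂ) * s) := by
      intro s hs
      have hs : 0 < s := hs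
      have h2 := charFun_stdGaussian (E := E3) (√(2 * s) • l)
      rw [charFun_apply] at h2
      have h3 : ∀ z : E3, 2 * π * inner ℝ (Y (s, z)) l = inner ℝ z (√(2 * s) • l) := by
        intro z
        rw [hY, inner_smul_left, inner_smul_right]
        simp
        field_simp
      simp_rw [h3]
      rw [h2, norm_smul, Complex.real_smul, Complex.ofReal_exp, ← Complex.exp_add,
        Real.norm_of_nonneg (by positivity)]
      congr 1
      have h4 : ((√(2 * s) : ℝ) : ℂ) ^ 2 = 2 * s := by
        rw [← Complex.ofReal_pow, Real.sq_sqrt (by positivity)]; push_cast; ring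
      push_cast
      rw [mul_pow, h4]
      ring
    rw [setIntegral_congr_fun measurableSet_Ioi h1, integral_exp_mul_complex_Ioi]
    · push_cast
      simp
      rw [show -(‖l‖ : ℂ) ^ 2 + -1 = -(1 + (‖l‖ : ℂ) ^ 2) by ring, neg_div_neg_eq, one_div]
    · rw [Complex.ofReal_re]
      have := sq_nonneg ‖l‖
      linarith

end Pekar

namespace Pekar

theorem decay_of_eq_integral {ν : Measure E3} (hν : ∀ n : ℕ, Integrable (fun y => (1 + ‖y‖) ^ n) ν)
    {f U : E3 → ℂ} {B K : ℝ} (hB : ∀ x, ‖f x‖ ≤ B) (hK : ∀ x, ‖U x‖ ≤ K)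
    (hU : Tendsto U (cocompact E3) (𝓝 0)) (h : ∀ x, f x = ∫ y, U (x + y) * f (x + y) ∂ν) (n : ℕ) :
    ∃ C, ∀ x, (1 + ‖x‖) ^ n * ‖f x‖ ≤ C := by
  set m : ℝ := ∫ y, (1 + ‖y‖) ^ n ∂ν with hm
  have hm0 : 0 ≤ m := integral_nonneg fun y => by positivity
  have hB0 : 0 ≤ B := (norm_nonneg _).trans (hB 0)
  have hK0 : 0 ≤ K := (norm_nonneg _).trans (hK 0)
  set ε : ℝ := (2 * (m + 1))⁻¹ with hε
  have hε0 : 0 < ε := by positivity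
  obtain ⟨R, hR⟩ : ∃ R : ℝ, ∀ z, R ≤ ‖z‖ → ‖U z‖ ≤ ε := by
    rw [← Metric.cobounded_eq_cocompact] at hU
    have h1 := (hU.norm.eventually_lt_const (u := ε) (by simpa using hε0))
    obtain ⟨R, -, hR⟩ := (hasBasis_cobounded_norm (E := E3)).mem_iff.1 h1
    exact ⟨R, fun z hz => (hR hz).le⟩
  set R' : ℝ := max R 0 with hR'
  set A : ℝ := (1 + R') ^ n * (K * B) with hA
  have hA0 : 0 ≤ A := by positivity
  refine ⟨2 * (m * A), fun x₀ => ?_⟩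
  set L : ℝ := (1 + ‖x₀‖) ^ n with hL
  have hL0 : 0 < L := by positivity
  set W : E3 → ℝ := fun x => min ((1 + ‖x‖) ^ n) L with hW
  have hW0 : ∀ x, 0 ≤ W x := fun x => le_min (by positivity) hL0.le
  have hWm : ∀ x y, W x ≤ (1 + ‖y‖) ^ n * W (x + y) := by
    intro x y
    have h1 : (1 : ℝ) ≤ (1 + ‖y‖) ^ n := one_le_pow₀ (by linarith [norm_nonneg y])
    have h2 : (1 + ‖x‖) ^ n ≤ (1 + ‖y‖) ^ n * (1 + ‖x + y‖) ^ n := by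
      rw [← mul_pow]
      gcongr
      have := norm_sub_le (x + y) y
      rw [add_sub_cancel_right] at this
      nlinarith [norm_nonneg y, norm_nonneg (x + y)]
    rw [hW]
    simp only
    rw [mul_min_of_nonneg _ _ (by positivity)]
    exact min_le_min h2 (le_mul_of_one_le_left hL0.le h1)
  set N : ℝ := ⨆ x, W x * ‖f x‖ with hN
  have hbdd : BddAbove (Set.range fun x => W x * ‖f x‖) := by
    refine ⟨L * B, ?_⟩
    rintro _ ⟨x, rfl⟩
    exact mul_le_mul (min_le_right _ _) (hB x) (norm_nonneg _) hL0.le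
  have hle : ∀ x, W x * ‖f x‖ ≤ N := fun x => le_ciSup hbdd x
  have hN0 : 0 ≤ N := (mul_nonneg (hW0 0) (norm_nonneg _)).trans (hle 0)
  have hpt : ∀ z, W z * (‖U z‖ * ‖f z‖) ≤ A + ε * N := by
    intro z
    rcases le_or_gt R ‖z‖ with hz | hz
    · have h1 : W z * (‖U z‖ * ‖f z‖) ≤ ε * N := by
        calc W z * (‖U z‖ * ‖f z‖) = ‖U z‖ * (W z * ‖f z‖) := by ring
          _ ≤ ε * N := mul_le_mul (hR z hz) (hle z) (mul_nonneg (hW0 z) (norm_nonneg _)) hε0.le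
      linarith
    · have h1 : W z ≤ (1 + R') ^ n := by
        refine (min_le_left _ _).trans ?_
        gcongr
        exact hz.le.trans (le_max_left _ _)
      have h2 : W z * (‖U z‖ * ‖f z‖) ≤ A :=
        mul_le_mul h1 (mul_le_mul (hK z) (hB z) (norm_nonneg _) hK0) (by positivity) (by positivity)
      have := mul_nonneg hε0.le hN0
      linarith
  have hstep : ∀ x, W x * ‖f x‖ ≤ m * (A + ε * N) := by
    intro x
    have h1 : W x * ‖f x‖ = ‖∫ y, (W x : ℂ) * (U (x + y) * f (x + y)) ∂ν‖ := by
      rw [integral_const_mul, ← h x, norm_mul, Complex.norm_real, Real.norm_of_nonneg (hW0 x)]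
    rw [h1, hm, ← integral_mul_const]
    refine norm_integral_le_of_norm_le ((hν n).mul_const _) (Eventually.of_forall fun y => ?_)
    rw [norm_mul, norm_mul, Complex.norm_real, Real.norm_of_nonneg (hW0 x)]
    calc _ ≤ (1 + ‖y‖) ^ n * W (x + y) * (‖U (x + y)‖ * ‖f (x + y)‖) := by gcongr; exact hWm x y
      _ ≤ _ := by rw [mul_assoc]; gcongr; exact hpt _
  have hNle : N ≤ m * (A + ε * N) := ciSup_le hstep
  have hmε : m * ε ≤ 1 / 2 := by
    rw [hε, ← div_eq_mul_inv, div_le_iff₀ (by positivity)]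
    linarith
  have h3 : W x₀ = L := by simp [hW, hL]
  have h4 := hle x₀
  rw [h3] at h4
  nlinarith [mul_le_mul_of_nonneg_right hmε hN0]

theorem fourier_resolvent_eq_integral {ν : Measure E3} [IsProbabilityMeasure ν]
    (hν : ∀ l : E3, ∫ y, Complex.exp (((2 * π * inner ℝ y l : ℝ) : ℂ) * Complex.I) ∂ν =
      (((1 + ‖l‖ ^ 2)⁻¹ : ℝ) : ℂ)) {G : E3 → ℂ} (hG : Integrable G) (x : E3) :
    𝓕 (fun l => (((1 + ‖l‖ ^ 2)⁻¹ : ℝ) : ℂ) * G l) x = ∫ y, 𝓕 G (x + y) ∂ν := by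
  simp_rw [Real.fourier_eq']
  have hInt : Integrable (Function.uncurry fun (y l : E3) =>
      Complex.exp (((-2 * π * inner ℝ l (x + y) : ℝ) : ℂ) * Complex.I) • G l) (ν.prod volume) := by
    refine (hG.comp_snd ν).norm.mono' ?_ (Eventually.of_forall fun p => ?_)
    · refine AEStronglyMeasurable.smul (f := fun p : E3 × E3 =>
        Complex.exp (((-2 * π * inner ℝ p.2 (x + p.1) : ℝ) : ℂ) * Complex.I))
            ?_ hG.aestronglyMeasurable.comp_snd
      exact Continuous.aestronglyMeasurable (by fun_prop)
    · rw [Function.uncurry, norm_smul, Complex.norm_exp_ofReal_mul_I, one_mul]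
  rw [integral_integral_swap hInt]
  congr 1
  ext l
  rw [integral_smul_const, smul_eq_mul, smul_eq_mul, ← mul_assoc]
  congr 1
  rw [← norm_neg l, ← hν (-l), ← integral_const_mul]
  congr 1
  ext y
  rw [← Complex.exp_add]
  congr 1
  rw [inner_add_right, inner_neg_right, real_inner_comm y l]
  push_cast
  ring

end Pekar

namespace Pekar

open scoped ContDiff

theorem ae_eq_of_fourier_eq {f g : E3 → ℂ} (hf : Integrable f) (hg : Integrable g)
    (h : ∀ x, 𝓕 f x = 𝓕 g x) : ∀ᵐ x, f x = g x := by
  refine ae_eq_of_integral_contDiff_smul_eq hf.locallyIntegrable hg.locallyIntegrable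
    fun φ hφ hφc => ?_
  have hφ' : ContDiff ℝ ∞ fun x => (φ x : ℂ) := Complex.ofRealCLM.contDiff.comp hφ
  have hφc' : HasCompactSupport fun x => (φ x : ℂ) := hφc.comp_left (g := Complex.ofReal) rfl
  set Φ : 𝓢(E3, ℂ) := 𝓕⁻ (hφc'.toSchwartzMap hφ') with hΦ
  have h1 : ∀ x, 𝓕 (Φ : E3 → ℂ) x = (φ x : ℂ) := by
    intro x
    rw [← SchwartzMap.fourier_coe, hΦ, FourierTransform.fourier_fourierInv_eq]
    rfl
  have key : ∀ F : E3 → ℂ, Integrable F → ∫ x, φ x • F x = ∫ x, 𝓕 F x • Φ x := by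
    intro F hF
    have h2 := VectorFourier.integral_fourierIntegral_smul_eq_flip (L := innerₗ E3)
      Real.continuous_fourierChar continuous_inner hF (Φ.integrable (μ := volume))
    rw [flip_innerₗ] at h2
    refine Eq.trans ?_ h2.symm
    congr 1
    ext x
    change _ = F x • 𝓕 (Φ : E3 → ℂ) x
    rw [h1, Complex.real_smul, smul_eq_mul, mul_comm]
  rw [key f hf, key g hg]
  simp_rw [h]

theorem contDiff_fourier_bounded {v : E3 → ℂ} (hv : ∀ n : ℕ, Integrable fun k => ‖k‖ ^ n * ‖v k‖)
    (hvm : AEStronglyMeasurable v) : ContDiff ℝ ∞ (𝓕 v) ∧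
      ∀ n : ℕ, ∃ M, ∀ x, ‖iteratedFDeriv ℝ n (𝓕 v) x‖ ≤ M := by
  refine ⟨Real.contDiff_fourier (N := ⊤) fun n _ => hv n, fun n => ?_⟩
  refine ⟨∫ k, ‖VectorFourier.fourierPowSMulRight (innerSL ℝ) v k n‖, fun x => ?_⟩
  rw [Real.iteratedFDeriv_fourier (N := ⊤) (fun n _ => hv n) hvm le_top]
  exact VectorFourier.norm_fourierIntegral_le_integral_norm _ _ _ _ _

theorem exists_schwartzMap_of_eulerLagrange {v V : E3 → ℂ} {c : ℝ} (hc : c ≠ 0)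
    (hv : ∀ n : ℕ, Integrable fun k => ‖k‖ ^ n * ‖v k‖) (hvm : AEStronglyMeasurable v)
    (hV : Integrable V) (hVneg : ∀ k, V (-k) = V k)
    (hEL : ∀ l, (c * (1 + ‖l‖ ^ 2) : ℝ) * v l = ∫ k, V k * v (k + l)) :
    ∃ u : 𝓢(E3, ℂ), ∀ᵐ k, u k = v k := by
  have hvi : Integrable v := by
    have := hv 0
    simp only [pow_zero, one_mul] at this
    exact (integrable_norm_iff hvm).1 this
  obtain ⟨hsm, hbd⟩ := contDiff_fourier_bounded hv hvm
  obtain ⟨ν, hνp, hνm, hν⟩ := exists_measure_resolvent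
  set G : E3 → ℂ := convolution V v (ContinuousLinearMap.mul ℂ ℂ) volume with hG
  have hGi : Integrable G := hV.integrable_convolution _ hvi
  have hGv : v = fun l => (((1 + ‖l‖ ^ 2)⁻¹ : ℝ) : ℂ) * ((c : ℂ)⁻¹ * G l) := by
    ext l
    have h1 : G l = (c * (1 + ‖l‖ ^ 2) : ℝ) * v l := by
      rw [hEL, hG, convolution, ← integral_neg_eq_self]
      congr 1
      ext k
      simp [hVneg, add_comm]
    have h2 : (c : ℂ) ≠ 0 := by exact_mod_cast hc
    have h3 : (1 + (‖l‖ : ℂ) ^ 2) ≠ 0 := by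
      have : (1 + ‖l‖ ^ 2 : ℝ) ≠ 0 := by positivity
      exact_mod_cast this
    rw [h1]
    push_cast
    field_simp
  have hEL' : ∀ x, 𝓕 v x = ∫ y, (c : ℂ)⁻¹ * 𝓕 V (x + y) * 𝓕 v (x + y) ∂ν := by
    intro x
    conv_lhs => rw [hGv]
    rw [fourier_resolvent_eq_integral hν (hGi.const_mul _)]
    congr 1
    ext y
    rw [mul_assoc, ← Real.fourier_mul_convolution_eq hV hvi]
    simp only [Real.fourier_eq]
    rw [← integral_const_mul]
    congr 1
    ext l
    simp only [Circle.smul_def, smul_eq_mul]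
    ring
  have hdec := decay_of_eq_integral hνm (f := 𝓕 v) (U := fun x => (c : ℂ)⁻¹ * 𝓕 V x)
    (B := ∫ k, ‖v k‖) (K := ‖(c : ℂ)⁻¹‖ * ∫ k, ‖V k‖)
    (fun x => VectorFourier.norm_fourierIntegral_le_integral_norm _ _ _ _ _)
    (fun x => by
      rw [norm_mul]
      gcongr
      exact VectorFourier.norm_fourierIntegral_le_integral_norm _ _ _ _ _)
    (by
      have := (tendsto_integral_exp_inner_smul_cocompact V).const_mul (c : ℂ)⁻¹
      rw [mul_zero] at this
      exact this) hEL'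
  obtain ⟨φ, hφ⟩ := exists_schwartzMap_of_bounded hsm hbd hdec
  refine ⟨𝓕⁻ φ, ae_eq_of_fourier_eq (SchwartzMap.integrable _) hvi fun x => ?_⟩
  rw [← SchwartzMap.fourier_coe, FourierTransform.fourier_fourierInv_eq, hφ]

end Pekar

namespace Pekar

theorem integrable_ofReal_toReal {f : E3 → ℝ≥0∞} (hf : Measurable f) (h : ∫⁻ k, f k ≠ ∞) :
    Integrable fun k => ((f k).toReal : ℂ) :=
  (integrable_toReal_of_lintegral_ne_top hf.aemeasurable h).ofReal

theorem exists_schwartz_optimizer : ∃ u : 𝓢(E3, ℂ), (∀ᵐ k, u k = (‖u k‖ : ℂ)) ∧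
    sob (fun k => ‖u k‖ₑ) = 1 ∧ coulE (fun k => ‖u k‖ₑ) = coulC := by
  obtain ⟨w, hw, hs, hE, hEL⟩ := exists_maximizer_eulerLagrange
  have hpow := lintegral_wt_pow_mul_ne_top hw hs hEL
  have hwfin : ∀ᵐ k, w k < ∞ := by
    have := hpow 0
    simp only [pow_zero, one_mul] at this
    exact ae_lt_top hw this
  set V : E3 → ℝ≥0∞ := fun k => corr w w k * coul k with hV
  have hVm : Measurable V := (measurable_corr hw hw).mul measurable_coul
  have hVi : ∫⁻ k, V k ≠ ∞ := lintegral_corr_self_mul_coul_ne_top hw hs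
  have hVfin : ∀ᵐ k, V k < ∞ := ae_lt_top hVm hVi
  set v : E3 → ℂ := fun k => ((w k).toReal : ℂ) with hv
  have hvm : Measurable v := by fun_prop
  have hC0 : coulC.toReal ≠ 0 := (ENNReal.toReal_pos coulC_ne_zero coulC_lt_top.ne).ne'
  have hvint : ∀ n : ℕ, Integrable fun k => ‖k‖ ^ n * ‖v k‖ := by
    intro n
    refine ⟨by fun_prop, lt_of_le_of_lt (lintegral_mono fun k => ?_) (hpow n).lt_top⟩
    rw [enorm_mul, enorm_pow, enorm_norm, enorm_norm, hv]
    refine mul_le_mul' (pow_le_pow_left' ?_ n) ?_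
    · rw [wt]
      rcases le_total ‖k‖ₑ 1 with h | h
      · exact h.trans le_self_add
      · exact (le_self_pow h two_ne_zero).trans le_add_self
    · rw [← ofReal_norm, Complex.norm_real, Real.norm_of_nonneg ENNReal.toReal_nonneg]
      exact ENNReal.ofReal_toReal_le
  obtain ⟨u, hu⟩ := exists_schwartzMap_of_eulerLagrange (v := v) (V := fun k => ((V k).toReal : ℂ))
    hC0 hvint hvm.aestronglyMeasurable (integrable_ofReal_toReal hVm hVi)
    (fun k => by simp only [hV, coul_neg, corr_neg]) (fun l => by
      have h1 := congrArg ENNReal.toReal (hEL l)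
      rw [corr, ← integral_toReal] at h1
      · simp only [ENNReal.toReal_mul] at h1
        simp only [hv, ← Complex.ofReal_mul]
        rw [integral_complex_ofReal, ← h1]
        simp [wt, ENNReal.toReal_add]
      · exact (hVm.mul (hw.comp (measurable_add_const l))).aemeasurable
      · filter_upwards [hVfin, (measurePreserving_add_right volume l).quasiMeasurePreserving.ae
          hwfin] with k h1 h2 using ENNReal.mul_lt_top h1 h2)
  have huw : ∀ᵐ k, ‖u k‖ₑ = w k := by
    filter_upwards [hu, hwfin] with k h1 h2
    rw [h1, ← ofReal_norm, Complex.norm_real, Real.norm_of_nonneg ENNReal.toReal_nonneg,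
      ENNReal.ofReal_toReal h2.ne]
  refine ⟨u, ?_, ?_, ?_⟩
  · filter_upwards [hu] with k h1
    rw [h1, hv, Complex.norm_real, Real.norm_of_nonneg ENNReal.toReal_nonneg]
  · rw [← hs, sob, sob]
    refine lintegral_congr_ae ?_
    filter_upwards [huw] with k h1
    rw [h1]
  · rw [← hE, coulE, coulE]
    simp_rw [corr_congr_ae huw huw]

theorem lintegral_gaussian_eq_inv {r : ℝ} (hr : 0 < r) :
    ∫⁻ s in Set.Ioi (0 : ℝ), ENNReal.ofReal (2 * Real.exp (-(π * r ^ 2) * s ^ 2)) =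
      (ENNReal.ofReal r)⁻¹ := by
  have hb : 0 < π * r ^ 2 := by positivity
  rw [← ofReal_integral_eq_lintegral_ofReal
      ((integrable_exp_neg_mul_sq hb).integrableOn.const_mul 2)
    (Eventually.of_forall fun _ => by positivity), integral_const_mul, integral_gaussian_Ioi,
    ← ENNReal.ofReal_inv_of_pos hr]
  congr 1
  rw [show π / (π * r ^ 2) = (r⁻¹) ^ 2 by field_simp, Real.sqrt_sq (by positivity)]
  ring

theorem lintegral_gaussian_inv_eq {a : ℝ} (ha : 0 < a) :
    ∫⁻ s in Set.Ioi (0 : ℝ), ENNReal.ofReal (2 * s⁻¹ ^ 3 * Real.exp (-a * (s⁻¹) ^ 2)) =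
      ENNReal.ofReal a⁻¹ := by
  have h0 : IntegrableOn (fun t : ℝ => Real.exp (-a * t)) (Set.Ioi 0) :=
    exp_neg_integrableOn_Ioi 0 ha
  have hcong : ∀ s ∈ Set.Ioi (0 : ℝ), (|(-2 : ℝ)| * s ^ ((-2 : ℝ) - 1)) • Real.exp
      (-a * s ^ (-2 : ℝ)) = 2 * s⁻¹ ^ 3 * Real.exp (-a * (s⁻¹) ^ 2) := by
    intro s hs
    have hs : (0 : ℝ) < s := hs
    rw [show (-2 : ℝ) - 1 = -(3 : ℕ) by norm_num, show (-2 : ℝ) = -(2 : ℕ) by norm_num,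
      Real.rpow_neg hs.le, Real.rpow_neg hs.le, Real.rpow_natCast, Real.rpow_natCast, inv_pow,
      inv_pow, smul_eq_mul, abs_neg]
    norm_num
  have h1 := (integrableOn_Ioi_comp_rpow_iff (fun t : ℝ => Real.exp (-a * t))
    (p := -2) (by norm_num)).2 h0
  have h2 := integral_comp_rpow_Ioi (fun t : ℝ => Real.exp (-a * t)) (p := -2) (by norm_num)
  rw [setIntegral_congr_fun measurableSet_Ioi hcong] at h2
  rw [integrableOn_congr_fun hcong measurableSet_Ioi] at h1
  rw [← ofReal_integral_eq_lintegral_ofReal h1, h2]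
  · congr 1
    rw [integral_exp_mul_Ioi (by linarith)]
    simp
  · filter_upwards [ae_restrict_mem measurableSet_Ioi] with s hs
    have hs : (0 : ℝ) < s := hs
    positivity

theorem integral_fourier_mul_flip {f g : E3 → ℂ} (hf : Integrable f) (hg : Integrable g) :
    ∫ x, 𝓕 f x * g x = ∫ x, f x * 𝓕 g x := by
  have h2 := VectorFourier.integral_fourierIntegral_smul_eq_flip (L := innerₗ E3)
    Real.continuous_fourierChar continuous_inner hf hg
  rw [flip_innerₗ] at h2
  exact h2

theorem conj_fourier_ofReal (ρ : E3 → ℝ) (k : E3) :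
    (starRingEnd ℂ) (𝓕 (fun x => (ρ x : ℂ)) k) = 𝓕 (fun x => (ρ x : ℂ)) (-k) := by
  rw [Real.fourier_eq', Real.fourier_eq', ← integral_conj]
  congr 1
  ext x
  simp [← Complex.exp_conj, Complex.conj_ofNat]

theorem integral_gaussian_interaction {ρ : E3 → ℝ} (hρ : Integrable ρ) {s : ℝ} (hs : 0 < s) :
    ∫ k, ‖𝓕 (fun x => (ρ x : ℂ)) k‖ ^ 2 * Real.exp (-(π * ‖k‖ ^ 2) * s⁻¹ ^ 2) =
      s ^ 3 * ∫ x, ρ x * ∫ y, ρ y * Real.exp (-(π * ‖x - y‖ ^ 2) * s ^ 2) := by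
  set rc : E3 → ℂ := fun x => (ρ x : ℂ) with hrc
  have hrci : Integrable rc := hρ.ofReal
  set b : ℂ := ((π * s⁻¹ ^ 2 : ℝ) : ℂ) with hb
  have hbre : 0 < b.re := by rw [hb, Complex.ofReal_re]; positivity
  set g : E3 → ℂ := fun k => Complex.exp (-b * ‖k‖ ^ 2) with hg
  have hgi : Integrable g := by
    have := GaussianFourier.integrable_cexp_neg_mul_sq_norm_add hbre 0 (0 : E3)
    simpa [hg] using this
  have hG : ∀ x, 𝓕 g x = ((s ^ 3 * Real.exp (-(π * ‖x‖ ^ 2) * s ^ 2) : ℝ) : ℂ) := by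
    intro x
    rw [hg, fourier_gaussian_innerProductSpace hbre]
    have h1 : (π : ℂ) / b = ((s ^ 2 : ℝ) : ℂ) := by
      have : (s : ℂ) ≠ 0 := by exact_mod_cast hs.ne'
      have : (π : ℂ) ≠ 0 := by exact_mod_cast Real.pi_ne_zero
      rw [hb]
      push_cast
      field_simp
    have h2 : (s ^ 2) ^ (3 / 2 : ℝ) = s ^ 3 := by
      rw [← Real.rpow_natCast s 2, ← Real.rpow_mul hs.le, ← Real.rpow_natCast s 3]
      norm_num
    rw [h1, finrank_euclideanSpace_fin, Complex.ofReal_mul, ← h2,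
      Complex.ofReal_cpow (by positivity), Complex.ofReal_exp]
    congr 2
    · push_cast; ring
    · rw [div_eq_mul_inv, show -(π : ℂ) ^ 2 * (‖x‖ : ℂ) ^ 2 * b⁻¹ =
        -π * (‖x‖ : ℂ) ^ 2 * (π / b) by ring, h1]
      push_cast
      ring
  have hcont : Continuous (𝓕 rc) :=
    VectorFourier.fourierIntegral_continuous Real.continuous_fourierChar continuous_inner hrci
  have hbd : ∀ k, ‖𝓕 rc k‖ ≤ ∫ x, ‖rc x‖ := fun k =>
    VectorFourier.norm_fourierIntegral_le_integral_norm _ _ _ _ _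
  set h : E3 → ℂ := fun k => 𝓕 rc (-k) * g k with hh
  have hhi : Integrable h :=
    hgi.bdd_mul (c := ∫ x, ‖rc x‖) (hcont.comp continuous_neg).aestronglyMeasurable
      (Eventually.of_forall fun k => hbd _)
  have hFh : ∀ x, 𝓕 h x = ∫ y, rc y * 𝓕 g (x - y) := by
    intro x
    set F : E3 → ℂ := fun k => Complex.exp (((2 * π * inner ℝ k x : ℝ) : ℂ) * Complex.I) * g k
      with hF
    have hFi : Integrable F := by
      refine hgi.bdd_mul (c := 1) (Continuous.aestronglyMeasurable (by fun_prop))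
        (Eventually.of_forall fun k => ?_)
      rw [Complex.norm_exp_ofReal_mul_I]
    have h1 : 𝓕 h x = ∫ k, 𝓕 rc k * F k := by
      rw [Real.fourier_eq', ← integral_neg_eq_self]
      congr 1
      ext k
      simp only [hh, hF, hg, neg_neg, norm_neg, inner_neg_left, smul_eq_mul]
      rw [mul_neg, neg_mul, neg_mul, neg_neg]
      ring
    rw [h1, integral_fourier_mul_flip hrci hFi]
    congr 1
    ext y
    congr 1
    have hsymm : 𝓕 g (x - y) = 𝓕 g (y - x) := by rw [hG, hG, norm_sub_rev]
    rw [hsymm, Real.fourier_eq', Real.fourier_eq']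
    congr 1
    ext k
    simp only [hF, smul_eq_mul]
    rw [← mul_assoc, ← Complex.exp_add]
    congr 2
    rw [inner_sub_right]
    push_cast
    ring
  have key := integral_fourier_mul_flip hrci hhi
  have hL : ∫ k, 𝓕 rc k * h k =
      ((∫ k, ‖𝓕 rc k‖ ^ 2 * Real.exp (-(π * ‖k‖ ^ 2) * s⁻¹ ^ 2) : ℝ) : ℂ) := by
    rw [← integral_complex_ofReal]
    congr 1
    ext k
    rw [hh]
    simp only
    rw [hrc, ← conj_fourier_ofReal, ← mul_assoc, Complex.mul_conj, Complex.normSq_eq_norm_sq, hg,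
      hb]
    push_cast
    congr 2
    ring
  have hR : ∫ x, rc x * 𝓕 h x = ((s ^ 3 * ∫ x, ρ x * ∫ y, ρ y *
      Real.exp (-(π * ‖x - y‖ ^ 2) * s ^ 2) : ℝ) : ℂ) := by
    rw [← integral_const_mul, ← integral_complex_ofReal]
    congr 1
    ext x
    rw [hFh, mul_left_comm, Complex.ofReal_mul]
    congr 1
    rw [← integral_const_mul, ← integral_complex_ofReal]
    congr 1
    ext y
    rw [hG, hrc]
    push_cast
    ring
  rw [hL, hR] at key
  exact_mod_cast key

theorem lintegral_ofReal_eq_of_integral {α : Type*} [MeasurableSpace α] {μ : Measure α} {f : α → ℝ}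
    (hf : Integrable f μ) (h0 : ∀ x, 0 ≤ f x) :
    ∫⁻ x, ENNReal.ofReal (f x) ∂μ = ENNReal.ofReal (∫ x, f x ∂μ) :=
  (ofReal_integral_eq_lintegral_ofReal hf (Eventually.of_forall h0)).symm

theorem lintegral_gaussian_interaction {ρ : E3 → ℝ} (hρ : Integrable ρ) (h0 : ∀ x, 0 ≤ ρ x)
    {s : ℝ} (hs : 0 < s) :
    ∫⁻ x, ∫⁻ y, ENNReal.ofReal (ρ x) * ENNReal.ofReal (ρ y) *
      ENNReal.ofReal (2 * Real.exp (-(π * ‖x - y‖ ^ 2) * s ^ 2)) =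
    ∫⁻ k, ‖𝓕 (fun x => (ρ x : ℂ)) k‖ₑ ^ 2 *
      ENNReal.ofReal (2 * s⁻¹ ^ 3 * Real.exp (-(π * ‖k‖ ^ 2) * s⁻¹ ^ 2)) := by
  set K : E3 → E3 → ℝ := fun x y => Real.exp (-(π * ‖x - y‖ ^ 2) * s ^ 2) with hK
  have hK1 : ∀ x y, K x y ≤ 1 := fun x y => Real.exp_le_one_iff.2 (by
    have : 0 ≤ π * ‖x - y‖ ^ 2 * s ^ 2 := by positivity
    linarith)
  have hK0 : ∀ x y, 0 ≤ K x y := fun x y => (Real.exp_pos _).le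
  have hKc : Continuous (Function.uncurry K) := by fun_prop
  have hprod : Integrable (fun p : E3 × E3 => ρ p.1 * (ρ p.2 * K p.1 p.2))
      (volume.prod volume) := by
    have := (hρ.mul_prod hρ).mul_bdd (c := 1) hKc.aestronglyMeasurable
      (Eventually.of_forall fun p => by
        rw [Function.uncurry, Real.norm_of_nonneg (hK0 _ _)]; exact hK1 _ _)
    refine this.congr (Eventually.of_forall fun p => ?_)
    simp only [Function.uncurry, mul_assoc]
  have hL : ∫⁻ x, ∫⁻ y, ENNReal.ofReal (ρ x) * ENNReal.ofReal (ρ y) *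
      ENNReal.ofReal (2 * K x y) = ENNReal.ofReal (2 * ∫ x, ρ x * ∫ y, ρ y * K x y) := by
    have h1 : ∀ x, ∫ y, ρ x * (ρ y * K x y) = ρ x * ∫ y, ρ y * K x y := fun x =>
      integral_const_mul _ _
    simp_rw [← h1]
    rw [← integral_prod (fun p : E3 × E3 => ρ p.1 * (ρ p.2 * K p.1 p.2)) hprod,
      ← integral_const_mul, ← lintegral_ofReal_eq_of_integral (hprod.const_mul 2)
        (fun p => mul_nonneg zero_le_two (mul_nonneg (h0 _) (mul_nonneg (h0 _) (hK0 _ _)))),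
      lintegral_prod _ (hprod.const_mul 2).aestronglyMeasurable.aemeasurable.ennreal_ofReal]
    congr 1
    ext x
    congr 1
    ext y
    rw [← ENNReal.ofReal_mul (h0 x), ← ENNReal.ofReal_mul (mul_nonneg (h0 x) (h0 y))]
    congr 1
    ring
  rw [hL]
  have hR := integral_gaussian_interaction hρ hs
  have h2 : 2 * ∫ x, ρ x * ∫ y, ρ y * K x y = ∫ k, ‖𝓕 (fun x => (ρ x : ℂ)) k‖ ^ 2 *
      (2 * s⁻¹ ^ 3 * Real.exp (-(π * ‖k‖ ^ 2) * s⁻¹ ^ 2)) := by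
    calc 2 * ∫ x, ρ x * ∫ y, ρ y * K x y
        = 2 * s⁻¹ ^ 3 * (s ^ 3 * ∫ x, ρ x * ∫ y, ρ y * K x y) := by field_simp
      _ = _ := by
        rw [← hR, ← integral_const_mul]
        congr 1
        ext k
        ring
  have hcont : Continuous (𝓕 fun x => (ρ x : ℂ)) :=
    VectorFourier.fourierIntegral_continuous Real.continuous_fourierChar continuous_inner hρ.ofReal
  have hInt : Integrable fun k => ‖𝓕 (fun x => (ρ x : ℂ)) k‖ ^ 2 *
      (2 * s⁻¹ ^ 3 * Real.exp (-(π * ‖k‖ ^ 2) * s⁻¹ ^ 2)) := by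
    have hg : Integrable fun k : E3 => Real.exp (-(π * ‖k‖ ^ 2) * s⁻¹ ^ 2) := by
      have h3 : (0 : ℝ) < (((π * s⁻¹ ^ 2 : ℝ) : ℂ)).re := by
        rw [Complex.ofReal_re]; positivity
      have := (GaussianFourier.integrable_cexp_neg_mul_sq_norm_add h3 0 (0 : E3)).norm
      refine this.congr (Eventually.of_forall fun k => ?_)
      simp only [Complex.norm_exp]
      congr 1
      simp [← Complex.ofReal_pow, ← Complex.ofReal_mul]
      ring
    refine (hg.const_mul (2 * s⁻¹ ^ 3)).bdd_mul (c := (∫ x, ‖(ρ x : ℂ)‖) ^ 2)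
      (hcont.norm.pow 2).aestronglyMeasurable (Eventually.of_forall fun k => ?_)
    rw [norm_pow, norm_norm]
    gcongr
    exact VectorFourier.norm_fourierIntegral_le_integral_norm _ _ _ _ _
  rw [h2, ← lintegral_ofReal_eq_of_integral hInt fun k => by positivity]
  congr 1
  ext k
  rw [ENNReal.ofReal_mul (by positivity), ENNReal.ofReal_pow (norm_nonneg _), ofReal_norm]

theorem lintegral_coulomb_eq {ρ : E3 → ℝ} (hρm : Measurable ρ) (hρ : Integrable ρ)
    (h0 : ∀ x, 0 ≤ ρ x) :
    ∫⁻ x, ∫⁻ y, ENNReal.ofReal (ρ x) * ENNReal.ofReal (ρ y) * ‖x - y‖ₑ⁻¹ =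
      ENNReal.ofReal π⁻¹ * ∫⁻ k, ‖𝓕 (fun x => (ρ x : ℂ)) k‖ₑ ^ 2 * coul k := by
  have hcont : Continuous (𝓕 fun x => (ρ x : ℂ)) :=
    VectorFourier.fourierIntegral_continuous Real.continuous_fourierChar continuous_inner hρ.ofReal
  have h1 : ∀ x, ∫⁻ y, ENNReal.ofReal (ρ x) * ENNReal.ofReal (ρ y) * ‖x - y‖ₑ⁻¹ =
      ∫⁻ s in Set.Ioi (0 : ℝ), ∫⁻ y, ENNReal.ofReal (ρ x) * ENNReal.ofReal (ρ y) *
        ENNReal.ofReal (2 * Real.exp (-(π * ‖x - y‖ ^ 2) * s ^ 2)) := by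
    intro x
    rw [← lintegral_lintegral_swap (Measurable.aemeasurable (by fun_prop))]
    refine lintegral_congr_ae ?_
    filter_upwards [compl_mem_ae_iff.2 (measure_singleton (μ := (volume : Measure E3)) x)] with y hy
    have hxy : 0 < ‖x - y‖ := norm_pos_iff.2 (sub_ne_zero.2 fun h => hy h.symm)
    rw [lintegral_const_mul _ (by fun_prop), lintegral_gaussian_eq_inv hxy, ofReal_norm]
  simp_rw [h1]
  rw [lintegral_lintegral_swap (Measurable.aemeasurable ?_)]
  swap
  · exact Measurable.lintegral_prod_right' (f := fun p : (E3 × ℝ) × E3 => ENNReal.ofReal (ρ p.1.1) *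
      ENNReal.ofReal (ρ p.2) *
      ENNReal.ofReal (2 * Real.exp (-(π * ‖p.1.1 - p.2‖ ^ 2) * p.1.2 ^ 2))) (by fun_prop)
  rw [setLIntegral_congr_fun measurableSet_Ioi fun s hs =>
    lintegral_gaussian_interaction hρ h0 (s := s) hs]
  have hm : Measurable (𝓕 fun x => (ρ x : ℂ)) := hcont.measurable
  clear hcont h1
  generalize (𝓕 fun x => (ρ x : ℂ)) = R at hm ⊢
  rw [lintegral_lintegral_swap (Measurable.aemeasurable (by fun_prop)), ← lintegral_const_mul']
  swap; · simp
  refine lintegral_congr_ae ?_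
  filter_upwards [compl_mem_ae_iff.2 (measure_singleton (μ := (volume : Measure E3)) 0)] with k hk
  have hk0 : 0 < ‖k‖ := norm_pos_iff.2 hk
  rw [lintegral_const_mul _ (by fun_prop), lintegral_gaussian_inv_eq (by positivity), mul_left_comm,
    coul, mul_inv, ENNReal.ofReal_mul (by positivity), ENNReal.ofReal_inv_of_pos (by positivity),
    ENNReal.ofReal_inv_of_pos (by positivity), ENNReal.ofReal_pow (norm_nonneg _), ofReal_norm]

theorem lintegral_enorm_sq_eq (f : 𝓢(E3, ℂ)) :
    ∫⁻ x, ‖f x‖ₑ ^ 2 = ENNReal.ofReal (∫ x, ‖f x‖ ^ 2) := by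
  have hi : Integrable fun x => ‖f x‖ ^ 2 :=
    (memLp_two_iff_integrable_sq_norm f.continuous.aestronglyMeasurable).1 (f.memLp 2 volume)
  rw [← lintegral_ofReal_eq_of_integral hi fun x => by positivity]
  congr 1
  ext x
  rw [ENNReal.ofReal_pow (norm_nonneg _), ofReal_norm]

theorem lintegral_enorm_sq_fourier (f : 𝓢(E3, ℂ)) :
    ∫⁻ k, ‖(𝓕 f) k‖ₑ ^ 2 = ∫⁻ x, ‖f x‖ₑ ^ 2 := by
  rw [lintegral_enorm_sq_eq, lintegral_enorm_sq_eq, SchwartzMap.integral_norm_sq_fourier]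

open scoped LineDeriv in
theorem lintegral_enorm_sq_fderiv_apply (f : 𝓢(E3, ℂ)) (m : E3) :
    ∫⁻ x, ‖fderiv ℝ f x m‖ₑ ^ 2 =
      ENNReal.ofReal (4 * π ^ 2) * ∫⁻ k, ‖inner ℝ k m‖ₑ ^ 2 * ‖(𝓕 f) k‖ₑ ^ 2 := by
  have h := lintegral_enorm_sq_fourier (∂_{m} f)
  simp_rw [SchwartzMap.lineDerivOp_apply_eq_fderiv] at h
  rw [← h, SchwartzMap.fourier_lineDerivOp_eq, ← lintegral_const_mul']
  · congr 1
    ext k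
    rw [smul_apply, SchwartzMap.smulLeftCLM_apply_apply (by fun_prop), enorm_smul,
      enorm_smul, mul_pow, mul_pow]
    congr 1
    rw [← ofReal_norm, ← ENNReal.ofReal_pow (norm_nonneg _)]
    congr 1
    simp [abs_of_pos Real.pi_pos]
    ring
  · exact ENNReal.ofReal_ne_top

theorem enorm_sq_eq_sum (k : E3) :
    ∑ i, ‖inner ℝ k (EuclideanSpace.single i (1 : ℝ))‖ₑ ^ 2 = ‖k‖ₑ ^ 2 := by
  have h : ∀ i : Fin 3, ‖inner ℝ k (EuclideanSpace.single i (1 : ℝ))‖ₑ ^ 2 =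
      ENNReal.ofReal (‖k i‖ ^ 2) := fun i => by
    rw [EuclideanSpace.inner_single_right, ENNReal.ofReal_pow (norm_nonneg _), ofReal_norm]
    simp
  simp_rw [h]
  rw [← ENNReal.ofReal_sum_of_nonneg (fun _ _ => by positivity), ← EuclideanSpace.norm_sq_eq,
    ENNReal.ofReal_pow (norm_nonneg _), ofReal_norm]

theorem lintegral_sum_enorm_sq_fderiv (f : 𝓢(E3, ℂ)) :
    ∫⁻ x, ∑ i, ‖fderiv ℝ f x (EuclideanSpace.single i (1 : ℝ))‖ₑ ^ 2 =
      ENNReal.ofReal (4 * π ^ 2) * ∫⁻ k, ‖k‖ₑ ^ 2 * ‖(𝓕 f) k‖ₑ ^ 2 := by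
  have hc : Continuous (fderiv ℝ f) := (f.smooth 1).continuous_fderiv one_ne_zero
  have hF : Measurable (𝓕 f : 𝓢(E3, ℂ)) := (𝓕 f).continuous.measurable
  rw [lintegral_finsetSum _ fun i _ =>
    (hc.clm_apply continuous_const).enorm.measurable.pow_const 2]
  simp_rw [lintegral_enorm_sq_fderiv_apply]
  rw [← Finset.mul_sum, ← lintegral_finsetSum _ fun i _ => by fun_prop]
  simp_rw [← Finset.sum_mul, enorm_sq_eq_sum]

theorem norm_sq_le_sum (D : E3 →L[ℝ] ℂ) :
    ‖D‖ ^ 2 ≤ ∑ i, ‖D (EuclideanSpace.single i (1 : ℝ))‖ ^ 2 := by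
  have h : ‖D‖ ≤ √(∑ i, ‖D (EuclideanSpace.single i (1 : ℝ))‖ ^ 2) := by
    refine D.opNorm_le_bound (Real.sqrt_nonneg _) fun x => ?_
    have hx : x = ∑ i, x i • EuclideanSpace.single i (1 : ℝ) := by
      ext j; simp [Finset.sum_apply, Pi.single_apply]
    calc ‖D x‖ = ‖∑ i, x i • D (EuclideanSpace.single i (1 : ℝ))‖ := by
          conv_lhs => rw [hx]
          simp [map_sum]
      _ ≤ ∑ i, ‖D (EuclideanSpace.single i (1 : ℝ))‖ * ‖x i‖ := by
          refine (norm_sum_le _ _).trans (le_of_eq ?_)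
          simp_rw [norm_smul, mul_comm]
      _ ≤ √(∑ i, ‖D (EuclideanSpace.single i (1 : ℝ))‖ ^ 2) * √(∑ i, ‖x i‖ ^ 2) :=
          Real.sum_mul_le_sqrt_mul_sqrt _ _ _
      _ = _ := by rw [← EuclideanSpace.norm_eq]
  calc ‖D‖ ^ 2 ≤ √(∑ i, ‖D (EuclideanSpace.single i (1 : ℝ))‖ ^ 2) ^ 2 := by gcongr
    _ = _ := Real.sq_sqrt (by positivity)

theorem sum_norm_sq_le_of_real (D : E3 →L[ℝ] ℂ) (hD : ∀ x, (D x).im = 0) :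
    ∑ i, ‖D (EuclideanSpace.single i (1 : ℝ))‖ ^ 2 ≤ ‖D‖ ^ 2 := by
  set v : E3 := ∑ i, (D (EuclideanSpace.single i (1 : ℝ))).re • EuclideanSpace.single i (1 : ℝ)
    with hv
  have hre : ∀ i, ‖D (EuclideanSpace.single i (1 : ℝ))‖ ^ 2 =
      (D (EuclideanSpace.single i (1 : ℝ))).re ^ 2 := fun i => by
    rw [Complex.sq_norm, Complex.normSq_apply, hD]; ring
  have hvn : ‖v‖ ^ 2 = ∑ i, ‖D (EuclideanSpace.single i (1 : ℝ))‖ ^ 2 := by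
    rw [EuclideanSpace.norm_sq_eq]
    refine Finset.sum_congr rfl fun i _ => ?_
    rw [hre]
    simp [hv, Finset.sum_apply, Pi.single_apply]
  have hDv : (D v).re = ‖v‖ ^ 2 := by
    rw [hvn, hv, map_sum, Complex.re_sum]
    refine Finset.sum_congr rfl fun i _ => ?_
    rw [hre]
    simp [sq]
  rw [← hvn]
  have h1 : ‖v‖ ^ 2 ≤ ‖D‖ * ‖v‖ :=
    hDv ▸ ((Complex.re_le_norm _).trans (D.le_opNorm v))
  rcases (norm_nonneg v).eq_or_lt with h0 | h0
  · rw [← h0, zero_pow two_ne_zero]; positivity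
  · have : ‖v‖ ≤ ‖D‖ := by nlinarith
    gcongr

/-- The Coulomb self-energy of `|f|²`. -/
def pot (f : E3 → ℂ) : ℝ≥0∞ := ∫⁻ x, ∫⁻ y, ‖f x‖ₑ ^ 2 * ‖f y‖ₑ ^ 2 * ‖x - y‖ₑ⁻¹

theorem integrable_norm_sq (f : 𝓢(E3, ℂ)) : Integrable fun x => ‖f x‖ ^ 2 :=
  (memLp_two_iff_integrable_sq_norm f.continuous.aestronglyMeasurable).1 (f.memLp 2 volume)

theorem pot_eq (f : 𝓢(E3, ℂ)) :
    pot f = ENNReal.ofReal π⁻¹ * ∫⁻ k, ‖𝓕 (fun x => ((‖f x‖ ^ 2 : ℝ) : ℂ)) k‖ₑ ^ 2 * coul k := by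
  rw [← lintegral_coulomb_eq (ρ := fun x => ‖f x‖ ^ 2) (f.continuous.norm.pow 2).measurable
      (integrable_norm_sq f)
    fun x => by positivity]
  unfold pot
  simp_rw [ENNReal.ofReal_pow (norm_nonneg _), ofReal_norm]

theorem fourier_comp_sub_left (f : 𝓢(E3, ℂ)) (k x : E3) :
    𝓕 (fun l => (𝓕 f : 𝓢(E3, ℂ)) (k - l)) x = 𝐞 (-inner ℝ x k) • f x := by
  have h1 : f x = 𝓕⁻ (𝓕 f) x := by rw [FourierTransform.fourierInv_fourier_eq]
  rw [h1, SchwartzMap.fourierInv_coe, Real.fourierInv_eq, Real.fourier_eq,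
    ← integral_sub_left_eq_self _ volume k, Circle.smul_def, ← integral_smul]
  congr 1
  ext l
  rw [sub_sub_cancel, ← Circle.smul_def, smul_smul]
  congr 1
  rw [← AddChar.map_add_eq_mul]
  congr 1
  rw [inner_sub_left, real_inner_comm x k]
  ring

theorem fourier_conj (f : E3 → ℂ) (l : E3) :
    𝓕 (fun x => (starRingEnd ℂ) (f x)) l = (starRingEnd ℂ) (𝓕 f (-l)) := by
  rw [Real.fourier_eq', Real.fourier_eq', ← integral_conj]
  congr 1
  ext x
  simp [← Complex.exp_conj, Complex.conj_ofNat]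

theorem fourier_norm_sq (f : 𝓢(E3, ℂ)) (k : E3) :
    𝓕 (fun x => ((‖f x‖ ^ 2 : ℝ) : ℂ)) k =
      ∫ l, (starRingEnd ℂ) ((𝓕 f) l) * (𝓕 f) (l + k) := by
  have hf : Integrable f := f.integrable (μ := volume)
  have hu : Integrable (𝓕 f : 𝓢(E3, ℂ)) := (𝓕 f).integrable (μ := volume)
  have h := integral_fourier_mul_flip (f := fun l => (𝓕 f) (k - l))
    (g := fun x => (starRingEnd ℂ) (f x)) (hu.comp_sub_left k)
        ((LinearIsometryEquiv.integrable_comp_iff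
      (Complex.conjLIE)).2 hf)
  simp_rw [fourier_comp_sub_left, fourier_conj, ← SchwartzMap.fourier_coe] at h
  rw [Real.fourier_eq]
  calc _ = ∫ x, 𝐞 (-inner ℝ x k) • f x * (starRingEnd ℂ) (f x) := by
        congr 1
        ext x
        rw [smul_mul_assoc, Complex.mul_conj, Complex.normSq_eq_norm_sq]
    _ = ∫ l, (𝓕 f) (k - l) * (starRingEnd ℂ) ((𝓕 f) (-l)) := h
    _ = _ := by
        rw [← integral_neg_eq_self]
        congr 1
        ext l
        rw [sub_neg_eq_add, neg_neg, mul_comm, add_comm]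

theorem enorm_fourier_norm_sq_le (f : 𝓢(E3, ℂ)) (k : E3) :
    ‖𝓕 (fun x => ((‖f x‖ ^ 2 : ℝ) : ℂ)) k‖ₑ ≤
      corr (fun l => ‖(𝓕 f) l‖ₑ) (fun l => ‖(𝓕 f) l‖ₑ) k := by
  rw [fourier_norm_sq]
  refine (enorm_integral_le_lintegral_enorm _).trans (le_of_eq ?_)
  simp [corr, enorm_mul]

theorem enorm_fourier_norm_sq_eq (f : 𝓢(E3, ℂ)) (h0 : ∀ᵐ l, (𝓕 f) l = (‖(𝓕 f) l‖ : ℂ)) (k : E3) :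
    ‖𝓕 (fun x => ((‖f x‖ ^ 2 : ℝ) : ℂ)) k‖ₑ =
      corr (fun l => ‖(𝓕 f) l‖ₑ) (fun l => ‖(𝓕 f) l‖ₑ) k := by
  have h1 : ∀ᵐ l, (𝓕 f) (l + k) = (‖(𝓕 f) (l + k)‖ : ℂ) :=
    (measurePreserving_add_right volume k).quasiMeasurePreserving.ae h0
  have hi : Integrable fun l => ‖(𝓕 f) l‖ * ‖(𝓕 f) (l + k)‖ := by
    have hu : Integrable (𝓕 f : 𝓢(E3, ℂ)) := (𝓕 f).integrable (μ := volume)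
    obtain ⟨C, hC⟩ := (𝓕 f).decay 0 0
    refine hu.norm.mul_bdd (c := C) (Continuous.aestronglyMeasurable (by fun_prop))
      (Eventually.of_forall fun l => ?_)
    simpa using hC.2 (l + k)
  have h2 : ∫ l, (starRingEnd ℂ) ((𝓕 f) l) * (𝓕 f) (l + k) =
      ((∫ l, ‖(𝓕 f) l‖ * ‖(𝓕 f) (l + k)‖ : ℝ) : ℂ) := by
    rw [← integral_complex_ofReal]
    refine integral_congr_ae ?_
    filter_upwards [h0, h1] with l hl hl'
    rw [hl, hl', Complex.conj_ofReal, ← Complex.ofReal_mul, ← hl, ← hl']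
  rw [fourier_norm_sq, h2, ← ofReal_norm, Complex.norm_real, ofReal_norm,
      Real.enorm_of_nonneg (by positivity),
    ← lintegral_ofReal_eq_of_integral hi fun l => by positivity]
  unfold corr
  simp_rw [ENNReal.ofReal_mul (norm_nonneg _), ofReal_norm]

theorem pot_le_coulE (f : 𝓢(E3, ℂ)) :
    pot f ≤ ENNReal.ofReal π⁻¹ * coulE fun l => ‖(𝓕 f) l‖ₑ := by
  rw [pot_eq]
  unfold coulE
  gcongr
  exact enorm_fourier_norm_sq_le f _

theorem pot_eq_coulE (f : 𝓢(E3, ℂ)) (h0 : ∀ᵐ l, (𝓕 f) l = (‖(𝓕 f) l‖ : ℂ)) :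
    pot f = ENNReal.ofReal π⁻¹ * coulE fun l => ‖(𝓕 f) l‖ₑ := by
  rw [pot_eq]
  unfold coulE
  simp_rw [enorm_fourier_norm_sq_eq f h0]

/-- The mass plus the suitably normalized kinetic energy is the squared Sobolev norm. -/
theorem sob_fourier (f : 𝓢(E3, ℂ)) :
    sob (fun l => ‖(𝓕 f) l‖ₑ) = (∫⁻ x, ‖f x‖ₑ ^ 2) + (ENNReal.ofReal (4 * π ^ 2))⁻¹ *
      ∫⁻ x, ∑ i, ‖fderiv ℝ f x (EuclideanSpace.single i (1 : ℝ))‖ₑ ^ 2 := by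
  have hF : Measurable (𝓕 f : 𝓢(E3, ℂ)) := (𝓕 f).continuous.measurable
  rw [lintegral_sum_enorm_sq_fderiv, ← mul_assoc, ENNReal.inv_mul_cancel
    (ENNReal.ofReal_pos.2 (by positivity)).ne' ENNReal.ofReal_ne_top, one_mul,
    ← lintegral_enorm_sq_fourier]
  unfold sob wt
  rw [← lintegral_add_left (by fun_prop)]
  simp_rw [add_mul, one_mul]

/-- The squared `L²` norm. -/
def mass (f : E3 → ℂ) : ℝ≥0∞ := ∫⁻ x, ‖f x‖ₑ ^ 2

/-- The kinetic energy, normalized by the factor `4π²` of the Fourier transform. -/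
def kin (f : E3 → ℂ) : ℝ≥0∞ := (ENNReal.ofReal (4 * π ^ 2))⁻¹ * ∫⁻ x, ‖fderiv ℝ f x‖ₑ ^ 2

/-- The optimal constant in `pot f ≤ potC * (mass f + kin f) ^ 2`. -/
def potC : ℝ≥0∞ := ENNReal.ofReal π⁻¹ * coulC

theorem enorm_sq_le_sum (D : E3 →L[ℝ] ℂ) :
    ‖D‖ₑ ^ 2 ≤ ∑ i, ‖D (EuclideanSpace.single i (1 : ℝ))‖ₑ ^ 2 := by
  simp_rw [← ofReal_norm, ← ENNReal.ofReal_pow (norm_nonneg _)]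
  rw [← ENNReal.ofReal_sum_of_nonneg fun _ _ => by positivity]
  exact ENNReal.ofReal_le_ofReal (norm_sq_le_sum D)

theorem sum_enorm_sq_le_of_real (D : E3 →L[ℝ] ℂ) (hD : ∀ x, (D x).im = 0) :
    ∑ i, ‖D (EuclideanSpace.single i (1 : ℝ))‖ₑ ^ 2 ≤ ‖D‖ₑ ^ 2 := by
  simp_rw [← ofReal_norm, ← ENNReal.ofReal_pow (norm_nonneg _)]
  rw [← ENNReal.ofReal_sum_of_nonneg fun _ _ => by positivity]
  exact ENNReal.ofReal_le_ofReal (sum_norm_sq_le_of_real D hD)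

theorem mass_lt_top (f : 𝓢(E3, ℂ)) : mass f < ∞ := by
  rw [mass, lintegral_enorm_sq_eq]; exact ENNReal.ofReal_lt_top

theorem mass_add_kin_le_sob (f : 𝓢(E3, ℂ)) : mass f + kin f ≤ sob fun l => ‖(𝓕 f) l‖ₑ := by
  rw [sob_fourier]
  unfold mass kin
  gcongr
  exact enorm_sq_le_sum _

theorem sob_le_mass_add_kin (f : 𝓢(E3, ℂ)) (hf : ∀ x, (f x).im = 0) :
    sob (fun l => ‖(𝓕 f) l‖ₑ) ≤ mass f + kin f := by
  rw [sob_fourier]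
  unfold mass kin
  gcongr with x
  refine sum_enorm_sq_le_of_real _ fun m => ?_
  have h1 : HasFDerivAt (fun x => (f x).im) (Complex.imCLM.comp (fderiv ℝ f x)) x :=
    Complex.imCLM.hasFDerivAt.comp x f.differentiableAt.hasFDerivAt
  have h2 : HasFDerivAt (fun x => (f x).im) (0 : E3 →L[ℝ] ℝ) x := by
    simp_rw [hf]; exact hasFDerivAt_const _ _
  exact congrArg (fun L : E3 →L[ℝ] ℝ => L m) (h1.unique h2)

theorem lintegral_enorm_sq_fderiv_lt_top (f : 𝓢(E3, ℂ)) :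
    ∫⁻ x, ‖fderiv ℝ f x‖ₑ ^ 2 < ∞ := by
  have h := (SchwartzMap.fderivCLM ℝ E3 ℂ f).memLp 2 volume
  have := (memLp_two_iff_integrable_sq_norm h.1).1 h
  have h2 := this.2
  rw [hasFiniteIntegral_iff_enorm] at h2
  simpa [enorm_pow] using h2

theorem kin_lt_top (f : 𝓢(E3, ℂ)) : kin f < ∞ :=
  ENNReal.mul_lt_top (ENNReal.inv_lt_top.2 (ENNReal.ofReal_pos.2 (by positivity)))
    (lintegral_enorm_sq_fderiv_lt_top f)

theorem measurable_enorm_fourier (f : 𝓢(E3, ℂ)) : Measurable fun l => ‖(𝓕 f) l‖ₑ :=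
  (𝓕 f).continuous.measurable.enorm

theorem pot_le_of_real (f : 𝓢(E3, ℂ)) (hf : ∀ x, (f x).im = 0) :
    pot f ≤ potC * (mass f + kin f) ^ 2 := by
  have hs := sob_le_mass_add_kin f hf
  refine (pot_le_coulE f).trans ?_
  rw [potC, mul_assoc]
  gcongr
  refine (coulE_le_coulC (measurable_enorm_fourier f) ?_).trans ?_
  · exact (hs.trans_lt (ENNReal.add_lt_top.2 ⟨mass_lt_top f, kin_lt_top f⟩)).ne
  · gcongr

theorem exists_pot_eq : ∃ f : 𝓢(E3, ℂ), mass f + kin f ≤ 1 ∧ pot f = potC := by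
  obtain ⟨u, hu, h1, hC⟩ := exists_schwartz_optimizer
  have e : 𝓕 (𝓕⁻ u) = u := FourierTransform.fourier_fourierInv_eq u
  refine ⟨𝓕⁻ u, (mass_add_kin_le_sob _).trans ?_, ?_⟩
  · rw [e, h1]
  · rw [pot_eq_coulE _ (by rw [e]; exact hu), e, hC, potC]

theorem potC_lt_top : potC < ∞ := ENNReal.mul_lt_top ENNReal.ofReal_lt_top coulC_lt_top

theorem potC_ne_zero : potC ≠ 0 :=
  mul_ne_zero (ENNReal.ofReal_pos.2 (by positivity)).ne' coulC_ne_zero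

end Pekar

namespace Pekar

section Composition
open scoped ContDiff

theorem exists_bound_iteratedFDeriv_comp {E F G : Type*} [NormedAddCommGroup E] [NormedSpace ℝ E]
    [NormedAddCommGroup F] [NormedSpace ℝ F] [ProperSpace F] [NormedAddCommGroup G]
    [NormedSpace ℝ G] (ψ : SchwartzMap E F) {g : F → G} (hg : ContDiff ℝ ∞ g) (n : ℕ) :
    ∃ M, ∀ x, ‖iteratedFDeriv ℝ n (g ∘ ψ) x‖ ≤ M := by
  have hψ : ∀ i : ℕ, ∃ M, ∀ x, ‖iteratedFDeriv ℝ i ψ x‖ ≤ M := fun i => by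
    obtain ⟨M, -, hM⟩ := ψ.decay 0 i
    exact ⟨M, fun x => by simpa using hM x⟩
  choose M hM using hψ
  have hM0 : ∀ i, 0 ≤ M i := fun i => (norm_nonneg _).trans (hM i 0)
  have hC : ∀ i : ℕ, ∃ C, ∀ x, ‖iteratedFDeriv ℝ i g (ψ x)‖ ≤ C := fun i => by
    obtain ⟨C, hC⟩ := (isCompact_closedBall (0 : F) (M 0)).exists_bound_of_continuousOn
      (hg.continuous_iteratedFDeriv (m := i) (mod_cast le_top)).continuousOn
    refine ⟨C, fun x => hC _ ?_⟩
    simpa using hM 0 x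
  choose C hC using hC
  have hC0 : ∀ i, 0 ≤ C i := fun i => (norm_nonneg _).trans (hC i 0)
  refine ⟨n.factorial * (∑ i ∈ Finset.range (n + 1), C i) *
    (1 + ∑ i ∈ Finset.range (n + 1), M i) ^ n, fun x => ?_⟩
  refine norm_iteratedFDeriv_comp_le hg (ψ.smooth _)
    (mod_cast le_top) x (fun i hi => (hC i x).trans ?_) fun i h1 hi => (hM i x).trans ?_
  · exact Finset.single_le_sum (f := C) (fun j _ => hC0 j) (Finset.mem_range.2 (by omega))
  · have h2 : M i ≤ 1 + ∑ i ∈ Finset.range (n + 1), M i :=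
      le_add_of_nonneg_of_le zero_le_one
        (Finset.single_le_sum (f := M) (fun j _ => hM0 j) (Finset.mem_range.2 (by omega)))
    have h3 : 1 ≤ 1 + ∑ i ∈ Finset.range (n + 1), M i :=
      le_add_of_nonneg_right (Finset.sum_nonneg fun j _ => hM0 j)
    exact h2.trans (le_self_pow₀ h3 (by omega))

theorem exists_schwartzMap_comp {E F G : Type*} [NormedAddCommGroup E] [NormedSpace ℝ E]
    [NormedAddCommGroup F] [NormedSpace ℝ F] [ProperSpace F] [NormedAddCommGroup G]
    [NormedSpace ℝ G] (ψ : SchwartzMap E F) {g : F → G} (hg : ContDiff ℝ ∞ g)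
    (hb : ∀ z, ‖g z‖ ≤ ‖z‖) : ∃ f : SchwartzMap E G, ∀ x, f x = g (ψ x) := by
  refine exists_schwartzMap_of_bounded (f := g ∘ ψ) (hg.comp (ψ.smooth _))
    (exists_bound_iteratedFDeriv_comp ψ hg) fun k => ⟨2 ^ k *
      ((Finset.Iic (k, 0)).sup fun m => SchwartzMap.seminorm ℝ m.1 m.2) ψ, fun x => ?_⟩
  refine le_trans (mul_le_mul_of_nonneg_left (hb (ψ x)) (by positivity)) ?_
  have := SchwartzMap.one_add_le_sup_seminorm_apply (𝕜 := ℝ) (m := (k, 0)) (le_refl k)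
    (le_refl 0) ψ x
  simpa using this

/-- A smooth approximation of the modulus. -/
def softAbs (ε : ℝ) (z : ℂ) : ℝ := √(‖z‖ ^ 2 + ε ^ 2) - ε

theorem contDiff_softAbs {ε : ℝ} (hε : 0 < ε) : ContDiff ℝ ∞ (softAbs ε) :=
  (((contDiff_norm_sq ℝ).add contDiff_const).sqrt fun z => by positivity).sub contDiff_const

end Composition

theorem softAbs_sub_le {ε : ℝ} (z w : ℂ) : softAbs ε z - softAbs ε w ≤ ‖z - w‖ := by
  have h1 : √(‖z‖ ^ 2 + ε ^ 2) ≤ √(‖w‖ ^ 2 + ε ^ 2) + ‖z - w‖ := by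
    refine Real.sqrt_le_iff.2 ⟨by positivity, ?_⟩
    have h2 : ‖w‖ ≤ √(‖w‖ ^ 2 + ε ^ 2) := Real.le_sqrt_of_sq_le (by nlinarith)
    have h3 : ‖z‖ ≤ ‖w‖ + ‖z - w‖ := by linarith [norm_sub_norm_le z w]
    have h4 := Real.sq_sqrt (show 0 ≤ ‖w‖ ^ 2 + ε ^ 2 by positivity)
    nlinarith [norm_nonneg z, norm_nonneg w, norm_nonneg (z - w)]
  unfold softAbs
  linarith

theorem lipschitzWith_softAbs (ε : ℝ) : LipschitzWith 1 (softAbs ε) :=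
  LipschitzWith.of_dist_le_mul fun z w => by
    rw [NNReal.coe_one, one_mul, Real.dist_eq, dist_eq_norm]
    exact abs_sub_le_iff.2 ⟨softAbs_sub_le z w, norm_sub_rev z w ▸ softAbs_sub_le w z⟩

theorem softAbs_zero {ε : ℝ} (hε : 0 < ε) : softAbs ε 0 = 0 := by
  simp [softAbs, Real.sqrt_sq hε.le]

theorem norm_softAbs_le {ε : ℝ} (hε : 0 < ε) (z : ℂ) : ‖softAbs ε z‖ ≤ ‖z‖ := by
  have := (lipschitzWith_softAbs ε).dist_le_mul z 0
  simpa [softAbs_zero hε] using this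

theorem tendsto_softAbs (z : ℂ) : Tendsto (fun ε => softAbs ε z) (𝓝 0) (𝓝 ‖z‖) := by
  have h : Continuous fun ε => softAbs ε z := by unfold softAbs; fun_prop
  simpa [softAbs] using h.tendsto 0

theorem exists_softAbs_comp (ψ : 𝓢(E3, ℂ)) {ε : ℝ} (hε : 0 < ε) :
    ∃ f : 𝓢(E3, ℂ), (∀ x, f x = (softAbs ε (ψ x) : ℂ)) ∧ mass f ≤ mass ψ ∧ kin f ≤ kin ψ := by
  obtain ⟨f, hf⟩ := exists_schwartzMap_comp ψ
    (Complex.ofRealCLM.contDiff.comp (contDiff_softAbs hε)) (fun z => by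
      simpa using norm_softAbs_le hε z)
  replace hf : ∀ x, f x = (softAbs ε (ψ x) : ℂ) := hf
  refine ⟨f, hf, ?_, ?_⟩
  · unfold mass
    gcongr with x
    rw [hf, ← ofReal_norm, ← ofReal_norm, Complex.norm_real]
    exact ENNReal.ofReal_le_ofReal (norm_softAbs_le hε _)
  · unfold kin
    gcongr with x
    rw [← ofReal_norm, ← ofReal_norm]
    apply ENNReal.ofReal_le_ofReal
    have hL : LipschitzWith 1 fun z => (softAbs ε z : ℂ) := by
      have := Complex.isometry_ofReal.lipschitz.comp (lipschitzWith_softAbs ε)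
      rwa [one_mul] at this
    have hd : Differentiable ℝ fun z => (softAbs ε z : ℂ) :=
      Complex.ofRealCLM.differentiable.comp ((contDiff_softAbs hε).differentiable (by simp))
    have hcomp : (f : E3 → ℂ) = (fun z => (softAbs ε z : ℂ)) ∘ ψ := funext hf
    rw [hcomp, fderiv_comp x (hd _) ψ.differentiableAt]
    refine (ContinuousLinearMap.opNorm_comp_le _ _).trans ?_
    refine mul_le_of_le_one_left (norm_nonneg _) ?_
    simpa using norm_fderiv_le_of_lipschitz ℝ hL

theorem pot_eq_prod {f : E3 → ℂ} (hf : Measurable f) :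
    pot f = ∫⁻ p : E3 × E3, ‖f p.1‖ₑ ^ 2 * ‖f p.2‖ₑ ^ 2 * ‖p.1 - p.2‖ₑ⁻¹ := by
  rw [Measure.volume_eq_prod, lintegral_prod _ (Measurable.aemeasurable (by fun_prop)), pot]

theorem pot_le_liminf {f : ℕ → E3 → ℂ} {g : E3 → ℂ} (hf : ∀ n, Measurable (f n))
    (hg : Measurable g) (h : ∀ x, Tendsto (fun n => ‖f n x‖ₑ) atTop (𝓝 ‖g x‖ₑ)) :
    pot g ≤ liminf (fun n => pot (f n)) atTop := by
  rw [pot_eq_prod hg]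
  simp_rw [pot_eq_prod (hf _)]
  refine le_trans (lintegral_mono fun p => ?_) (lintegral_liminf_le fun n => by
    have := hf n; fun_prop)
  by_cases h0 : ‖g p.1‖ₑ ^ 2 * ‖g p.2‖ₑ ^ 2 = 0
  · simp only [h0, zero_mul]; exact bot_le
  · refine (Tendsto.liminf_eq (ENNReal.Tendsto.mul_const
      (ENNReal.Tendsto.mul (ENNReal.Tendsto.pow (n := 2) (h p.1))
      (Or.inr (by simp)) (ENNReal.Tendsto.pow (n := 2) (h p.2)) (Or.inr (by simp))) (Or.inl h0))).ge

theorem pot_le (ψ : 𝓢(E3, ℂ)) : pot ψ ≤ potC * (mass ψ + kin ψ) ^ 2 := by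
  have hpos : ∀ n : ℕ, (0 : ℝ) < 1 / ((n : ℝ) + 1) := fun n => Nat.one_div_pos_of_nat
  choose f hf hm hk using fun n => exists_softAbs_comp ψ (hpos n)
  refine (pot_le_liminf (f := fun n => f n) (fun n => (f n).continuous.measurable)
    ψ.continuous.measurable fun x => ?_).trans (liminf_le_of_le (by isBoundedDefault)
      fun b hb => ?_)
  · have h1 := ((tendsto_softAbs (ψ x)).comp tendsto_one_div_add_atTop_nhds_zero_nat).enorm
    refine (h1.congr fun n => ?_).trans (le_of_eq ?_)
    · rw [hf, ← ofReal_norm, ← ofReal_norm, Complex.norm_real]; rfl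
    · rw [enorm_norm]
  · obtain ⟨n, hn⟩ := hb.exists
    refine hn.trans ((pot_le_of_real (f n) fun x => by rw [hf, Complex.ofReal_im]).trans ?_)
    gcongr
    exacts [hm n, hk n]

theorem lintegral_comp_smul_E3 (g : E3 → ℝ≥0∞) {r : ℝ} (hr : 0 < r) :
    ∫⁻ x, g (r • x) = ENNReal.ofReal (r⁻¹ ^ 3) * ∫⁻ x, g x := by
  have h : ∫⁻ x, g (r • x) = ∫⁻ x, g x ∂(Measure.map (r • ·) (volume : Measure E3)) :=
    ((Homeomorph.smulOfNeZero r hr.ne').measurableEmbedding.lintegral_map g).symm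
  rw [h, Measure.map_addHaar_smul _ hr.ne', lintegral_smul_measure, finrank_euclideanSpace_fin,
    abs_of_pos (by positivity), inv_pow, smul_eq_mul]

theorem mass_comp_smul (f : E3 → ℂ) {r : ℝ} (hr : 0 < r) (a : ℝ) :
    mass (fun x => a • f (r • x)) = ENNReal.ofReal (a ^ 2 * r⁻¹ ^ 3) * mass f := by
  unfold mass
  rw [lintegral_comp_smul_E3 (fun x => ‖a • f x‖ₑ ^ 2) hr, ENNReal.ofReal_mul (by positivity),
    mul_comm (ENNReal.ofReal (a ^ 2)), mul_assoc, ← lintegral_const_mul' (ENNReal.ofReal (a ^ 2)) _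
      ENNReal.ofReal_ne_top]
  simp_rw [enorm_smul, mul_pow, ← enorm_pow a, Real.enorm_of_nonneg (sq_nonneg a)]

theorem kin_comp_smul {f : E3 → ℂ} (hf : Differentiable ℝ f) {r : ℝ} (hr : 0 < r) (a : ℝ) :
    kin (fun x => a • f (r • x)) = ENNReal.ofReal (a ^ 2 * r⁻¹) * kin f := by
  have hd : ∀ x, fderiv ℝ (fun x => a • f (r • x)) x = (a * r) • fderiv ℝ f (r • x) := fun x => by
    have h1 : HasFDerivAt (fun x : E3 => r • x) (r • ContinuousLinearMap.id ℝ E3) x :=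
      (hasFDerivAt_id x).const_smul r
    have h2 : HasFDerivAt (fun x => a • f (r • x))
        (a • (fderiv ℝ f (r • x)).comp (r • ContinuousLinearMap.id ℝ E3)) x :=
      ((hf (r • x)).hasFDerivAt.comp x h1).const_smul a
    rw [h2.fderiv]
    ext m
    simp [mul_assoc]
  unfold kin
  simp_rw [hd]
  rw [lintegral_comp_smul_E3 (fun x => ‖(a * r) • fderiv ℝ f x‖ₑ ^ 2) hr, mul_left_comm]
  simp_rw [enorm_smul, mul_pow, ← enorm_pow (a * r), Real.enorm_of_nonneg (sq_nonneg (a * r))]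
  rw [lintegral_const_mul' _ _ ENNReal.ofReal_ne_top, mul_left_comm _ (ENNReal.ofReal _),
    ← mul_assoc, ← ENNReal.ofReal_mul (by positivity)]
  congr 2
  field_simp

theorem pot_comp_smul (f : E3 → ℂ) {r : ℝ} (hr : 0 < r) (a : ℝ) :
    pot (fun x => a • f (r • x)) = ENNReal.ofReal (a ^ 4 * r⁻¹ ^ 5) * pot f := by
  have hn : ∀ x y : E3, ‖x - y‖ₑ⁻¹ = ENNReal.ofReal r * ‖r • x - r • y‖ₑ⁻¹ := fun x y => by
    rw [← smul_sub, enorm_smul, Real.enorm_of_nonneg hr.le, ENNReal.mul_inv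
      (Or.inl (ENNReal.ofReal_pos.2 hr).ne') (Or.inl ENNReal.ofReal_ne_top), ← mul_assoc,
      ENNReal.mul_inv_cancel (ENNReal.ofReal_pos.2 hr).ne' ENNReal.ofReal_ne_top, one_mul]
  have h0 : pot (fun x => a • f (r • x)) = ∫⁻ x, ∫⁻ y, ‖a • f (r • x)‖ₑ ^ 2 *
      ‖a • f (r • y)‖ₑ ^ 2 * (ENNReal.ofReal r * ‖r • x - r • y‖ₑ⁻¹) := by
    simp_rw [← hn]; rfl
  rw [h0, pot]
  have h1 : ∀ x : E3, ∫⁻ y, ‖a • f (r • x)‖ₑ ^ 2 * ‖a • f (r • y)‖ₑ ^ 2 *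
      (ENNReal.ofReal r * ‖r • x - r • y‖ₑ⁻¹) = ENNReal.ofReal (r⁻¹ ^ 3) *
      ∫⁻ y, ‖a • f (r • x)‖ₑ ^ 2 * ‖a • f y‖ₑ ^ 2 * (ENNReal.ofReal r * ‖r • x - y‖ₑ⁻¹) :=
    fun x => lintegral_comp_smul_E3 (fun y => ‖a • f (r • x)‖ₑ ^ 2 * ‖a • f y‖ₑ ^ 2 *
      (ENNReal.ofReal r * ‖r • x - y‖ₑ⁻¹)) hr
  simp_rw [h1]
  rw [lintegral_const_mul' _ _ ENNReal.ofReal_ne_top,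
    lintegral_comp_smul_E3 (fun x => ∫⁻ y, ‖a • f x‖ₑ ^ 2 * ‖a • f y‖ₑ ^ 2 *
      (ENNReal.ofReal r * ‖x - y‖ₑ⁻¹)) hr, ← mul_assoc, ← ENNReal.ofReal_mul (by positivity)]
  have h2 : ∀ x y : E3, ‖a • f x‖ₑ ^ 2 * ‖a • f y‖ₑ ^ 2 * (ENNReal.ofReal r * ‖x - y‖ₑ⁻¹) =
      ENNReal.ofReal (a ^ 4 * r) * (‖f x‖ₑ ^ 2 * ‖f y‖ₑ ^ 2 * ‖x - y‖ₑ⁻¹) := fun x y => by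
    simp_rw [enorm_smul, mul_pow, ← enorm_pow a, Real.enorm_of_nonneg (sq_nonneg a)]
    rw [ENNReal.ofReal_mul (by positivity), show a ^ 4 = a ^ 2 * a ^ 2 by ring,
      ENNReal.ofReal_mul (by positivity)]
    ring
  simp_rw [h2, lintegral_const_mul' _ _ ENNReal.ofReal_ne_top]
  rw [← mul_assoc, ← ENNReal.ofReal_mul (by positivity)]
  congr 2
  field_simp

theorem exists_schwartzMap_scale (f : 𝓢(E3, ℂ)) {r : ℝ} (hr : 0 < r) (a : ℝ) :
    ∃ g : 𝓢(E3, ℂ), mass g = ENNReal.ofReal (a ^ 2 * r⁻¹ ^ 3) * mass f ∧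
      kin g = ENNReal.ofReal (a ^ 2 * r⁻¹) * kin f ∧
      pot g = ENNReal.ofReal (a ^ 4 * r⁻¹ ^ 5) * pot f := by
  let g : 𝓢(E3, ℂ) := a • SchwartzMap.compCLMOfContinuousLinearEquiv ℝ
    (ContinuousLinearEquiv.smulLeft (R₁ := ℝ) (M₁ := E3) (Units.mk0 r hr.ne')) f
  have hg : (g : E3 → ℂ) = fun x => a • f (r • x) := rfl
  refine ⟨g, ?_⟩
  rw [hg]
  exact ⟨mass_comp_smul _ hr a, kin_comp_smul f.differentiable hr a, pot_comp_smul _ hr a⟩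

theorem pot_lt_top (f : 𝓢(E3, ℂ)) : pot f < ∞ :=
  (pot_le f).trans_lt (ENNReal.mul_lt_top potC_lt_top (ENNReal.pow_lt_top
    (ENNReal.add_lt_top.2 ⟨mass_lt_top f, kin_lt_top f⟩)))

theorem toReal_mass (f : 𝓢(E3, ℂ)) : (mass f).toReal = ∫ x, ‖f x‖ ^ 2 := by
  rw [mass, lintegral_enorm_sq_eq, ENNReal.toReal_ofReal (by positivity)]

theorem toReal_pot (f : 𝓢(E3, ℂ)) :
    ∫ x, ∫ y, ‖f x‖ ^ 2 * ‖f y‖ ^ 2 / ‖x - y‖ = (pot f).toReal := by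
  have hf : Measurable f := f.continuous.measurable
  have h1 : ∀ x : E3, ∫ y, ‖f x‖ ^ 2 * ‖f y‖ ^ 2 / ‖x - y‖ =
      (∫⁻ y, ‖f x‖ₑ ^ 2 * ‖f y‖ₑ ^ 2 * ‖x - y‖ₑ⁻¹).toReal := fun x => by
    rw [integral_eq_lintegral_of_nonneg_ae (Eventually.of_forall fun y => by positivity)
      (Measurable.aestronglyMeasurable (by fun_prop))]
    congr 1
    refine lintegral_congr_ae ?_
    filter_upwards [compl_mem_ae_iff.2 (measure_singleton (μ := (volume : Measure E3)) x)] with y hy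
    have hxy : 0 < ‖x - y‖ := norm_pos_iff.2 (sub_ne_zero.2 fun h => hy h.symm)
    rw [div_eq_mul_inv, ENNReal.ofReal_mul (by positivity), ENNReal.ofReal_mul (by positivity),
      ENNReal.ofReal_inv_of_pos hxy, ENNReal.ofReal_pow (norm_nonneg _),
      ENNReal.ofReal_pow (norm_nonneg _), ofReal_norm, ofReal_norm, ofReal_norm]
  have hm : Measurable fun x => ∫⁻ y, ‖f x‖ₑ ^ 2 * ‖f y‖ₑ ^ 2 * ‖x - y‖ₑ⁻¹ :=
    Measurable.lintegral_prod_right' (f := fun p : E3 × E3 =>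
      ‖f p.1‖ₑ ^ 2 * ‖f p.2‖ₑ ^ 2 * ‖p.1 - p.2‖ₑ⁻¹) (by fun_prop)
  simp_rw [h1]
  exact integral_toReal hm.aemeasurable (ae_lt_top hm (pot_lt_top f).ne)

theorem pekarF_eq (f : 𝓢(E3, ℂ)) :
    pekarF f = 4 * π ^ 2 * (kin f).toReal - (pot f).toReal := by
  have h1 : ∫ x, ‖fderiv ℝ f x‖ ^ 2 = (∫⁻ x, ‖fderiv ℝ f x‖ₑ ^ 2).toReal := by
    rw [integral_eq_lintegral_of_nonneg_ae (f := fun x => ‖fderiv ℝ f x‖ ^ 2)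
      (Eventually.of_forall fun y => by positivity)
          (((f.smooth 1).continuous_fderiv one_ne_zero).norm.pow 2).aestronglyMeasurable]
    simp_rw [ENNReal.ofReal_pow (norm_nonneg _), ofReal_norm]
  rw [pekarF, toReal_pot, h1, kin, ENNReal.toReal_mul, ENNReal.toReal_inv,
    ENNReal.toReal_ofReal (by positivity), mul_inv_cancel_left₀ (by positivity)]

/-- Scaling form of the sharp inequality. -/
theorem pot_mul_le (f : 𝓢(E3, ℂ)) {r : ℝ} (hr : 0 < r) :
    (pot f).toReal * r ≤ potC.toReal * ((mass f).toReal + r ^ 2 * (kin f).toReal) ^ 2 := by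
  obtain ⟨g, hm, hk, hp⟩ := exists_schwartzMap_scale f hr 1
  have h := ENNReal.toReal_mono (ENNReal.mul_lt_top potC_lt_top (ENNReal.pow_lt_top
    (ENNReal.add_lt_top.2 ⟨mass_lt_top g, kin_lt_top g⟩))).ne (pot_le g)
  rw [ENNReal.toReal_mul, ENNReal.toReal_pow, ENNReal.toReal_add (mass_lt_top g).ne
    (kin_lt_top g).ne, hm, hk, hp] at h
  simp only [ENNReal.toReal_mul, ENNReal.toReal_ofReal (show (0:ℝ) ≤ 1 ^ 2 * r⁻¹ ^ 3 by positivity),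
    ENNReal.toReal_ofReal (show (0:ℝ) ≤ 1 ^ 2 * r⁻¹ by positivity),
    ENNReal.toReal_ofReal (show (0:ℝ) ≤ 1 ^ 4 * r⁻¹ ^ 5 by positivity)] at h
  have h2 := mul_le_mul_of_nonneg_left h (show 0 ≤ r ^ 6 by positivity)
  refine (le_of_eq ?_).trans (h2.trans (le_of_eq ?_))
  · field_simp
  · rw [mul_left_comm, show r ^ 6 = (r ^ 3) ^ 2 by ring, ← mul_pow]
    congr 2
    field_simp

theorem kin_optimizer {M t : ℝ} (hM : M + t ≤ 1) (hM0 : 0 ≤ M) (ht : 0 ≤ t)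
    (h : ∀ r : ℝ, 0 < r → r ≤ (M + r ^ 2 * t) ^ 2) : M = 3 / 4 ∧ t = 1 / 4 := by
  have h1 : ∀ s : ℝ, 0 < s → s ≤ M + s ^ 4 * t := fun s hs => by
    have := h (s ^ 2) (by positivity)
    have h2 := abs_le_of_sq_le_sq this (by positivity)
    rw [abs_of_pos hs] at h2
    linarith [h2, show (s ^ 2) ^ 2 * t = s ^ 4 * t by ring]
  have h2 : ∀ s : ℝ, 0 < s → (s - 1) * 1 ≤ (s - 1) * ((1 + s) * (1 + s ^ 2) * t) := fun s hs => by
    nlinarith [h1 s hs]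
  have hlim : Tendsto (fun s : ℝ => (1 + s) * (1 + s ^ 2) * t) (𝓝 1) (𝓝 (4 * t)) := by
    have : Continuous fun s : ℝ => (1 + s) * (1 + s ^ 2) * t := by fun_prop
    convert this.tendsto 1 using 2
    norm_num
  have hlo : 1 ≤ 4 * t := by
    refine ge_of_tendsto (hlim.mono_left (nhdsWithin_le_nhds (s := Set.Ioi 1))) ?_
    filter_upwards [self_mem_nhdsWithin] with s hs
    have hs : 1 < s := hs
    exact le_of_mul_le_mul_left (h2 s (by linarith)) (by linarith)
  have hhi : 4 * t ≤ 1 := by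
    refine le_of_tendsto (hlim.mono_left (nhdsWithin_le_nhds (s := Set.Iio 1))) ?_
    filter_upwards [self_mem_nhdsWithin, nhdsWithin_le_nhds (lt_mem_nhds zero_lt_one)] with s hs h0
    have hs : s < 1 := hs
    have := h2 s h0
    nlinarith
  have ht' : t = 1 / 4 := by linarith
  have h3 := h1 1 one_pos
  constructor <;> linarith

theorem exists_optimizer : ∃ f : 𝓢(E3, ℂ), (mass f).toReal = 3 / 4 ∧ (kin f).toReal = 1 / 4 ∧
    (pot f).toReal = potC.toReal := by
  obtain ⟨f, h1, hp⟩ := exists_pot_eq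
  have hC : 0 < potC.toReal := ENNReal.toReal_pos potC_ne_zero potC_lt_top.ne
  have hs : (mass f).toReal + (kin f).toReal ≤ 1 := by
    rw [← ENNReal.toReal_add (mass_lt_top f).ne (kin_lt_top f).ne]
    exact ENNReal.toReal_le_of_le_ofReal zero_le_one (by simpa using h1)
  obtain ⟨hM, ht⟩ := kin_optimizer hs ENNReal.toReal_nonneg ENNReal.toReal_nonneg fun r hr => by
    have := pot_mul_le f hr
    rw [hp] at this
    exact le_of_mul_le_mul_left this hC
  exact ⟨f, hM, ht, by rw [hp]⟩

theorem energy_le {C t D r : ℝ} (hC : 0 < C) (ht : 0 ≤ t) (hr : r = 2 * C / (3 * π ^ 2))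
    (h : ∀ s : ℝ, 0 < s → D * s ≤ C * (1 + s ^ 2 * t) ^ 2) :
    4 * π ^ 2 * (r ^ 2 / 3) - 16 / 9 * r * C ≤ 4 * π ^ 2 * t - D := by
  have hr0 : 0 < r := by rw [hr]; positivity
  have hrC : C = 3 * π ^ 2 * r / 2 := by rw [hr]; field_simp
  have hπ : 0 < π ^ 2 := by positivity
  rcases ht.eq_or_lt with rfl | ht
  · have h1 := h (2 / r) (by positivity)
    have h2 : D ≤ C * r / 2 := by
      have : D * (2 / r) * (r / 2) ≤ C * (1 + (2 / r) ^ 2 * 0) ^ 2 * (r / 2) := by gcongr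
      rw [mul_assoc, div_mul_div_cancel₀ hr0.ne'] at this
      linarith
    rw [hrC] at h2 ⊢
    have : 0 ≤ π ^ 2 * r ^ 2 := by positivity
    nlinarith
  · set s := √(3 * t) with hs
    have hs0 : 0 < s := Real.sqrt_pos.2 (by positivity)
    have hst : t = s ^ 2 / 3 := by rw [hs, Real.sq_sqrt (by positivity)]; ring
    have h1 := h s⁻¹ (by positivity)
    have h2 : D ≤ 16 / 9 * C * s := by
      have h3 : 1 + s⁻¹ ^ 2 * t = 4 / 3 := by rw [hst]; field_simp; norm_num
      rw [h3] at h1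
      have : D * s⁻¹ * s ≤ C * (4 / 3) ^ 2 * s := by gcongr
      rw [mul_assoc, inv_mul_cancel₀ hs0.ne'] at this
      linarith
    rw [hst]
    rw [hrC] at h2 ⊢
    nlinarith [mul_nonneg hπ.le (sq_nonneg (s - r))]

end Pekar

end

/-- Existence of a normalized minimizer of the Pekar functional. -/
theorem pekar_minimizer_exists :
    ∃ ψPek : SchwartzMap E3 ℂ, (∫ x : E3, ‖ψPek x‖ ^ 2) = 1 ∧
      ∀ ψ : SchwartzMap E3 ℂ, (∫ x : E3, ‖ψ x‖ ^ 2) = 1 →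
        pekarF ψPek ≤ pekarF ψ := by
  obtain ⟨f, hM, ht, hp⟩ := Pekar.exists_optimizer
  have hC : 0 < Pekar.potC.toReal :=
    ENNReal.toReal_pos Pekar.potC_ne_zero Pekar.potC_lt_top.ne
  set r : ℝ := 2 * Pekar.potC.toReal / (3 * π ^ 2) with hr
  have hr0 : 0 < r := by positivity
  set a : ℝ := √(4 * r ^ 3 / 3) with ha
  have ha2 : a ^ 2 = 4 * r ^ 3 / 3 := Real.sq_sqrt (by positivity)
  have ha4 : a ^ 4 = (4 * r ^ 3 / 3) ^ 2 := by rw [← ha2]; ring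
  obtain ⟨g, hgm, hgk, hgp⟩ := Pekar.exists_schwartzMap_scale f hr0 a
  refine ⟨g, ?_, fun ψ hψ => ?_⟩
  · rw [← Pekar.toReal_mass, hgm, ENNReal.toReal_mul,
      ENNReal.toReal_ofReal (by positivity), hM, ha2]
    field_simp
  · have hk : (Pekar.kin g).toReal = r ^ 2 / 3 := by
      rw [hgk, ENNReal.toReal_mul, ENNReal.toReal_ofReal (by positivity), ht, ha2]
      field_simp
    have hD : (Pekar.pot g).toReal = 16 / 9 * r * Pekar.potC.toReal := by
      rw [hgp, ENNReal.toReal_mul, ENNReal.toReal_ofReal (by positivity), hp, ha4]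
      field_simp
      norm_num
    rw [Pekar.pekarF_eq, Pekar.pekarF_eq, hk, hD]
    refine Pekar.energy_le hC ENNReal.toReal_nonneg hr fun s hs => ?_
    rw [← Pekar.toReal_mass] at hψ
    have := Pekar.pot_mul_le ψ hs
    rwa [hψ] at this

end
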